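/- arXiv:2207.07204 — 4 statements merged into one kernel-verified Lean document; each statement's English description precedes it below -/
import Mathlib

section
/- Let K be a number field, let A be a set of nonzero prime ideals of the ring of integers of K, and let δ ≥ 0 be real. Suppose #{𝔭 ∈ A : N𝔭 ≤ x} = δ·Li(x) + o(x/(log x)^2) as x → ∞. Let b ≥ 2 and let S be a positive integer with b^{m−1} ≤ S < b^m for some m ≥ 1, and let A_{b,S} = {𝔭 ∈ A : N𝔭 begins with the base-b string S}. Then lim_{x→∞} (1/log log x) · ∑_{𝔭 ∈ A_{b,S}, N𝔭 ≤ x} 1/N𝔭 = δ·log_b(1 + 1/S). -/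
open Filter Asymptotics Real NumberField

lemma bf_li : Tendsto (fun x : ℝ => (∫ t in (2 : ℝ)..x, 1 / Real.log t) / (x / Real.log x))
    atTop (nhds 1) := by
  have hO := Chebyshev.integral_one_div_log_sq_isBigO
  have key : ∀ x : ℝ, 2 ≤ x → ∫ t in (2 : ℝ)..x, 1 / Real.log t =
      x / log x - 2 / log 2 + ∫ t in (2 : ℝ)..x, 1 / log t ^ 2 := by
    intro x hx
    have hpos : ∀ t ∈ Set.uIcc 2 x, 0 < log t := by
      intro t ht
      rw [Set.uIcc_of_le hx] at ht
      exact Real.log_pos (by linarith [ht.1])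
    have hne : ∀ t ∈ Set.uIcc 2 x, t ≠ 0 := by
      intro t ht
      rw [Set.uIcc_of_le hx] at ht
      linarith [ht.1]
    have hi2 : IntervalIntegrable (fun t : ℝ => 1 / log t ^ 2) MeasureTheory.volume 2 x :=
      Chebyshev.intervalIntegrable_one_div_log_sq (by norm_num) (by linarith)
    have hi1 : IntervalIntegrable (fun t : ℝ => 1 / log t) MeasureTheory.volume 2 x := by
      apply ContinuousOn.intervalIntegrable
      intro t ht
      exact ((continuousAt_const).div (Real.continuousAt_log (hne t ht))
        (hpos t ht).ne').continuousWithinAt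
    have h := intervalIntegral.integral_eq_sub_of_hasDerivAt (f := fun t => t / log t)
      (f' := fun t => 1 / log t - 1 / log t ^ 2) (a := 2) (b := x) (by
        intro t ht
        have := (hasDerivAt_id t).div (Real.hasDerivAt_log (hne t ht)) (hpos t ht).ne'
        convert! this using 1
        have := hpos t ht
        have := hne t ht
        simp only [id]
        field_simp) (hi1.sub hi2)
    rw [intervalIntegral.integral_sub hi1 hi2] at h
    linarith
  have hlogx : Tendsto (fun x : ℝ => log x / x) atTop (nhds 0) :=
    (Real.isLittleO_log_id_atTop).tendsto_div_nhds_zero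
  have h2 : Tendsto (fun x : ℝ => (∫ t in (2 : ℝ)..x, 1 / log t ^ 2) / (x / log x))
      atTop (nhds 0) := by
    apply IsLittleO.tendsto_div_nhds_zero
    refine hO.trans_isLittleO ?_
    have hinv : (fun x : ℝ => (log x)⁻¹) =o[atTop] (fun _ => (1 : ℝ)) :=
      (isLittleO_one_iff ℝ).2 Real.tendsto_log_atTop.inv_tendsto_atTop
    have := hinv.mul_isBigO (isBigO_refl (fun x : ℝ => x / log x) atTop)
    refine this.congr (fun x => by ring) (fun x => by ring)
  have h3 : Tendsto (fun x : ℝ => 1 - 2 / log 2 * (log x / x) +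
      (∫ t in (2 : ℝ)..x, 1 / log t ^ 2) / (x / log x)) atTop (nhds 1) := by
    simpa using (tendsto_const_nhds.sub (hlogx.const_mul (2 / log 2))).add h2
  refine h3.congr' ?_
  filter_upwards [eventually_ge_atTop 2] with x hx
  rw [key x hx]
  have : 0 < log x := Real.log_pos (by linarith)
  have : 0 < log 2 := Real.log_pos (by norm_num)
  have : 0 < x := by linarith
  rw [add_div, sub_div, div_self (by positivity)]
  field_simp

/-- counting function asymptotic -/
lemma bf_phi (P : ℝ → ℝ) (δ : ℝ)
    (h : (fun x : ℝ => P x - δ * ∫ t in (2 : ℝ)..x, 1 / Real.log t)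
        =o[atTop] fun x : ℝ => x / (Real.log x) ^ 2) :
    Tendsto (fun x => P x / (x / log x)) atTop (nhds δ) := by
  have h1 : (fun x : ℝ => x / (Real.log x) ^ 2) =O[atTop] (fun x : ℝ => x / log x) := by
    have hinv : (fun x : ℝ => (log x)⁻¹) =o[atTop] (fun _ => (1 : ℝ)) :=
      (isLittleO_one_iff ℝ).2 Real.tendsto_log_atTop.inv_tendsto_atTop
    have := (hinv.mul_isBigO (isBigO_refl (fun x : ℝ => x / log x) atTop)).isBigO
    refine this.congr (fun x => by ring) (fun x => by ring)
  have h2 := (h.trans_isBigO h1).tendsto_div_nhds_zero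
  have h3 := h2.add (bf_li.const_mul δ)
  simp only [zero_add, mul_one] at h3
  refine h3.congr (fun x => ?_)
  ring

lemma bf_unif (P : ℝ → ℝ) (δ : ℝ) (h : Tendsto (fun x => P x / (x / log x)) atTop (nhds δ))
    (b : ℝ) (hb : 1 < b) (α β : ℝ) (hα : 0 < α) :
    Tendsto (fun p : ℕ × ℝ => p.1 * (P (b ^ p.1 * p.2) / (b ^ p.1 * p.2)))
      (atTop ×ˢ 𝓟 (Set.Icc α β)) (nhds (δ / log b)) := by
  have hfst : Tendsto (fun p : ℕ × ℝ => p.1) (atTop ×ˢ 𝓟 (Set.Icc α β)) atTop := tendsto_fst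
  have hsnd : ∀ᶠ p : ℕ × ℝ in (atTop ×ˢ 𝓟 (Set.Icc α β)), p.2 ∈ Set.Icc α β :=
    tendsto_snd.eventually (eventually_mem_set.2 (mem_principal_self _))
  have hlb : 0 < log b := Real.log_pos hb
  have hu : Tendsto (fun p : ℕ × ℝ => b ^ p.1 * p.2) (atTop ×ˢ 𝓟 (Set.Icc α β)) atTop := by
    refine tendsto_atTop_mono' _ ?_
      (((tendsto_pow_atTop_atTop_of_one_lt hb).comp hfst).atTop_mul_const hα)
    filter_upwards [hsnd] with p hp
    have : 0 < b ^ p.1 := by positivity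
    exact mul_le_mul_of_nonneg_left hp.1 this.le
  have h1 := h.comp hu
  have hz : Tendsto (fun p : ℕ × ℝ => (|log α| + |log β|) / (p.1 : ℝ))
      (atTop ×ˢ 𝓟 (Set.Icc α β)) (nhds 0) :=
    (tendsto_const_div_atTop_nhds_zero_nat _).comp hfst
  have h2 : Tendsto (fun p : ℕ × ℝ => log p.2 / (p.1 : ℝ))
      (atTop ×ˢ 𝓟 (Set.Icc α β)) (nhds 0) := by
    refine squeeze_zero_norm' ?_ hz
    filter_upwards [hsnd] with p hp
    rw [norm_div, Real.norm_eq_abs, Real.norm_eq_abs, Nat.abs_cast]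
    gcongr
    have a1 := Real.log_le_log hα hp.1
    have a2 := Real.log_le_log (hα.trans_le hp.1) hp.2
    rw [abs_le]
    constructor
    · linarith [neg_abs_le (log α), abs_nonneg (log β)]
    · linarith [le_abs_self (log β), abs_nonneg (log α)]
  have h3 : Tendsto (fun p : ℕ × ℝ => (log b + log p.2 / (p.1 : ℝ))⁻¹)
      (atTop ×ˢ 𝓟 (Set.Icc α β)) (nhds (log b)⁻¹) := by
    have := (tendsto_const_nhds (x := log b)).add h2
    rw [add_zero] at this
    exact this.inv₀ hlb.ne'
  have h4 := h1.mul h3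
  rw [← div_eq_mul_inv] at h4
  refine h4.congr' ?_
  filter_upwards [hsnd, hfst.eventually (eventually_ge_atTop 1),
    hu.eventually (eventually_gt_atTop 1)] with p hp hp1 hp2
  have hp0 : 0 < p.2 := hα.trans_le hp.1
  have ht : (0 : ℝ) < p.1 := by exact_mod_cast hp1
  have hbt : 0 < b ^ p.1 := by positivity
  have hl : log (b ^ p.1 * p.2) = p.1 * (log b + log p.2 / p.1) := by
    rw [Real.log_mul hbt.ne' hp0.ne', Real.log_pow]
    field_simp
  have hl0 := Real.log_pos hp2
  simp only [Function.comp]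
  rw [hl] at hl0 ⊢
  have hq : 0 < log b + log p.2 / p.1 := by
    exact (mul_pos_iff_of_pos_left ht).1 hl0
  generalize log b + log p.2 / p.1 = q at *
  field_simp

lemma bf_abel (c : ℕ → ℝ) (n₀ n₁ : ℕ) (h0 : 0 < n₀) (h01 : n₀ ≤ n₁) (τ L ε : ℝ)
    (h : ∀ u ∈ Set.Icc (n₀ : ℝ) n₁, |τ * ((∑ k ∈ Finset.Icc 0 ⌊u⌋₊, c k) / u) - L| ≤ ε) :
    |τ * ∑ k ∈ Finset.Ioc n₀ n₁, c k / k - L * log ((n₁ : ℝ) / n₀)| ≤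
      ε * (2 + log ((n₁ : ℝ) / n₀)) := by
  have h0' : (0 : ℝ) < n₀ := by exact_mod_cast h0
  have h01' : (n₀ : ℝ) ≤ n₁ := by exact_mod_cast h01
  have h1' : (0 : ℝ) < n₁ := h0'.trans_le h01'
  have hne : ∀ t ∈ Set.Icc (n₀ : ℝ) n₁, t ≠ 0 := fun t ht => (h0'.trans_le ht.1).ne'
  have hderiv : deriv (fun t : ℝ => t⁻¹) = fun t => -(t ^ 2)⁻¹ := by
    ext t; simp
  have hint : MeasureTheory.IntegrableOn (deriv (fun t : ℝ => t⁻¹)) (Set.Icc (n₀ : ℝ) n₁) := by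
    rw [hderiv]
    apply ContinuousOn.integrableOn_Icc
    intro t ht
    have := hne t ht
    apply ContinuousAt.continuousWithinAt
    have : t ^ 2 ≠ 0 := by positivity
    fun_prop (disch := assumption)
  have hab := sum_mul_eq_sub_sub_integral_mul' (f := fun t : ℝ => t⁻¹) c h01
    (fun t ht => differentiableAt_inv (hne t ht)) hint
  have hint2 := (integrableOn_mul_sum_Icc c (m := 0) h0'.le hint)
  rw [← intervalIntegral.integral_of_le h01'] at hab
  rw [← intervalIntegrable_iff_integrableOn_Icc_of_le h01'] at hint2
  rw [hderiv] at hab hint2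
  have hinv : IntervalIntegrable (fun t : ℝ => t⁻¹) MeasureTheory.volume n₀ n₁ := by
    apply ContinuousOn.intervalIntegrable
    rw [Set.uIcc_of_le h01']
    intro t ht
    exact (continuousAt_inv₀ (hne t ht)).continuousWithinAt
  have hlog : ∫ t in (n₀ : ℝ)..n₁, t⁻¹ = log ((n₁ : ℝ) / n₀) := integral_inv_of_pos h0' h1'
  have hI : |(-τ) * (∫ t in (n₀ : ℝ)..n₁, -(t ^ 2)⁻¹ * ∑ k ∈ Finset.Icc 0 ⌊t⌋₊, c k)
      - L * log ((n₁ : ℝ) / n₀)| ≤ ε * log ((n₁ : ℝ) / n₀) := by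
    rw [← hlog, ← intervalIntegral.integral_const_mul, ← intervalIntegral.integral_const_mul,
      ← intervalIntegral.integral_const_mul,
      ← intervalIntegral.integral_sub (hint2.const_mul _) (hinv.const_mul _), ← Real.norm_eq_abs]
    refine intervalIntegral.norm_integral_le_of_norm_le h01' ?_ (hinv.const_mul _)
    refine Eventually.of_forall (fun t ht => ?_)
    have ht' : t ∈ Set.Icc (n₀ : ℝ) n₁ := ⟨ht.1.le, ht.2⟩
    have h0t : 0 < t := h0'.trans ht.1
    have : -τ * (-(t ^ 2)⁻¹ * ∑ k ∈ Finset.Icc 0 ⌊t⌋₊, c k) - L * t⁻¹ =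
      (τ * ((∑ k ∈ Finset.Icc 0 ⌊t⌋₊, c k) / t) - L) * t⁻¹ := by
      field_simp
    rw [this, norm_mul, Real.norm_eq_abs, norm_of_nonneg (inv_nonneg.2 h0t.le)]
    exact mul_le_mul_of_nonneg_right (h t ht') (inv_nonneg.2 h0t.le)
  have e0 := h n₀ ⟨le_rfl, h01'⟩
  have e1 := h n₁ ⟨h01', le_rfl⟩
  rw [Nat.floor_natCast] at e0 e1
  have hs : ∑ k ∈ Finset.Ioc n₀ n₁, c k / k = ∑ k ∈ Finset.Ioc n₀ n₁, (k : ℝ)⁻¹ * c k :=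
    Finset.sum_congr rfl (fun k _ => by ring)
  rw [hs, hab]
  rw [abs_le] at *
  rw [div_eq_mul_inv _ (n₀ : ℝ)] at e0
  rw [div_eq_mul_inv _ (n₁ : ℝ)] at e1
  constructor <;> linarith [e0.1, e0.2, e1.1, e1.2, hI.1, hI.2]

lemma bf_block (c : ℕ → ℝ) (δ : ℝ)
    (h : Tendsto (fun x : ℝ => (∑ k ∈ Finset.Icc 0 ⌊x⌋₊, c k) / (x / log x)) atTop (nhds δ))
    (b S : ℕ) (hb : 2 ≤ b) (hS : 1 ≤ S) :
    Tendsto (fun t : ℕ => (t : ℝ) * ∑ k ∈ Finset.Ico (S * b ^ t) ((S + 1) * b ^ t), c k / k)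
      atTop (nhds (δ / log b * log (1 + 1 / (S : ℝ)))) := by
  have hb1 : (1 : ℝ) < b := by exact_mod_cast hb
  have hS0 : (0 : ℝ) < S := by exact_mod_cast hS
  have hU := bf_unif _ δ h b hb1 (S / 2) (S + 1) (by positivity)
  set L := δ / log b with hL
  have hpow : Tendsto (fun t : ℕ => ((b : ℝ) ^ t)⁻¹) atTop (nhds 0) :=
    (tendsto_pow_atTop_atTop_of_one_lt hb1).inv_tendsto_atTop
  -- the ratio
  set n₀ : ℕ → ℕ := fun t => S * b ^ t - 1 with hn₀
  set n₁ : ℕ → ℕ := fun t => (S + 1) * b ^ t - 1 with hn₁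
  have hc0 : ∀ t, ((n₀ t : ℕ) : ℝ) = S * b ^ t - 1 := by
    intro t
    have : 1 ≤ S * b ^ t := Nat.mul_pos hS (by positivity)
    simp only [hn₀]
    push_cast [Nat.cast_sub this]
    ring
  have hc1 : ∀ t, ((n₁ t : ℕ) : ℝ) = (S + 1) * b ^ t - 1 := by
    intro t
    have : 1 ≤ (S + 1) * b ^ t := Nat.mul_pos (by omega) (by positivity)
    simp only [hn₁]
    push_cast [Nat.cast_sub this]
    ring
  have hratio : Tendsto (fun t => log ((n₁ t : ℝ) / n₀ t)) atTop
      (nhds (log (1 + 1 / (S : ℝ)))) := by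
    have h1 : Tendsto (fun t : ℕ => (((S : ℝ) + 1) - ((b : ℝ) ^ t)⁻¹) / ((S : ℝ) - ((b : ℝ) ^ t)⁻¹))
        atTop (nhds (((S : ℝ) + 1 - 0) / ((S : ℝ) - 0))) :=
      (tendsto_const_nhds.sub hpow).div (tendsto_const_nhds.sub hpow) (by simpa using hS0.ne')
    have e : ((S : ℝ) + 1 - 0) / ((S : ℝ) - 0) = 1 + 1 / (S : ℝ) := by
      rw [sub_zero, sub_zero, add_div, div_self hS0.ne']
    rw [e] at h1
    have h2 := h1.log (by positivity)
    refine h2.congr (fun t => ?_)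
    have hbt : (0 : ℝ) < (b : ℝ) ^ t := by positivity
    congr 1
    rw [hc0, hc1, ← mul_div_mul_left _ _ hbt.ne', mul_sub, mul_sub, mul_inv_cancel₀ hbt.ne']
    ring
  have hmain : Tendsto (fun t : ℕ => (t : ℝ) *
      ∑ k ∈ Finset.Ico (S * b ^ t) ((S + 1) * b ^ t), c k / k - L * log ((n₁ t : ℝ) / n₀ t))
      atTop (nhds 0) := by
    rw [Metric.tendsto_atTop']
    intro ε hε
    set M := 2 + (log (1 + 1 / (S : ℝ)) + 1) with hM
    have hlpos : 0 ≤ log (1 + 1 / (S : ℝ)) := Real.log_nonneg (by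
      have : 0 < 1 / (S : ℝ) := by positivity
      linarith)
    have hMpos : 0 < M := by positivity
    have hη : 0 < ε / (2 * M) := by positivity
    have h1 := hU.eventually (Metric.closedBall_mem_nhds L hη)
    rw [eventually_prod_principal_iff] at h1
    have h2 := hratio.eventually (Iio_mem_nhds (lt_add_one (log (1 + 1 / (S : ℝ)))))
    have h3 := (h1.and h2).and (eventually_ge_atTop 1)
    obtain ⟨N, hN⟩ := eventually_atTop.1 h3
    refine ⟨N, fun t ht => ?_⟩
    obtain ⟨⟨g1, g2⟩, g3⟩ := hN t (le_of_lt ht)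
    have hbt : (b : ℝ) ≤ (b : ℝ) ^ t := le_self_pow₀ hb1.le (by omega)
    have hbt2 : (2 : ℝ) ≤ (b : ℝ) ^ t := le_trans (by exact_mod_cast hb) hbt
    have hbtn : 2 ≤ b ^ t := by exact_mod_cast hbt2
    have hSb : 2 ≤ S * b ^ t := by nlinarith
    have hico : Finset.Ico (S * b ^ t) ((S + 1) * b ^ t) = Finset.Ioc (n₀ t) (n₁ t) := by
      ext k
      have : S * b ^ t ≤ (S + 1) * b ^ t := Nat.mul_le_mul_right _ (by omega)
      simp only [Finset.mem_Ico, Finset.mem_Ioc, hn₀, hn₁]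
      omega
    have hle : n₀ t ≤ n₁ t := by
      have : S * b ^ t ≤ (S + 1) * b ^ t := Nat.mul_le_mul_right _ (by omega)
      simp only [hn₀, hn₁]
      omega
    have hab := bf_abel c (n₀ t) (n₁ t) (by simp only [hn₀]; omega) hle t L (ε / (2 * M)) (by
      intro u hu
      rw [hc0, hc1] at hu
      have hbt0 : (0 : ℝ) < (b : ℝ) ^ t := by linarith
      have := g1 (u / b ^ t) (by
        constructor
        · rw [le_div_iff₀ hbt0]
          have : (1 : ℝ) ≤ S := by exact_mod_cast hS
          nlinarith [hu.1]
        · rw [div_le_iff₀ hbt0]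
          linarith [hu.2])
      simp only [mul_div_cancel₀ u hbt0.ne'] at this
      simpa [Real.dist_eq] using this)
    rw [hico, Real.dist_eq, sub_zero]
    refine hab.trans_lt ?_
    have : ε / (2 * M) * (2 + log ((n₁ t : ℝ) / n₀ t)) ≤ ε / (2 * M) * M := by
      apply mul_le_mul_of_nonneg_left _ hη.le
      linarith
    have e : ε / (2 * M) * M = ε / 2 := by field_simp
    linarith
  have := hmain.add (hratio.const_mul L)
  simpa using this

lemma bf_cesaro (T : ℕ → ℝ) (M : ℝ) (h : Tendsto (fun t : ℕ => (t : ℝ) * T t) atTop (nhds M)) :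
    Tendsto (fun n : ℕ => (∑ t ∈ Finset.range n, T t) / log n) atTop (nhds M) := by
  have hlog : Tendsto (fun n : ℕ => log (n : ℝ)) atTop atTop :=
    Real.tendsto_log_atTop.comp tendsto_natCast_atTop_atTop
  have hgam : Tendsto (fun n : ℕ => (harmonic n : ℝ) - log n) atTop
      (nhds Real.eulerMascheroniConstant) := Real.tendsto_harmonic_sub_log
  have hh : Tendsto (fun n : ℕ => (harmonic n : ℝ) / log n) atTop (nhds 1) := by
    have := (hgam.div_atTop hlog).add_const 1
    rw [zero_add] at this
    refine this.congr' ?_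
    filter_upwards [hlog.eventually (eventually_gt_atTop 0)] with n hn
    field_simp
    ring
  have hharm : ∀ n, (harmonic n : ℝ) = ∑ i ∈ Finset.range n, ((i : ℝ) + 1)⁻¹ := by
    intro n; simp [harmonic]
  have hatTop : Tendsto (fun n : ℕ => ∑ i ∈ Finset.range n, ((i : ℝ) + 1)⁻¹) atTop atTop := by
    have := hgam.add_atTop hlog
    refine this.congr (fun n => ?_)
    rw [← hharm]; ring
  have hT : Tendsto (fun t : ℕ => ((t : ℝ) + 1) * T t) atTop (nhds M) := by
    have h1 : Tendsto (fun t : ℕ => ((t : ℝ))⁻¹) atTop (nhds 0) :=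
      tendsto_inv_atTop_nhds_zero_nat
    have h2 := h.add (h1.mul h)
    rw [zero_mul, add_zero] at h2
    refine h2.congr' ?_
    filter_upwards [eventually_ge_atTop 1] with t ht
    have : (0 : ℝ) < t := by exact_mod_cast ht
    field_simp
  have ho : (fun t : ℕ => T t - M * ((t : ℝ) + 1)⁻¹) =o[atTop] (fun t : ℕ => ((t : ℝ) + 1)⁻¹) := by
    rw [isLittleO_iff_tendsto (fun t ht => by
      have : ((t : ℝ) + 1)⁻¹ ≠ 0 := by positivity
      exact absurd ht this)]
    have := hT.sub_const M
    rw [sub_self] at this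
    refine this.congr (fun t => ?_)
    have : (0 : ℝ) < (t : ℝ) + 1 := by positivity
    field_simp
  have hs := ho.sum_range (fun t => by positivity) hatTop
  have h0 := hs.tendsto_div_nhds_zero
  have h1 := (h0.add_const M).mul hh
  rw [zero_add, mul_one] at h1
  refine h1.congr' ?_
  filter_upwards [hlog.eventually (eventually_gt_atTop 0),
    hatTop.eventually (eventually_gt_atTop 0)] with n hn hn2
  rw [hharm, Finset.sum_sub_distrib, ← Finset.mul_sum]
  generalize ∑ i ∈ Finset.range n, ((i : ℝ) + 1)⁻¹ = H at *
  field_simp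
  ring

lemma bf_loglog (b S : ℕ) (hb : 2 ≤ b) (hS : 1 ≤ S) (τ : ℝ → ℕ)
    (h1 : ∀ x : ℝ, (S : ℝ) ≤ x → (S : ℝ) * b ^ τ x ≤ x)
    (h2 : ∀ x : ℝ, (S : ℝ) ≤ x → x < (S : ℝ) * b ^ (τ x + 1)) :
    Tendsto τ atTop atTop ∧
    Tendsto (fun x => log (τ x) / log (log x)) atTop (nhds 1) := by
  have hb1 : (1 : ℝ) < b := by exact_mod_cast hb
  have hS0 : (0 : ℝ) < S := by exact_mod_cast hS
  have hlb : 0 < log b := Real.log_pos hb1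
  have hτ : Tendsto τ atTop atTop := by
    rw [tendsto_atTop]
    intro n
    filter_upwards [eventually_ge_atTop (S : ℝ), eventually_ge_atTop ((S : ℝ) * b ^ n)] with x hx hx2
    have := hx2.trans_lt (h2 x hx)
    have := lt_of_mul_lt_mul_left this hS0.le
    have := (pow_lt_pow_iff_right₀ hb1).1 this
    omega
  refine ⟨hτ, ?_⟩
  have hτR : Tendsto (fun x => (τ x : ℝ)) atTop atTop := tendsto_natCast_atTop_atTop.comp hτ
  have hll : Tendsto (fun x : ℝ => log (log x)) atTop atTop :=
    Real.tendsto_log_atTop.comp Real.tendsto_log_atTop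
  have hr : Tendsto (fun x => log x / τ x) atTop (nhds (log b)) := by
    have z : ∀ C : ℝ, Tendsto (fun x => log b + C / (τ x : ℝ)) atTop (nhds (log b)) := by
      intro C
      simpa using (tendsto_const_nhds (x := log (b : ℝ))).add (hτR.const_div_atTop C)
    refine tendsto_of_tendsto_of_tendsto_of_le_of_le' (z (log S)) (z (log S + log b)) ?_ ?_
    · filter_upwards [eventually_ge_atTop (S : ℝ), hτR.eventually (eventually_gt_atTop 0)] with x hx hp
      have := Real.log_le_log (by positivity) (h1 x hx)
      rw [Real.log_mul hS0.ne' (by positivity), Real.log_pow] at this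
      rw [le_div_iff₀ hp, add_mul, div_mul_cancel₀ _ hp.ne']
      linarith
    · filter_upwards [eventually_ge_atTop (S : ℝ), hτR.eventually (eventually_gt_atTop 0)] with x hx hp
      have := Real.log_le_log (by linarith) (h2 x hx).le
      rw [Real.log_mul hS0.ne' (by positivity), Real.log_pow] at this
      push_cast at this
      rw [div_le_iff₀ hp, add_mul, div_mul_cancel₀ _ hp.ne']
      linarith
  have h3 := (hr.log hlb.ne').div_atTop hll
  have h4 := (tendsto_const_nhds (x := (1 : ℝ))).sub h3
  rw [sub_zero] at h4
  refine h4.congr' ?_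
  filter_upwards [Real.tendsto_log_atTop.eventually (eventually_gt_atTop 0),
    hll.eventually (eventually_gt_atTop 0), hτR.eventually (eventually_gt_atTop 0)] with x a1 a2 a3
  rw [Real.log_div a1.ne' a3.ne']
  field_simp
  ring

lemma bf_real (c : ℕ → ℝ) (hc : ∀ n, 0 ≤ c n) (δ : ℝ)
    (h : Tendsto (fun x : ℝ => (∑ k ∈ Finset.Icc 0 ⌊x⌋₊, c k) / (x / log x)) atTop (nhds δ))
    (b S m : ℕ) (hb : 2 ≤ b) (hm : 1 ≤ m)
    (hS₁ : b ^ (m - 1) ≤ S) (hS₂ : S < b ^ m) (U : ℝ → ℝ)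
    (hU : ∀ x, 0 ≤ x → ∀ s : Finset ℕ, (∀ n, n ∈ s ↔ n ≤ ⌊x⌋₊ ∧
      ∃ t : ℕ, S * b ^ t ≤ n ∧ n < (S + 1) * b ^ t) → U x = ∑ n ∈ s, c n / n) :
    Tendsto (fun x => U x / log (log x)) atTop (nhds (δ * Real.logb b (1 + 1 / (S : ℝ)))) := by
  have hb1 : (1 : ℝ) < b := by exact_mod_cast hb
  have hS : 1 ≤ S := le_trans (Nat.one_le_pow _ _ (by omega)) hS₁
  have hS0 : (0 : ℝ) < S := by exact_mod_cast hS
  have hSb : S + 1 ≤ S * b := by nlinarith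
  set B : ℕ → Finset ℕ := fun t => Finset.Ico (S * b ^ t) ((S + 1) * b ^ t) with hB
  set T : ℕ → ℝ := fun t => ∑ k ∈ B t, c k / k with hT
  have hblock := bf_block c δ h b S hb hS
  have hces := bf_cesaro T _ hblock
  have hTz : Tendsto T atTop (nhds 0) := by
    have h1 := hblock.mul (tendsto_inv_atTop_nhds_zero_nat (𝕜 := ℝ))
    rw [mul_zero] at h1
    refine h1.congr' ?_
    filter_upwards [eventually_ge_atTop 1] with t ht
    have : (0 : ℝ) < t := by exact_mod_cast ht
    simp only [hT, hB]
    field_simp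
  set τ : ℝ → ℕ := fun x => Nat.log b (⌊x⌋₊ / S) with hτ
  have key : ∀ x : ℝ, (S : ℝ) ≤ x → S * b ^ τ x ≤ ⌊x⌋₊ ∧ ⌊x⌋₊ < S * b ^ (τ x + 1) := by
    intro x hx
    have hq : 1 ≤ ⌊x⌋₊ / S := by
      rw [Nat.le_div_iff_mul_le (by omega), one_mul]
      exact Nat.le_floor hx
    constructor
    · have := Nat.pow_log_le_self b (x := ⌊x⌋₊ / S) (by omega)
      rw [Nat.le_div_iff_mul_le (by omega)] at this
      rw [mul_comm]; exact this
    · have := Nat.lt_pow_succ_log_self (b := b) (by omega) (⌊x⌋₊ / S)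
      rw [Nat.div_lt_iff_lt_mul (by omega)] at this
      rw [mul_comm]; exact this
  obtain ⟨hτ1, hτ2⟩ := bf_loglog b S hb hS τ (by
    intro x hx
    have h0 : 0 ≤ x := by linarith
    have := (Nat.cast_le (α := ℝ)).2 (key x hx).1
    push_cast at this
    exact this.trans (Nat.floor_le h0)) (by
    intro x hx
    have h0 : 0 ≤ x := by linarith
    have := (Nat.floor_lt h0).1 (key x hx).2
    push_cast at this
    exact this)
  have hdisj : ∀ t u : ℕ, t < u → Disjoint (B t) (B u) := by
    intro t u htu
    rw [Finset.disjoint_left]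
    intro n h1 h2
    simp only [hB, Finset.mem_Ico] at h1 h2
    have : b ^ (t + 1) ≤ b ^ u := Nat.pow_le_pow_right (by omega) htu
    have h3 : (S + 1) * b ^ t ≤ S * b ^ (t + 1) := by
      rw [pow_succ, mul_comm (b ^ t), ← mul_assoc]
      exact Nat.mul_le_mul_right _ hSb
    have h4 : S * b ^ (t + 1) ≤ S * b ^ u := Nat.mul_le_mul_left _ this
    omega
  have hpd : ∀ s : Finset ℕ, ((s : Set ℕ)).PairwiseDisjoint B := by
    intro s t _ u _ htu
    rcases lt_or_gt_of_ne htu with h | h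
    · exact hdisj t u h
    · exact (hdisj u t h).symm
  have hnn : ∀ n : ℕ, 0 ≤ c n / n := fun n => div_nonneg (hc n) (by positivity)
  have bounds : ∀ x : ℝ, (S : ℝ) ≤ x → (∑ t ∈ Finset.range (τ x), T t) ≤ U x ∧
      U x ≤ (∑ t ∈ Finset.range (τ x), T t) + T (τ x) := by
    intro x hx
    classical
    have hs := hU x (by linarith) ((Finset.Icc 0 ⌊x⌋₊).filter (fun n =>
      ∃ t : ℕ, S * b ^ t ≤ n ∧ n < (S + 1) * b ^ t)) (by
        intro n; simp)
    rw [hs, ← Finset.sum_range_succ]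
    simp only [hT]
    rw [← Finset.sum_biUnion (hpd _), ← Finset.sum_biUnion (hpd _)]
    constructor
    · apply Finset.sum_le_sum_of_subset_of_nonneg
      · intro n hn
        simp only [Finset.mem_biUnion, Finset.mem_range, hB, Finset.mem_Ico] at hn
        obtain ⟨t, ht, hn1, hn2⟩ := hn
        simp only [Finset.mem_filter, Finset.mem_Icc, zero_le, true_and]
        refine ⟨?_, t, hn1, hn2⟩
        have h3 : (S + 1) * b ^ t ≤ S * b ^ (t + 1) := by
          rw [pow_succ, mul_comm (b ^ t), ← mul_assoc]
          exact Nat.mul_le_mul_right _ hSb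
        have : b ^ (t + 1) ≤ b ^ τ x := Nat.pow_le_pow_right (by omega) ht
        have h4 : S * b ^ (t + 1) ≤ S * b ^ τ x := Nat.mul_le_mul_left _ this
        have := (key x hx).1
        omega
      · intro n _ _; exact hnn n
    · apply Finset.sum_le_sum_of_subset_of_nonneg
      · intro n hn
        simp only [Finset.mem_filter, Finset.mem_Icc, zero_le, true_and] at hn
        obtain ⟨hn0, t, hn1, hn2⟩ := hn
        simp only [Finset.mem_biUnion, Finset.mem_range, hB, Finset.mem_Ico]
        refine ⟨t, ?_, hn1, hn2⟩
        have := (hn1.trans hn0).trans_lt (key x hx).2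
        have := Nat.lt_of_mul_lt_mul_left this
        exact (Nat.pow_lt_pow_iff_right (by omega)).1 this
      · intro n _ _; exact hnn n
  have hll : Tendsto (fun x : ℝ => log (log x)) atTop atTop :=
    Real.tendsto_log_atTop.comp Real.tendsto_log_atTop
  have hG : Tendsto (fun x => (∑ t ∈ Finset.range (τ x), T t) / log (log x)) atTop
      (nhds (δ * Real.logb b (1 + 1 / (S : ℝ)))) := by
    have h1 := (hces.comp hτ1).mul hτ2
    have e : δ / log b * log (1 + 1 / (S : ℝ)) * 1 = δ * Real.logb b (1 + 1 / (S : ℝ)) := by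
      rw [Real.logb]; ring
    rw [e] at h1
    refine h1.congr' ?_
    have hτR : Tendsto (fun x => log (τ x : ℝ)) atTop atTop :=
      Real.tendsto_log_atTop.comp (tendsto_natCast_atTop_atTop.comp hτ1)
    filter_upwards [hτR.eventually (eventually_gt_atTop 0)] with x hx
    simp only [Function.comp]
    rw [div_mul_div_cancel₀ hx.ne']
  have hG2 := hG.add ((hTz.comp hτ1).div_atTop hll)
  rw [add_zero] at hG2
  refine tendsto_of_tendsto_of_tendsto_of_le_of_le' hG hG2 ?_ ?_
  · filter_upwards [eventually_ge_atTop (S : ℝ), hll.eventually (eventually_gt_atTop 0)] with x hx hp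
    exact div_le_div_of_nonneg_right (bounds x hx).1 hp.le
  · filter_upwards [eventually_ge_atTop (S : ℝ), hll.eventually (eventually_gt_atTop 0)] with x hx hp
    rw [← add_div]
    exact div_le_div_of_nonneg_right (bounds x hx).2 hp.le

lemma bf_fiber {ι : Type*} (N : ι → ℕ) (A : Set ι) (hfin : ∀ n : ℕ, {I | I ∈ A ∧ N I ≤ n}.Finite)
    (Q : ι → Prop) (P : ℕ → Prop) (x : ℝ) (hQ : ∀ I, Q I ↔ I ∈ A ∧ P (N I) ∧ (N I : ℝ) ≤ x)
    (hx : 0 ≤ x) (f : ℕ → ℝ) (s : Finset ℕ) (hs : ∀ n, n ∈ s ↔ n ≤ ⌊x⌋₊ ∧ P n) :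
    ∑' I : {I // Q I}, f (N I.1) = ∑ n ∈ s, (Nat.card {I // I ∈ A ∧ N I = n} : ℝ) * f n := by
  classical
  have hF : {I | Q I}.Finite := by
    refine (hfin ⌊x⌋₊).subset (fun I hI => ?_)
    have := (hQ I).1 hI
    exact ⟨this.1, Nat.le_floor this.2.2⟩
  have hc : ∀ n ∈ s, Nat.card {I // I ∈ A ∧ N I = n} = (hF.toFinset.filter (fun I => N I = n)).card := by
    intro n hn
    rw [← Nat.card_eq_finsetCard]
    refine Nat.card_congr (Equiv.subtypeEquivRight (fun I => ?_))
    simp only [Finset.mem_filter, Set.Finite.mem_toFinset, Set.mem_ofPred_eq, hQ]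
    constructor
    · rintro ⟨h1, rfl⟩
      have := (hs _).1 hn
      exact ⟨⟨h1, this.2, (Nat.le_floor_iff hx).1 this.1⟩, rfl⟩
    · rintro ⟨h1, rfl⟩
      exact ⟨h1.1, rfl⟩
  have h1 : ∑' I : {I // Q I}, f (N I.1) = ∑ I ∈ hF.toFinset, f (N I) := by
    rw [← Finset.tsum_subtype hF.toFinset (fun I => f (N I))]
    exact (Equiv.tsum_eq (Equiv.subtypeEquivRight (p := fun I => I ∈ hF.toFinset) (q := Q)
      (fun I => by simp)) (fun I : {I // Q I} => f (N I.1))).symm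
  rw [h1, ← Finset.sum_fiberwise_of_maps_to (s := hF.toFinset) (t := s) (g := N)]
  · refine Finset.sum_congr rfl (fun n hn => ?_)
    rw [hc n hn, Finset.sum_congr rfl (g := fun _ => f n)]
    · simp
    · intro I hI
      rw [(Finset.mem_filter.1 hI).2]
  · intro I hI
    have := (hQ I).1 (by simpa using hI)
    exact (hs _).2 ⟨Nat.le_floor this.2.2, this.2.1⟩

/-- Corollary-style form of Theorem 1.1: a Chebotarev-type counting asymptotic
`#{𝔭 ∈ A : N𝔭 ≤ x} = δ·Li(x) + o(x/(log x)²)` yields the logarithmic Benford law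
for the prime ideals of `A` whose norms begin with the base-`b` string `S`. -/
theorem benford_from_counting
    (K : Type*) [Field K] [NumberField K]
    (A : Set (Ideal (𝓞 K)))
    (hA : ∀ I ∈ A, I.IsPrime ∧ I ≠ ⊥)
    (δ : ℝ) (hδ : 0 ≤ δ)
    (hcount : (fun x : ℝ =>
        (Nat.card {I : Ideal (𝓞 K) // I ∈ A ∧ (Ideal.absNorm I : ℝ) ≤ x} : ℝ) -
          δ * ∫ t in (2 : ℝ)..x, 1 / Real.log t)
        =o[atTop] fun x : ℝ => x / (Real.log x) ^ 2)
    (b S m : ℕ) (hb : 2 ≤ b) (hm : 1 ≤ m)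
    (hS₁ : b ^ (m - 1) ≤ S) (hS₂ : S < b ^ m) :
    Tendsto (fun x : ℝ =>
        (∑' 𝔭 : {I : Ideal (𝓞 K) // I ∈ A ∧
            (∃ t : ℕ, S * b ^ t ≤ Ideal.absNorm I ∧ Ideal.absNorm I < (S + 1) * b ^ t) ∧
            (Ideal.absNorm I : ℝ) ≤ x},
          (1 : ℝ) / (Ideal.absNorm 𝔭.1 : ℝ)) / Real.log (Real.log x))
      atTop (nhds (δ * Real.logb b (1 + 1 / (S : ℝ)))) := by
  have hfin : ∀ n : ℕ, {I | I ∈ A ∧ Ideal.absNorm I ≤ n}.Finite := fun n =>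
    (Ideal.finite_setOfPred_absNorm_le n).subset (fun I hI => hI.2)
  set c : ℕ → ℝ := fun n => (Nat.card {I // I ∈ A ∧ Ideal.absNorm I = n} : ℝ) with hc
  have h1 := bf_phi _ δ hcount
  refine bf_real c (fun n => by positivity) δ ?_ b S m hb hm hS₁ hS₂ _ ?_
  · refine h1.congr' ?_
    filter_upwards [eventually_ge_atTop 0] with x hx
    congr 1
    have := bf_fiber Ideal.absNorm A hfin
      (fun I => I ∈ A ∧ (Ideal.absNorm I : ℝ) ≤ x) (fun _ => True) x (by simp) hx (fun _ => 1)
      (Finset.Icc 0 ⌊x⌋₊) (by simp)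
    simp only [mul_one] at this
    rw [← this]
    simp
  · intro x hx s hs
    rw [bf_fiber Ideal.absNorm A hfin _
      (fun n => ∃ t : ℕ, S * b ^ t ≤ n ∧ n < (S + 1) * b ^ t) x (fun I => Iff.rfl) hx
      (fun n => 1 / (n : ℝ)) s hs]
    refine Finset.sum_congr rfl (fun n _ => ?_)
    rw [mul_one_div]
end

section
/- Let a and q be coprime positive integers, let b ≥ 2 be an integer, and let S be a positive integer with b^{m−1} ≤ S < b^m for some m ≥ 1. Let A be the set of rational primes p with p ≡ a (mod q) whose base-b expansion begins with the string S. Then lim_{x→∞} (1/log log x) · ∑_{p ∈ A, p ≤ x} 1/p = (1/φ(q)) · log_b(1 + 1/S), where φ is Euler's totient function. -/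
open Filter Real

namespace BenfordAP

open Topology

lemma upper_of_deriv {G H : ℝ → ℝ} {c σ : ℝ} (hσ : 0 < σ)
    (hG : ∀ δ, 0 < δ → HasDerivAt G (-H δ) δ)
    (hH : ∀ δ ∈ Set.Ioo 0 σ, H δ ≤ c / δ) :
    ∃ C, ∀ δ ∈ Set.Ioo 0 (σ / 2), G δ ≤ c * (-Real.log δ) + C := by
  have hd : ∀ δ, 0 < δ → HasDerivAt (fun x => G x + c * Real.log x) (-H δ + c * δ⁻¹) δ := by
    intro δ hδ
    exact (hG δ hδ).add ((Real.hasDerivAt_log hδ.ne').const_mul c)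
  have hmono : MonotoneOn (fun x => G x + c * Real.log x) (Set.Ioo 0 σ) := by
    apply monotoneOn_of_deriv_nonneg (convex_Ioo 0 σ)
    · intro x hx
      exact (hd x hx.1).continuousAt.continuousWithinAt
    · intro x hx
      rw [interior_Ioo] at hx
      exact (hd x hx.1).differentiableAt.differentiableWithinAt
    · intro x hx
      rw [interior_Ioo] at hx
      rw [(hd x hx.1).deriv]
      have := hH x hx
      rw [div_eq_mul_inv] at this
      linarith
  refine ⟨G (σ / 2) + c * Real.log (σ / 2), fun δ hδ => ?_⟩
  have := hmono (a := δ) ⟨hδ.1, by linarith [hδ.2]⟩ (b := σ / 2) ⟨by linarith, by linarith⟩ hδ.2.le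
  simp only at this
  linarith

lemma tendsto_neg_log_zero : Tendsto (fun δ : ℝ => -Real.log δ) (𝓝[>] 0) atTop :=
  tendsto_neg_atBot_atTop.comp Real.tendsto_log_nhdsGT_zero

/-- A one-sided de l'Hopital type statement. -/
lemma upper_ratio {G H : ℝ → ℝ} {κ : ℝ}
    (hG : ∀ δ, 0 < δ → HasDerivAt G (-H δ) δ)
    (hH : Tendsto (fun δ => δ * H δ) (𝓝[>] 0) (𝓝 κ)) (ε : ℝ) (hε : 0 < ε) :
    ∀ᶠ δ in 𝓝[>] (0 : ℝ), G δ / (-Real.log δ) < κ + ε := by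
  have h1 : ∀ᶠ δ in 𝓝[>] (0 : ℝ), δ * H δ < κ + ε / 2 :=
    hH.eventually_lt_const (by linarith)
  obtain ⟨σ, hσ, h2⟩ := (mem_nhdsGT_iff_exists_Ioo_subset).1 h1
  have hσ' : 0 < σ := hσ
  obtain ⟨C, hC⟩ := upper_of_deriv (c := κ + ε / 2) hσ' hG (fun δ hδ => by
    have := h2 hδ
    simp only [Set.mem_ofPred_eq] at this
    rw [le_div_iff₀ hδ.1]; linarith)
  have h3 : ∀ᶠ δ in 𝓝[>] (0 : ℝ), max 1 ((C + 1) * 2 / ε) < -Real.log δ :=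
    tendsto_neg_log_zero.eventually_gt_atTop _
  have h4 : ∀ᶠ δ in 𝓝[>] (0 : ℝ), δ ∈ Set.Ioo 0 (σ / 2) := Ioo_mem_nhdsGT (by linarith)
  filter_upwards [h3, h4] with δ h3 h4
  have h5 : 1 < -Real.log δ := (le_max_left _ _).trans_lt h3
  have h6 : (C + 1) * 2 / ε < -Real.log δ := (le_max_right _ _).trans_lt h3
  rw [div_lt_iff₀ (by linarith)]
  rw [div_lt_iff₀ hε] at h6
  have := hC δ h4
  nlinarith

lemma ratio {G H : ℝ → ℝ} {κ : ℝ}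
    (hG : ∀ δ, 0 < δ → HasDerivAt G (-H δ) δ)
    (hH : Tendsto (fun δ => δ * H δ) (𝓝[>] 0) (𝓝 κ)) :
    Tendsto (fun δ => G δ / (-Real.log δ)) (𝓝[>] (0 : ℝ)) (𝓝 κ) := by
  rw [tendsto_order]
  constructor
  · intro a ha
    have := upper_ratio (G := fun x => - G x) (H := fun x => - H x) (κ := -κ)
      (fun δ hδ => (hG δ hδ).neg) (by simpa using hH.neg) (κ - a) (by linarith)
    filter_upwards [this] with δ h
    rw [neg_div] at h
    linarith
  · intro a ha
    filter_upwards [upper_ratio hG hH (a - κ) (by linarith)] with δ h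
    linarith

/-- Differentiation of a (real) Dirichlet series. -/
lemma hasDerivAt_series {w : ℕ → ℝ} (hw : ∀ n, 0 ≤ w n) (h0 : ∀ n, n < 2 → w n = 0)
    (hs : ∀ δ : ℝ, 0 < δ → Summable fun n : ℕ => w n * (n : ℝ) ^ (-δ)) :
    (∀ δ : ℝ, 0 < δ → Summable fun n : ℕ => w n / Real.log n * (n : ℝ) ^ (-δ)) ∧
    ∀ δ : ℝ, 0 < δ → HasDerivAt (fun δ : ℝ => ∑' n : ℕ, w n / Real.log n * (n : ℝ) ^ (-δ))
      (-∑' n : ℕ, w n * (n : ℝ) ^ (-δ)) δ := by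
  have hS : ∀ δ : ℝ, 0 < δ → Summable fun n : ℕ => w n / Real.log n * (n : ℝ) ^ (-δ) := by
    intro δ hδ
    refine ((hs δ hδ).mul_left (Real.log 2)⁻¹).of_nonneg_of_le (fun n => ?_) (fun n => ?_)
    · have := hw n
      positivity
    · rcases lt_or_ge n 2 with h | h
      · simp [h0 n h]
      · have hl : Real.log 2 ≤ Real.log n := Real.log_le_log (by norm_num) (by exact_mod_cast h)
        have h2 : 0 < Real.log 2 := Real.log_pos (by norm_num)
        rw [← mul_assoc, mul_comm _ (w n), div_eq_mul_inv]
        have := hw n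
        gcongr
  refine ⟨hS, fun δ hδ => ?_⟩
  have key := hasDerivAt_tsum_of_isPreconnected (𝕜 := ℝ) (F := ℝ)
    (g := fun (n : ℕ) (δ : ℝ) => w n / Real.log n * (n : ℝ) ^ (-δ))
    (g' := fun (n : ℕ) (δ : ℝ) => -(w n * (n : ℝ) ^ (-δ)))
    (t := Set.Ioi (δ / 2)) (y₀ := δ) (y := δ) (hs (δ / 2) (by linarith)) isOpen_Ioi
    isPreconnected_Ioi ?_ ?_ (by simp [hδ]) (hS δ hδ) (by simp [hδ])
  · rw [tsum_neg] at key
    exact key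
  · intro n y hy
    rcases lt_or_ge n 2 with h | h
    · simp [h0 n h, hasDerivAt_const]
    · have hn : (0 : ℝ) < n := by positivity
      have hl : 0 < Real.log n := Real.log_pos (by exact_mod_cast h)
      have h1 : HasDerivAt (fun y : ℝ => (n : ℝ) ^ (-y)) (Real.log n * (-1) * (n : ℝ) ^ (-y)) y :=
        (hasDerivAt_neg y).const_rpow hn
      have e : -(w n * (n : ℝ) ^ (-y)) =
          w n / Real.log n * (Real.log n * (-1) * (n : ℝ) ^ (-y)) := by
        field_simp
      simp only [e]
      exact h1.const_mul (w n / Real.log n)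
  · intro n y hy
    rw [norm_neg, Real.norm_of_nonneg (mul_nonneg (hw n) (by positivity))]
    rcases lt_or_ge n 2 with h | h
    · simp [h0 n h]
    · apply mul_le_mul_of_nonneg_left _ (hw n)
      apply Real.rpow_le_rpow_of_exponent_le
      · exact_mod_cast (by omega : 1 ≤ n)
      · have : δ / 2 < y := hy
        linarith

/-- elementary Tauberian theorem. -/
lemma tauber {a : ℕ → ℝ} (ha : ∀ n, 0 ≤ a n) (h0 : a 0 = 0) {κ : ℝ}
    (hs : ∀ δ : ℝ, 0 < δ → Summable fun n : ℕ => a n * (n : ℝ) ^ (-δ))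
    (hG : Tendsto (fun δ : ℝ => (∑' n : ℕ, a n * (n : ℝ) ^ (-δ)) / (-Real.log δ))
      (𝓝[>] (0 : ℝ)) (𝓝 κ)) :
    Tendsto (fun x : ℝ => (∑ n ∈ Finset.range (⌊x⌋₊ + 1), a n) / Real.log (Real.log x))
      atTop (𝓝 κ) := by
  set G : ℝ → ℝ := fun δ => ∑' n : ℕ, a n * (n : ℝ) ^ (-δ) with hGdef
  have hLL : Tendsto (fun x : ℝ => Real.log (Real.log x)) atTop atTop :=
    Real.tendsto_log_atTop.comp Real.tendsto_log_atTop
  have hc : ∀ c : ℝ, 0 < c → Tendsto (fun x : ℝ => G (c / Real.log x) / Real.log (Real.log x))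
      atTop (𝓝 κ) := by
    intro c hc
    have t1 : Tendsto (fun x : ℝ => c / Real.log x) atTop (𝓝[>] 0) := by
      rw [tendsto_nhdsWithin_iff]
      refine ⟨Real.tendsto_log_atTop.const_div_atTop c, ?_⟩
      filter_upwards [eventually_gt_atTop 1] with x hx
      exact div_pos hc (Real.log_pos hx)
    have t2 := hG.comp t1
    have t3 : Tendsto (fun x : ℝ => (1 : ℝ) - Real.log c / Real.log (Real.log x)) atTop (𝓝 (1 - 0)) :=
      tendsto_const_nhds.sub (hLL.const_div_atTop _)
    have t4 := t2.mul t3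
    rw [sub_zero, mul_one] at t4
    refine t4.congr' ?_
    filter_upwards [t1.eventually (tendsto_neg_log_zero.eventually_gt_atTop 0),
      hLL.eventually_gt_atTop 0, eventually_gt_atTop 1] with x h1 h2 h3
    have h4 : 0 < Real.log x := Real.log_pos h3
    simp only [Function.comp]
    rw [Real.log_div hc.ne' h4.ne'] at h1 ⊢
    have h5 : -(Real.log c - Real.log (Real.log x)) ≠ 0 := h1.ne'
    rw [div_mul_eq_mul_div, div_eq_div_iff h5 h2.ne', mul_assoc, sub_mul,
      div_mul_cancel₀ _ h2.ne']
    ring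
  -- upper bound
  have hup : ∀ c : ℝ, 0 < c → ∀ x : ℝ, 1 < x →
      ∑ n ∈ Finset.range (⌊x⌋₊ + 1), a n ≤ Real.exp c * G (c / Real.log x) := by
    intro c hc x hx
    have hl : 0 < Real.log x := Real.log_pos hx
    have hδ : 0 < c / Real.log x := div_pos hc hl
    have e1 : Real.exp c = x ^ (c / Real.log x) := by
      rw [Real.rpow_def_of_pos (by linarith), mul_div_cancel₀ _ hl.ne']
    calc ∑ n ∈ Finset.range (⌊x⌋₊ + 1), a n
        ≤ ∑ n ∈ Finset.range (⌊x⌋₊ + 1), Real.exp c * (a n * (n : ℝ) ^ (-(c / Real.log x))) := by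
          apply Finset.sum_le_sum
          intro n hn
          rcases Nat.eq_zero_or_pos n with rfl | hn0
          · simp [h0]
          · have hn1 : n ≤ ⌊x⌋₊ := by simpa [Nat.lt_succ_iff] using hn
            have hn2 : (n : ℝ) ≤ x := (Nat.le_floor_iff (by linarith)).1 hn1
            have hn3 : (0 : ℝ) < n := by exact_mod_cast hn0
            have : 1 ≤ Real.exp c * (n : ℝ) ^ (-(c / Real.log x)) := by
              rw [e1, Real.rpow_neg hn3.le, ← div_eq_mul_inv, one_le_div (by positivity)]
              exact Real.rpow_le_rpow hn3.le hn2 hδ.le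
            nlinarith [ha n]
      _ = Real.exp c * ∑ n ∈ Finset.range (⌊x⌋₊ + 1), (a n * (n : ℝ) ^ (-(c / Real.log x))) := by
          rw [Finset.mul_sum]
      _ ≤ _ := by
          apply mul_le_mul_of_nonneg_left _ (Real.exp_pos c).le
          exact (hs _ hδ).sum_le_tsum _ (fun n _ => mul_nonneg (ha n) (by positivity))
  have hlow : ∀ c : ℝ, 0 < c → ∀ x : ℝ, 1 < x →
      G (2 * c / Real.log x) - Real.exp (-c) * G (c / Real.log x) ≤
      ∑ n ∈ Finset.range (⌊x⌋₊ + 1), a n := by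
    intro c hc x hx
    have hl : 0 < Real.log x := Real.log_pos hx
    have hδ : 0 < c / Real.log x := div_pos hc hl
    have hδ2 : 0 < 2 * c / Real.log x := div_pos (by linarith) hl
    have e1 : Real.exp (-c) = x ^ (-(c / Real.log x)) := by
      rw [Real.rpow_def_of_pos (by linarith), mul_neg, mul_div_cancel₀ _ hl.ne']
    have s1 := (hs _ hδ).mul_left (Real.exp (-c))
    have s2 : Summable fun n : ℕ => if n ∈ Finset.range (⌊x⌋₊ + 1) then a n else 0 :=
      summable_of_ne_finset_zero (s := Finset.range (⌊x⌋₊ + 1)) (fun n hn => if_neg hn)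
    have e2 : ∑' n : ℕ, (if n ∈ Finset.range (⌊x⌋₊ + 1) then a n else 0) =
        ∑ n ∈ Finset.range (⌊x⌋₊ + 1), a n := by
      rw [tsum_eq_sum (s := Finset.range (⌊x⌋₊ + 1)) (fun n hn => if_neg hn)]
      exact Finset.sum_congr rfl (fun n hn => if_pos hn)
    rw [sub_le_iff_le_add, ← e2, hGdef]
    simp only
    rw [← tsum_mul_left, ← s2.tsum_add s1]
    refine (hs _ hδ2).tsum_le_tsum (fun n => ?_) (s2.add s1)
    rcases Nat.eq_zero_or_pos n with rfl | hn0
    · simp [h0]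
    have hn3 : (0 : ℝ) < n := by exact_mod_cast hn0
    have hn1 : (1 : ℝ) ≤ n := by exact_mod_cast hn0
    have p1 : 0 ≤ Real.exp (-c) * (a n * (n : ℝ) ^ (-(c / Real.log x))) :=
      mul_nonneg (Real.exp_pos _).le (mul_nonneg (ha n) (by positivity))
    split_ifs with hn
    · have : (n : ℝ) ^ (-(2 * c / Real.log x)) ≤ 1 :=
        Real.rpow_le_one_of_one_le_of_nonpos hn1 (by linarith)
      nlinarith [ha n]
    · have hn2 : x ≤ n := by
        have : ⌊x⌋₊ < n := by simpa [Nat.lt_succ_iff] using hn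
        exact ((Nat.floor_lt (by linarith)).1 this).le
      have e3 : (n : ℝ) ^ (-(2 * c / Real.log x)) =
          (n : ℝ) ^ (-(c / Real.log x)) * (n : ℝ) ^ (-(c / Real.log x)) := by
        rw [← Real.rpow_add hn3]; congr 1; ring
      have e4 : (n : ℝ) ^ (-(c / Real.log x)) ≤ Real.exp (-c) := by
        rw [e1]
        exact Real.rpow_le_rpow_of_nonpos (by linarith) hn2 (by linarith)
      rw [e3, zero_add, ← mul_assoc, mul_comm]
      rw [mul_comm (a n)]
      have := mul_nonneg (ha n) (Real.rpow_nonneg hn3.le (-(c / Real.log x)))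
      nlinarith
  rw [tendsto_order]
  constructor
  · intro u hu
    have l1 : Tendsto (fun c : ℝ => κ - Real.exp (-c) * κ) atTop (𝓝 (κ - 0 * κ)) :=
      tendsto_const_nhds.sub ((Real.tendsto_exp_neg_atTop_nhds_zero).mul_const κ)
    rw [zero_mul, sub_zero] at l1
    obtain ⟨c, hcu, hc0⟩ := ((l1.eventually_const_lt hu).and (eventually_gt_atTop 0)).exists
    have l2 := (hc (2 * c) (by linarith)).sub ((hc c hc0).const_mul (Real.exp (-c)))
    filter_upwards [l2.eventually_const_lt hcu, eventually_gt_atTop 1, hLL.eventually_gt_atTop 0]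
      with x h1 h2 h3
    refine h1.trans_le ?_
    rw [← mul_div_assoc, ← sub_div]
    exact div_le_div_of_nonneg_right (hlow c hc0 x h2) h3.le
  · intro u hu
    have l1 : Tendsto (fun c : ℝ => Real.exp c * κ) (𝓝[>] 0) (𝓝 (Real.exp 0 * κ)) :=
      ((Real.continuous_exp.mul continuous_const).tendsto 0).mono_left nhdsWithin_le_nhds
    rw [Real.exp_zero, one_mul] at l1
    obtain ⟨c, hcu, hc0⟩ := ((l1.eventually_lt_const hu).and self_mem_nhdsWithin).exists
    have hc0 : 0 < c := hc0
    have l2 := (hc c hc0).const_mul (Real.exp c)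
    filter_upwards [l2.eventually_lt_const hcu, eventually_gt_atTop 1, hLL.eventually_gt_atTop 0]
      with x h1 h2 h3
    refine lt_of_le_of_lt ?_ h1
    rw [← mul_div_assoc]
    exact div_le_div_of_nonneg_right (hup c hc0 x h2) h3.le

section

open ArithmeticFunction.vonMangoldt

variable {q : ℕ} [NeZero q] {a : ZMod q}

lemma summable_base (a : ZMod q) (δ : ℝ) (hδ : 0 < δ) :
    Summable fun n : ℕ => residueClass a n / n * (n : ℝ) ^ (-δ) := by
  have h := LSeries.summable_real_of_abscissaOfAbsConv_lt (f := residueClass a) (x := 1 + δ) <|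
    (abscissaOfAbsConv_residueClass_le_one a).trans_lt (by
      exact_mod_cast (by linarith : (1 : ℝ) < 1 + δ))
  refine h.congr fun n => ?_
  rcases Nat.eq_zero_or_pos n with rfl | hn
  · simp
  · have hn : (0 : ℝ) < n := by exact_mod_cast hn
    rw [Real.rpow_add hn, Real.rpow_one, Real.rpow_neg hn.le]
    field_simp

lemma fourier_term (T : ℝ) (k : ℤ) (δ : ℝ) (n : ℕ) :
    ((residueClass a n / n * (n : ℝ) ^ (-δ) : ℝ) : ℂ) * fourier k ((Real.log n : ℝ) : AddCircle T) =
    LSeries.term (fun n => (residueClass a n : ℂ)) (1 + δ - (2 * π * k / T : ℝ) * Complex.I) n := by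
  rcases Nat.eq_zero_or_pos n with rfl | hn
  · simp
  · have hn0 : (n : ℂ) ≠ 0 := by exact_mod_cast hn.ne'
    have hnr : (0 : ℝ) < n := by exact_mod_cast hn
    rw [LSeries.term_of_ne_zero hn.ne', fourier_coe_apply, Complex.cpow_sub _ _ hn0,
      Complex.cpow_add _ _ hn0, Complex.cpow_one]
    push_cast
    rw [Complex.ofReal_cpow hnr.le]
    have e : Complex.exp (2 * π * Complex.I * k * (Complex.log n) / T) =
      (n : ℂ) ^ ((2 * π * k / T : ℂ) * Complex.I) := by
      rw [Complex.cpow_def_of_ne_zero hn0]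
      congr 1
      ring
    rw [e]
    push_cast
    rw [Complex.cpow_neg]
    have : (n : ℂ) ^ ((2 * π * k / T : ℂ) * Complex.I) ≠ 0 := by
      simp [Complex.cpow_def_of_ne_zero hn0]
    have : (n : ℂ) ^ (δ : ℂ) ≠ 0 := by
      simp [Complex.cpow_def_of_ne_zero hn0]
    field_simp

lemma fourier_limit (ha : IsUnit a) (T : ℝ) (hT : 0 < T) (k : ℤ) :
    Tendsto (fun δ : ℝ => (δ : ℂ) * ∑' n : ℕ, ((residueClass a n / n * (n : ℝ) ^ (-δ) : ℝ) : ℂ) *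
      fourier k ((Real.log n : ℝ) : AddCircle T)) (𝓝[>] 0)
      (𝓝 (if k = 0 then (q.totient : ℂ)⁻¹ else 0)) := by
  simp only [fourier_term]
  set t : ℝ := 2 * π * k / T with ht
  set s : ℝ → ℂ := fun δ => 1 + δ - (t : ℝ) * Complex.I with hs
  have hre : ∀ δ, (s δ).re = 1 + δ := by intro δ; simp [hs]
  have hscont : Continuous s := by rw [hs]; fun_prop
  have hAux : Tendsto (fun δ => LFunctionResidueClassAux a (s δ)) (𝓝[>] 0)
      (𝓝 (LFunctionResidueClassAux a (s 0))) := by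
    have h1 := continuousOn_LFunctionResidueClassAux a (s 0) (by simp [hre])
    refine h1.tendsto.comp ?_
    rw [tendsto_nhdsWithin_iff]
    refine ⟨(hscont.tendsto 0).mono_left nhdsWithin_le_nhds, ?_⟩
    filter_upwards [self_mem_nhdsWithin] with δ hδ
    have : 0 < δ := hδ
    simp [hre, this.le]
  have hδ0 : Tendsto (fun δ : ℝ => (δ : ℂ)) (𝓝[>] 0) (𝓝 0) :=
    (Complex.continuous_ofReal.tendsto 0).mono_left nhdsWithin_le_nhds
  have hmain : Tendsto (fun δ : ℝ => (δ : ℂ) * ((q.totient : ℂ)⁻¹ / (s δ - 1))) (𝓝[>] 0)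
      (𝓝 (if k = 0 then (q.totient : ℂ)⁻¹ else 0)) := by
    split_ifs with hk
    · refine tendsto_const_nhds.congr' ?_
      filter_upwards [self_mem_nhdsWithin] with δ hδ
      have : (δ : ℂ) ≠ 0 := by exact_mod_cast (ne_of_gt hδ)
      have : s δ - 1 = δ := by simp [hs, ht, hk]
      rw [this]
      field_simp
    · have ht0 : t ≠ 0 := by
        rw [ht]
        have : (k : ℝ) ≠ 0 := by exact_mod_cast hk
        positivity
      have h1 : s 0 - 1 ≠ 0 := by
        simp [hs, ht0]
      have h2 : Tendsto (fun δ => s δ - 1) (𝓝[>] 0) (𝓝 (s 0 - 1)) :=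
        ((hscont.sub continuous_const).tendsto 0).mono_left nhdsWithin_le_nhds
      have := hδ0.mul ((tendsto_const_nhds (x := (q.totient : ℂ)⁻¹)).div h2 h1)
      simpa using this
  have := (hδ0.mul hAux).add hmain
  rw [zero_mul, zero_add] at this
  refine this.congr' ?_
  filter_upwards [self_mem_nhdsWithin] with δ hδ
  have hδ : 0 < δ := hδ
  have := eqOn_LFunctionResidueClassAux ha (x := s δ) (by simp [hre, hδ])
  rw [this]
  simp only [LSeries]
  ring

end

section equi
variable {T : ℝ} [hT : Fact (0 < T)]

lemma integral_fourier (k : ℤ) :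
    ∫ t, (fourier k : C(AddCircle T, ℂ)) t ∂AddCircle.haarAddCircle = if k = 0 then 1 else 0 := by
  have h := (orthonormal_iff_ite.1 (orthonormal_fourier (T := T))) 0 k
  rw [fourierLp, fourierLp, MeasureTheory.ContinuousMap.inner_toLp (@AddCircle.haarAddCircle T hT)] at h
  simp only [fourier_zero, map_one, mul_one] at h
  rw [h]
  simp only [eq_comm]

lemma weyl {u : ℝ → ℕ → ℝ} {x : ℕ → AddCircle T} {κ : ℝ} (hκ : 0 ≤ κ)
    (hu : ∀ δ, 0 < δ → ∀ n, 0 ≤ u δ n) (hs : ∀ δ, 0 < δ → Summable (u δ))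
    (hF : ∀ k : ℤ, Tendsto (fun δ => ∑' n, (u δ n : ℂ) * fourier k (x n)) (𝓝[>] 0)
      (𝓝 (if k = 0 then (κ : ℂ) else 0))) (f : C(AddCircle T, ℂ)) :
    Tendsto (fun δ => ∑' n, (u δ n : ℂ) * f (x n)) (𝓝[>] 0)
      (𝓝 (κ * ∫ t, f t ∂AddCircle.haarAddCircle)) := by
  have hint : ∀ f : C(AddCircle T, ℂ), MeasureTheory.Integrable f AddCircle.haarAddCircle :=
    fun f => f.continuous.integrable_of_hasCompactSupport (HasCompactSupport.of_compactSpace _)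
  have hb : ∀ (f : C(AddCircle T, ℂ)) δ n, 0 < δ → ‖(u δ n : ℂ) * f (x n)‖ ≤ u δ n * ‖f‖ := by
    intro f δ n hδ
    rw [norm_mul, Complex.norm_real, Real.norm_of_nonneg (hu δ hδ n)]
    exact mul_le_mul_of_nonneg_left (f.norm_coe_le_norm _) (hu δ hδ n)
  have hsum : ∀ (f : C(AddCircle T, ℂ)) δ, 0 < δ → Summable fun n => (u δ n : ℂ) * f (x n) :=
    fun f δ hδ => Summable.of_norm_bounded ((hs δ hδ).mul_right ‖f‖) (fun n => hb f δ n hδ)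
  have hspan : ∀ g ∈ Submodule.span ℂ (Set.range (@fourier T)),
      Tendsto (fun δ => ∑' n, (u δ n : ℂ) * g (x n)) (𝓝[>] 0)
      (𝓝 (κ * ∫ t, g t ∂AddCircle.haarAddCircle)) := by
    intro g hg
    induction hg using Submodule.span_induction with
    | mem g hg =>
      obtain ⟨k, rfl⟩ := hg
      rw [integral_fourier]
      simpa using hF k
    | zero => simp
    | add f g _ _ hf hg =>
      have e : ∫ t, (f + g) t ∂AddCircle.haarAddCircle =
          ∫ t, f t ∂AddCircle.haarAddCircle + ∫ t, g t ∂AddCircle.haarAddCircle :=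
        MeasureTheory.integral_add (hint f) (hint g)
      rw [e, mul_add]
      refine (hf.add hg).congr' ?_
      filter_upwards [self_mem_nhdsWithin] with δ hδ
      rw [← (hsum f δ hδ).tsum_add (hsum g δ hδ)]
      simp [mul_add]
    | smul c f _ hf =>
      have e : ∫ t, (c • f) t ∂AddCircle.haarAddCircle =
          c * ∫ t, f t ∂AddCircle.haarAddCircle :=
        MeasureTheory.integral_const_mul c _
      rw [e, mul_left_comm]
      refine (hf.const_mul c).congr fun δ => ?_
      rw [← tsum_mul_left]
      simp [mul_left_comm]
  have hU : Tendsto (fun δ => ∑' n, u δ n) (𝓝[>] 0) (𝓝 κ) := by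
    have h := hF 0
    simp only [fourier_zero, mul_one, if_true, ← Complex.ofReal_tsum] at h
    exact (Complex.continuous_re.tendsto _).comp h
  rw [Metric.tendsto_nhds]
  intro ε hε
  have hM : 0 < 2 * κ + 2 := by linarith
  have hmem : f ∈ (Submodule.span ℂ (Set.range (@fourier T))).topologicalClosure := by
    rw [span_fourier_closure_eq_top]; trivial
  obtain ⟨g, hg, hfg⟩ := Metric.mem_closure_iff.1 hmem (ε / (2 * κ + 2)) (by positivity)
  rw [dist_eq_norm] at hfg
  have h1 := (Metric.tendsto_nhds.1 (hspan g hg)) (ε / (2 * κ + 2)) (by positivity)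
  filter_upwards [h1, hU.eventually_lt_const (lt_add_one κ), self_mem_nhdsWithin] with δ h1 h2 hδ
  have hδ : 0 < δ := hδ
  have b1 : ‖∑' n, (u δ n : ℂ) * f (x n) - ∑' n, (u δ n : ℂ) * g (x n)‖ ≤ (∑' n, u δ n) * ‖f - g‖ := by
    rw [← (hsum f δ hδ).tsum_sub (hsum g δ hδ), ← tsum_mul_right]
    refine tsum_of_norm_bounded ((hs δ hδ).mul_right _).hasSum fun n => ?_
    have := hb (f - g) δ n hδ
    rwa [ContinuousMap.sub_apply, mul_sub] at this
  have b2 : ‖∫ t, g t ∂AddCircle.haarAddCircle - ∫ t, f t ∂AddCircle.haarAddCircle‖ ≤ ‖f - g‖ := by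
    rw [← MeasureTheory.integral_sub (hint g) (hint f)]
    have := MeasureTheory.norm_integral_le_of_norm_le_const (μ := @AddCircle.haarAddCircle T hT)
      (f := fun t => g t - f t) (C := ‖f - g‖) (Eventually.of_forall fun t => by
        rw [norm_sub_rev]; exact (f - g).norm_coe_le_norm t)
    simpa using this
  rw [dist_eq_norm] at h1 ⊢
  have e : ∑' n, (u δ n : ℂ) * f (x n) - κ * ∫ t, f t ∂AddCircle.haarAddCircle =
    (∑' n, (u δ n : ℂ) * f (x n) - ∑' n, (u δ n : ℂ) * g (x n)) +
    (∑' n, (u δ n : ℂ) * g (x n) - κ * ∫ t, g t ∂AddCircle.haarAddCircle) +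
    κ * (∫ t, g t ∂AddCircle.haarAddCircle - ∫ t, f t ∂AddCircle.haarAddCircle) := by ring
  rw [e]
  refine (norm_add₃_le).trans_lt ?_
  rw [norm_mul, Complex.norm_real, Real.norm_of_nonneg hκ]
  have b3 : (∑' n, u δ n) * ‖f - g‖ ≤ (κ + 1) * (ε / (2 * κ + 2)) :=
    mul_le_mul h2.le hfg.le (norm_nonneg _) (by linarith)
  have b4 : κ * ‖∫ t, g t ∂AddCircle.haarAddCircle - ∫ t, f t ∂AddCircle.haarAddCircle‖ ≤
      κ * (ε / (2 * κ + 2)) := mul_le_mul_of_nonneg_left (b2.trans hfg.le) hκ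
  have b5 : (κ + 1) * (ε / (2 * κ + 2)) + ε / (2 * κ + 2) + κ * (ε / (2 * κ + 2)) = ε := by
    field_simp; ring
  linarith

/-- The indices whose point lies in the arc `[α, β)`. -/
def arcSet (x : ℕ → AddCircle T) (α β : ℝ) : Set ℕ :=
  {n | ∃ y ∈ Set.Ico α β, ((y : ℝ) : AddCircle T) = x n}

lemma arc_lower {u : ℝ → ℕ → ℝ} {x : ℕ → AddCircle T} {κ : ℝ} (hκ : 0 ≤ κ)
    (hu : ∀ δ, 0 < δ → ∀ n, 0 ≤ u δ n) (hs : ∀ δ, 0 < δ → Summable (u δ))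
    (hF : ∀ k : ℤ, Tendsto (fun δ => ∑' n, (u δ n : ℂ) * fourier k (x n)) (𝓝[>] 0)
      (𝓝 (if k = 0 then (κ : ℂ) else 0))) {α β : ℝ} (hαβ : α ≤ β) (hβ : β ≤ α + T)
    {c : ℝ} (hc : c < κ * ((β - α) / T)) :
    ∀ᶠ δ in 𝓝[>] (0 : ℝ), c < ∑' n, (arcSet x α β).indicator (u δ) n := by
  have hT0 : 0 < T := hT.out
  rcases hαβ.eq_or_lt with rfl | hlt
  · filter_upwards [self_mem_nhdsWithin] with δ hδ
    simp only [sub_self, zero_div, mul_zero] at hc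
    exact hc.trans_le (tsum_nonneg fun n => Set.indicator_nonneg (fun n _ => hu δ hδ n) n)
  have hη : ∃ η, 0 < η ∧ 2 * η ≤ β - α ∧ c < κ * ((β - α - 2 * η) / T) := by
    have l : Tendsto (fun η : ℝ => κ * ((β - α - 2 * η) / T)) (𝓝[>] 0)
        (𝓝 (κ * ((β - α - 2 * 0) / T))) := by
      refine Tendsto.mono_left (Continuous.tendsto ?_ 0) nhdsWithin_le_nhds
      fun_prop
    rw [mul_zero, sub_zero] at l
    have l2 : ∀ᶠ η in 𝓝[>] (0 : ℝ), η ∈ Set.Ioo 0 ((β - α) / 2) :=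
      Ioo_mem_nhdsGT (by linarith)
    obtain ⟨η, h1, h2⟩ := ((l.eventually_const_lt hc).and l2).exists
    exact ⟨η, h2.1, by linarith [h2.2], h1⟩
  obtain ⟨η, hη0, hη1, hη2⟩ := hη
  set tent : ℝ → ℝ := fun y => max 0 (min 1 (min ((y - α) / η) ((β - y) / η))) with htent
  have tcont : Continuous tent := by
    rw [htent]
    fun_prop
  have t0 : ∀ y, 0 ≤ tent y := fun y => le_max_left _ _
  have t1 : ∀ y, tent y ≤ 1 := fun y => max_le zero_le_one (min_le_left _ _)
  have tβ : ∀ y, β ≤ y → tent y = 0 := by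
    intro y hy
    refine max_eq_left ((min_le_right _ _).trans ((min_le_right _ _).trans ?_))
    exact div_nonpos_of_nonpos_of_nonneg (by linarith) hη0.le
  have tα : tent α = 0 := by
    refine max_eq_left ((min_le_right _ _).trans ((min_le_left _ _).trans ?_))
    simp
  have tone : ∀ y ∈ Set.Icc (α + η) (β - η), tent y = 1 := by
    intro y hy
    have h1 : 1 ≤ (y - α) / η := by rw [one_le_div hη0]; linarith [hy.1]
    have h2 : 1 ≤ (β - y) / η := by rw [one_le_div hη0]; linarith [hy.2]
    simp [htent, min_eq_left (le_min h1 h2)]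
  have hper : (fun y => ((tent y : ℝ) : ℂ)) α = (fun y => ((tent y : ℝ) : ℂ)) (α + T) := by
    simp [tα, tβ _ hβ]
  let f : C(AddCircle T, ℂ) := ⟨AddCircle.liftIco T α (fun y => ((tent y : ℝ) : ℂ)),
    AddCircle.liftIco_continuous hper (by fun_prop)⟩
  have hf : ∀ y ∈ Set.Ico α (α + T), f (y : AddCircle T) = tent y := fun y hy =>
    AddCircle.liftIco_coe_apply (f := fun y => ((tent y : ℝ) : ℂ)) hy
  have hI : ∫ t, f t ∂AddCircle.haarAddCircle = ((T⁻¹ * ∫ y in α..α + T, tent y : ℝ) : ℂ) := by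
    rw [AddCircle.integral_haarAddCircle]
    change T⁻¹ • ∫ t, AddCircle.liftIco T α (fun y => ((tent y : ℝ) : ℂ)) t = _
    rw [← AddCircle.liftIoc_eq_liftIco hper, AddCircle.integral_liftIoc_eq_intervalIntegral,
      intervalIntegral.integral_ofReal]
    simp
  have hI2 : β - α - 2 * η ≤ ∫ y in α..α + T, tent y := by
    have h1 : ∫ y in (α + η)..(β - η), tent y = β - α - 2 * η := by
      rw [intervalIntegral.integral_congr (g := fun _ => (1 : ℝ))]
      · simp; ring
      · rw [Set.uIcc_of_le (by linarith)]; exact tone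
    rw [← h1]
    exact intervalIntegral.integral_mono_interval (by linarith) (by linarith) (by linarith)
      (Eventually.of_forall t0) (tcont.intervalIntegrable _ _)
  have hW := (Complex.continuous_re.tendsto _).comp (weyl hκ hu hs hF f)
  rw [hI, ← Complex.ofReal_mul, Complex.ofReal_re] at hW
  have hlt2 : c < κ * (T⁻¹ * ∫ y in α..α + T, tent y) := by
    refine hη2.trans_le (mul_le_mul_of_nonneg_left ?_ hκ)
    rw [div_eq_inv_mul]
    exact mul_le_mul_of_nonneg_left hI2 (by positivity)
  filter_upwards [hW.eventually_const_lt hlt2, self_mem_nhdsWithin] with δ h1 hδ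
  have hδ : 0 < δ := hδ
  refine h1.trans_le ?_
  simp only [Function.comp]
  have hex : ∀ n, ∃ y ∈ Set.Ico α (α + T), ((y : ℝ) : AddCircle T) = x n := fun n =>
    ⟨AddCircle.equivIco T α (x n), (AddCircle.equivIco T α (x n)).2,
      (AddCircle.equivIco T α).symm_apply_apply (x n)⟩
  choose y hy hyx using hex
  have e : ∀ n, (u δ n : ℂ) * f (x n) = ((u δ n * tent (y n) : ℝ) : ℂ) := by
    intro n
    rw [← hyx n, hf _ (hy n)]; push_cast; rfl
  simp only [e, ← Complex.ofReal_tsum, Complex.ofReal_re]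
  have hsi : Summable ((arcSet x α β).indicator (u δ)) := (hs δ hδ).indicator _
  have hle : ∀ n, u δ n * tent (y n) ≤ (arcSet x α β).indicator (u δ) n := by
    intro n
    rcases lt_or_ge (y n) β with h | h
    · have : n ∈ arcSet x α β := ⟨y n, ⟨(hy n).1, h⟩, hyx n⟩
      rw [Set.indicator_of_mem this]
      exact mul_le_of_le_one_right (hu δ hδ n) (t1 _)
    · rw [tβ _ h, mul_zero]
      exact Set.indicator_nonneg (fun n _ => hu δ hδ n) n
  refine Summable.tsum_le_tsum hle (hsi.of_nonneg_of_le (fun n => ?_) hle) hsi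
  exact mul_nonneg (hu δ hδ n) (t0 _)

lemma arc_limit {u : ℝ → ℕ → ℝ} {x : ℕ → AddCircle T} {κ : ℝ} (hκ : 0 ≤ κ)
    (hu : ∀ δ, 0 < δ → ∀ n, 0 ≤ u δ n) (hs : ∀ δ, 0 < δ → Summable (u δ))
    (hF : ∀ k : ℤ, Tendsto (fun δ => ∑' n, (u δ n : ℂ) * fourier k (x n)) (𝓝[>] 0)
      (𝓝 (if k = 0 then (κ : ℂ) else 0))) {α β : ℝ} (hαβ : α ≤ β) (hβ : β ≤ α + T) :
    Tendsto (fun δ => ∑' n, (arcSet x α β).indicator (u δ) n) (𝓝[>] 0)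
      (𝓝 (κ * ((β - α) / T))) := by
  have hT0 : 0 < T := hT.out
  have hU : Tendsto (fun δ => ∑' n, u δ n) (𝓝[>] 0) (𝓝 κ) := by
    have h := hF 0
    simp only [fourier_zero, mul_one, if_true, ← Complex.ofReal_tsum] at h
    exact (Complex.continuous_re.tendsto _).comp h
  rw [tendsto_order]
  refine ⟨fun c hc => arc_lower hκ hu hs hF hαβ hβ hc, fun c hc => ?_⟩
  have h1 := arc_lower hκ hu hs hF hβ (by linarith : α + T ≤ β + T)
    (c := κ * ((α + T - β) / T) - (c - κ * ((β - α) / T)) / 2) (by linarith)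
  have h2 := hU.eventually_lt_const (u := κ + (c - κ * ((β - α) / T)) / 2) (by linarith)
  filter_upwards [h1, h2, self_mem_nhdsWithin] with δ h1 h2 hδ
  have hδ : 0 < δ := hδ
  have s1 : Summable ((arcSet x α β).indicator (u δ)) := (hs δ hδ).indicator _
  have s2 : Summable ((arcSet x β (α + T)).indicator (u δ)) := (hs δ hδ).indicator _
  have h3 : ∑' n, (arcSet x α β).indicator (u δ) n + ∑' n, (arcSet x β (α + T)).indicator (u δ) n
      ≤ ∑' n, u δ n := by
    rw [← s1.tsum_add s2]
    refine (s1.add s2).tsum_le_tsum (fun n => ?_) (hs δ hδ)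
    by_cases m1 : n ∈ arcSet x α β
    · have m2 : n ∉ arcSet x β (α + T) := by
        rintro ⟨y', hy', hx'⟩
        obtain ⟨y, hy, hx⟩ := m1
        have := (AddCircle.coe_eq_coe_iff_of_mem_Ico (p := T) (a := α) (x := y) (y := y')
          ⟨hy.1, hy.2.trans_le hβ⟩ ⟨hαβ.trans hy'.1, hy'.2⟩).1 (hx.trans hx'.symm)
        linarith [hy.2, hy'.1]
      simp [m1, m2]
    · rw [Set.indicator_of_notMem m1, zero_add]
      exact Set.indicator_le_self' (fun n _ => hu δ hδ n) n
  have h4 : κ * ((β - α) / T) + κ * ((α + T - β) / T) = κ := by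
    field_simp; ring
  linarith

end equi

section final

open Topology ArithmeticFunction.vonMangoldt

lemma arc_iff {b S n : ℕ} (hb : 2 ≤ b) (hS : 1 ≤ S) (hn : S ≤ n) :
    n ∈ arcSet (T := Real.log b) (fun n : ℕ => ((Real.log n : ℝ) : AddCircle (Real.log b)))
      (Real.log S) (Real.log (S + 1)) ↔ ∃ t : ℕ, S * b ^ t ≤ n ∧ n < (S + 1) * b ^ t := by
  have hb0 : (0 : ℝ) < b := by positivity
  have hS0 : (0 : ℝ) < S := by exact_mod_cast hS
  have hn0 : (0 : ℝ) < n := by exact_mod_cast (by omega : 0 < n)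
  have hlb : 0 < Real.log b := Real.log_pos (by exact_mod_cast hb)
  have key : ∀ t : ℕ, (S * b ^ t ≤ n ∧ n < (S + 1) * b ^ t) ↔
      (Real.log S + t * Real.log b ≤ Real.log n ∧
        Real.log n < Real.log (S + 1) + t * Real.log b) := by
    intro t
    have e1 : Real.log S + t * Real.log b = Real.log ((S * b ^ t : ℕ) : ℝ) := by
      push_cast
      rw [Real.log_mul hS0.ne' (by positivity), Real.log_pow]
    have e2 : Real.log (S + 1) + t * Real.log b = Real.log (((S + 1) * b ^ t : ℕ) : ℝ) := by
      push_cast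
      rw [Real.log_mul (by positivity) (by positivity), Real.log_pow]
    rw [e1, e2, Real.log_le_log_iff (by push_cast; positivity) hn0,
      Real.log_lt_log_iff hn0 (by push_cast; positivity)]
    norm_cast
  constructor
  · rintro ⟨y, hy, hyn⟩
    have h0 : ((Real.log n - y : ℝ) : AddCircle (Real.log b)) = 0 := by
      rw [AddCircle.coe_sub, hyn, sub_self]
    obtain ⟨j, hj⟩ := (AddCircle.coe_eq_zero_iff _).1 h0
    rw [zsmul_eq_mul] at hj
    have hj0 : 0 ≤ j := by
      by_contra hneg
      have hj1 : (j : ℝ) ≤ -1 := by exact_mod_cast (by omega : j ≤ -1)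
      have h1 : Real.log (S + 1) ≤ Real.log S + Real.log b := by
        rw [← Real.log_mul hS0.ne' hb0.ne']
        apply Real.log_le_log (by positivity)
        have : S + 1 ≤ S * b := by nlinarith
        exact_mod_cast this
      have h2 : Real.log S ≤ Real.log n := Real.log_le_log hS0 (by exact_mod_cast hn)
      nlinarith [hy.2]
    lift j to ℕ using hj0
    refine ⟨j, (key j).2 ?_⟩
    push_cast at hj
    constructor <;> linarith [hy.1, hy.2]
  · rintro ⟨t, ht⟩
    have ht := (key t).1 ht
    refine ⟨Real.log n - t * Real.log b, ⟨by linarith, by linarith⟩, ?_⟩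
    rw [← sub_eq_zero, ← AddCircle.coe_sub, AddCircle.coe_eq_zero_iff]
    exact ⟨-t, by simp⟩

lemma weighted_limit {q : ℕ} [NeZero q] {a : ZMod q} (ha : IsUnit a) {b S : ℕ} (hb : 2 ≤ b)
    (hS : 1 ≤ S) (E : Set ℕ)
    (hE : E = arcSet (T := Real.log b) (fun n : ℕ => ((Real.log n : ℝ) : AddCircle (Real.log b)))
      (Real.log S) (Real.log (S + 1))) :
    Tendsto (fun x : ℝ => (∑ n ∈ Finset.range (⌊x⌋₊ + 1),
        E.indicator (fun n => residueClass a n / n) n / Real.log n) / Real.log (Real.log x))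
      atTop (𝓝 ((1 / (Nat.totient q : ℝ)) * Real.logb b (1 + 1 / (S : ℝ)))) := by
  have hb0 : (0 : ℝ) < b := by positivity
  have hS0 : (0 : ℝ) < S := by exact_mod_cast hS
  have hlb : 0 < Real.log b := Real.log_pos (by exact_mod_cast hb)
  have : Fact (0 < Real.log b) := ⟨hlb⟩
  have hr : ∀ n : ℕ, 0 ≤ residueClass a n / n := fun n =>
    div_nonneg (residueClass_nonneg a n) (Nat.cast_nonneg n)
  have h1 : Real.log (S + 1) ≤ Real.log S + Real.log b := by
    rw [← Real.log_mul hS0.ne' hb0.ne']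
    apply Real.log_le_log (by positivity)
    have : S + 1 ≤ S * b := by nlinarith
    exact_mod_cast this
  have lim := arc_limit (T := Real.log b) (κ := (q.totient : ℝ)⁻¹)
    (u := fun δ n => δ * (residueClass a n / n * (n : ℝ) ^ (-δ)))
    (x := fun n : ℕ => ((Real.log n : ℝ) : AddCircle (Real.log b))) (by positivity)
    (fun δ hδ n => mul_nonneg hδ.le (mul_nonneg (hr n) (by positivity)))
    (fun δ hδ => (summable_base a δ hδ).mul_left δ)
    (fun k => by
      have := fourier_limit ha (Real.log b) hlb k
      refine (this.congr fun δ => ?_).trans (le_of_eq ?_)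
      · rw [← tsum_mul_left]
        refine tsum_congr fun n => ?_
        push_cast
        ring
      · push_cast; rfl)
    (α := Real.log S) (β := Real.log (S + 1)) (Real.log_le_log hS0 (by linarith)) h1
  rw [← hE] at lim
  have hκ : (q.totient : ℝ)⁻¹ * ((Real.log (S + 1) - Real.log S) / Real.log b) =
      (1 / (Nat.totient q : ℝ)) * Real.logb b (1 + 1 / (S : ℝ)) := by
    rw [one_div, Real.logb, ← Real.log_div (by positivity) hS0.ne']
    congr 3
    field_simp
  rw [hκ] at lim
  set w : ℕ → ℝ := E.indicator (fun n : ℕ => residueClass a n / n) with hw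
  have hw0 : ∀ n, 0 ≤ w n := fun n => Set.indicator_nonneg (fun n _ => hr n) n
  have hwz : ∀ n, n < 2 → w n = 0 := by
    intro n hn
    have h : residueClass a n = 0 := by
      interval_cases n <;> simp [Set.indicator]
    rw [hw]
    by_cases hn : n ∈ E
    · rw [Set.indicator_of_mem hn, h, zero_div]
    · rw [Set.indicator_of_notMem hn]
  have hws : ∀ δ : ℝ, 0 < δ → Summable fun n : ℕ => w n * (n : ℝ) ^ (-δ) := by
    intro δ hδ
    refine (summable_base a δ hδ).of_nonneg_of_le
      (fun n => mul_nonneg (hw0 n) (by positivity)) (fun n => ?_)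
    exact mul_le_mul_of_nonneg_right (Set.indicator_le_self' (fun n _ => hr n) n) (by positivity)
  have lim2 : Tendsto (fun δ : ℝ => δ * ∑' n : ℕ, w n * (n : ℝ) ^ (-δ)) (𝓝[>] 0)
      (𝓝 ((1 / (Nat.totient q : ℝ)) * Real.logb b (1 + 1 / (S : ℝ)))) := by
    refine lim.congr fun δ => ?_
    rw [← tsum_mul_left]
    refine tsum_congr fun n => ?_
    by_cases hn : n ∈ E <;> simp [hw, hn]
  obtain ⟨hs, hd⟩ := hasDerivAt_series hw0 hwz hws
  refine tauber (a := fun n => w n / Real.log n) (fun n => ?_) ?_ hs (ratio hd lim2)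
  · exact div_nonneg (hw0 n) (Real.log_natCast_nonneg n)
  · simp

end final

end BenfordAP

theorem benford_primes_in_AP
    (a q : ℕ) (ha : 0 < a) (hq : 0 < q) (hcop : Nat.Coprime a q)
    (b S m : ℕ) (hb : 2 ≤ b) (hm : 1 ≤ m)
    (hS₁ : b ^ (m - 1) ≤ S) (hS₂ : S < b ^ m) :
    Tendsto (fun x : ℝ =>
        (∑' p : {p : ℕ // p.Prime ∧ p % q = a % q ∧
            (∃ t : ℕ, S * b ^ t ≤ p ∧ p < (S + 1) * b ^ t) ∧ (p : ℝ) ≤ x},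
          (1 : ℝ) / (p.1 : ℝ)) / Real.log (Real.log x))
      atTop (nhds ((1 / (Nat.totient q : ℝ)) * Real.logb b (1 + 1 / (S : ℝ)))) := by
  classical
  have : NeZero q := ⟨hq.ne'⟩
  have hS : 1 ≤ S := le_trans (Nat.one_le_pow _ _ (by omega)) hS₁
  have hunit : IsUnit (a : ZMod q) := (ZMod.isUnit_iff_coprime a q).2 hcop
  obtain ⟨E, hE⟩ : ∃ E : Set ℕ, E = BenfordAP.arcSet (T := Real.log b)
      (fun n : ℕ => ((Real.log n : ℝ) : AddCircle (Real.log b)))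
      (Real.log S) (Real.log (S + 1)) := ⟨_, rfl⟩
  have lim := BenfordAP.weighted_limit hunit hb hS E hE
  set w : ℕ → ℝ := fun n =>
    E.indicator (fun n : ℕ => ArithmeticFunction.vonMangoldt.residueClass (a : ZMod q) n / n) n /
      Real.log n with hw
  set c : ℕ → ℝ := fun n => if n.Prime ∧ n % q = a % q ∧
    (∃ t : ℕ, S * b ^ t ≤ n ∧ n < (S + 1) * b ^ t) then (1 : ℝ) / n else 0 with hc
  have hsum : Summable fun n => c n - w n := by
    have hnp := (ArithmeticFunction.vonMangoldt.summable_residueClass_non_primes_div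
      (a : ZMod q)).mul_left (Real.log 2)⁻¹
    refine Summable.of_norm_bounded_eventually_nat hnp ?_
    filter_upwards [eventually_ge_atTop S, eventually_ge_atTop 2] with n hn hn2
    have hmem : n ∈ E ↔ ∃ t : ℕ, S * b ^ t ≤ n ∧ n < (S + 1) * b ^ t := by
      rw [hE]; exact BenfordAP.arc_iff hb hS hn
    have hl2 : 0 < Real.log 2 := Real.log_pos (by norm_num)
    have hl : Real.log 2 ≤ Real.log n := Real.log_le_log (by norm_num) (by exact_mod_cast hn2)
    have hr : 0 ≤ ArithmeticFunction.vonMangoldt.residueClass (a : ZMod q) n / n :=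
      div_nonneg (ArithmeticFunction.vonMangoldt.residueClass_nonneg _ n) (Nat.cast_nonneg n)
    by_cases hp : n.Prime
    · have hcw : c n = w n := by
        have hmod : ((n : ZMod q) = (a : ZMod q)) ↔ n % q = a % q :=
          ZMod.natCast_eq_natCast_iff' n a q
        simp only [hc, hw, Set.indicator, hmem, Set.mem_ofPred_eq, hmod, hp, true_and]
        by_cases h1 : n % q = a % q <;>
          by_cases h2 : ∃ t : ℕ, S * b ^ t ≤ n ∧ n < (S + 1) * b ^ t
        · simp only [h1, h2, and_self, if_true,
            ArithmeticFunction.vonMangoldt_apply_prime hp]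
          have : Real.log n ≠ 0 := by linarith
          field_simp
        all_goals simp [h1, h2]
      simp [hcw, hp]
    · have hc0 : c n = 0 := by simp [hc, hp]
      have hw0 : 0 ≤ w n := div_nonneg (Set.indicator_nonneg (fun n _ =>
        div_nonneg (ArithmeticFunction.vonMangoldt.residueClass_nonneg _ n) (Nat.cast_nonneg n)) n)
        (by linarith)
      rw [hc0, zero_sub, norm_neg, Real.norm_of_nonneg hw0, if_neg hp, ← div_eq_inv_mul]
      refine div_le_div₀ hr ?_ hl2 hl
      by_cases h : n ∈ E
      · rw [Set.indicator_of_mem h]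
      · rw [Set.indicator_of_notMem h]; exact hr
  have hLL : Tendsto (fun x : ℝ => Real.log (Real.log x)) atTop atTop :=
    Real.tendsto_log_atTop.comp Real.tendsto_log_atTop
  have hfl : Tendsto (fun x : ℝ => ⌊x⌋₊ + 1) atTop atTop :=
    (tendsto_add_atTop_nat 1).comp tendsto_nat_floor_atTop
  have hdiff := (hsum.hasSum.tendsto_sum_nat.comp hfl).div_atTop hLL
  have htot := hdiff.add lim
  rw [zero_add] at htot
  refine htot.congr' ?_
  filter_upwards [eventually_ge_atTop 0] with x hx
  rw [← add_div]
  congr 1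
  rw [Function.comp_apply, ← Finset.sum_add_distrib]
  refine (Finset.sum_congr rfl fun n _ => sub_add_cancel (c n) (w n)).trans ?_
  have e := tsum_subtype {p : ℕ | p.Prime ∧ p % q = a % q ∧
            (∃ t : ℕ, S * b ^ t ≤ p ∧ p < (S + 1) * b ^ t) ∧ (p : ℝ) ≤ x}
          (fun p : ℕ => (1 : ℝ) / (p : ℝ))
  refine Eq.trans ?_ e.symm
  rw [tsum_eq_sum (s := Finset.range (⌊x⌋₊ + 1))]
  · refine Finset.sum_congr rfl fun n hn => ?_
    have hnx : (n : ℝ) ≤ x := (Nat.le_floor_iff hx).1 (Nat.lt_succ_iff.1 (Finset.mem_range.1 hn))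
    simp only [hc, Set.indicator, Set.mem_ofPred_eq, hnx, and_true]
  · intro n hn
    refine Set.indicator_of_notMem ?_ _
    rintro ⟨-, -, -, h⟩
    exact hn (Finset.mem_range.2 (Nat.lt_succ_iff.2 ((Nat.le_floor_iff hx).2 h)))
end

section
/- Let d ∈ {1, 2, …, 9}. Then lim_{x→∞} ( ∑_{p ≤ x prime, p begins with digit d in base 10} 1/p ) / ( ∑_{p ≤ x prime} 1/p ) = log_{10}(1 + 1/d). -/
open Filter Real

namespace WB
open ArithmeticFunction ArithmeticFunction.vonMangoldt

/-- weights `Λ n / log n`. -/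
noncomputable def w (n : ℕ) : ℝ := vonMangoldt n / Real.log n

lemma w_nonneg (n : ℕ) : 0 ≤ w n := div_nonneg vonMangoldt_nonneg (Real.log_natCast_nonneg n)

lemma w_le_one (n : ℕ) : w n ≤ 1 := div_le_one_of_le₀ vonMangoldt_le_log (Real.log_natCast_nonneg n)

lemma w_mul_log (n : ℕ) : w n * Real.log n = vonMangoldt n := by
  unfold w
  by_cases h : Real.log n = 0
  · have h1 : vonMangoldt n ≤ Real.log n := vonMangoldt_le_log
    have h2 : 0 ≤ vonMangoldt n := vonMangoldt_nonneg
    rw [h] at h1 ⊢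
    simp; linarith
  · field_simp

/-- `Λ` has L-series bounded by `C + 1/|s-1|` on horizontal segments. -/
lemma vm_bound (t : ℝ) : ∃ C : ℝ, ∀ σ : ℝ, 0 < σ → σ ≤ 1 →
    ‖LSeries (fun n => ((vonMangoldt n : ℝ) : ℂ)) (1 + σ + t * Complex.I)‖ ≤
      C + 1 / ‖(σ + t * Complex.I : ℂ)‖ := by
  have hc : ContinuousOn (fun σ : ℝ => LFunctionResidueClassAux (1 : ZMod 1) (1 + σ + t * Complex.I))
      (Set.Icc 0 1) := by
    refine (continuousOn_LFunctionResidueClassAux (1 : ZMod 1)).comp (by fun_prop) ?_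
    intro σ hσ
    simpa using hσ.1
  obtain ⟨C, hC⟩ := isCompact_Icc.exists_bound_of_continuousOn hc
  refine ⟨C, fun σ h0 h1 => ?_⟩
  have h2 := hC σ ⟨h0.le, h1⟩
  have h3 := eqOn_LFunctionResidueClassAux (a := (1 : ZMod 1)) isUnit_one
    (x := 1 + σ + t * Complex.I) (by simpa using h0)
  have h4 : residueClass (1 : ZMod 1) = fun n => vonMangoldt n := by
    ext n
    have : (n : ZMod 1) = 1 := Subsingleton.elim _ _
    simp [residueClass, this]
  rw [h3, h4] at h2
  have h5 : (1 + σ + t * Complex.I - 1 : ℂ) = σ + t * Complex.I := by ring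
  simp only [h5, Nat.totient_one, Nat.cast_one, inv_one] at h2
  have h6 := norm_le_norm_add_norm_sub' (LSeries (fun n => ((vonMangoldt n : ℝ) : ℂ)) (1 + σ + t * Complex.I)) (1 / (σ + t * Complex.I))
  rw [norm_div, norm_one] at h6
  linarith

lemma vm_real (σ : ℝ) (h : 0 < σ) :
    Summable (fun n : ℕ => vonMangoldt n / (n : ℝ) ^ (1 + σ)) ∧
    ((∑' n : ℕ, vonMangoldt n / (n : ℝ) ^ (1 + σ) : ℝ) : ℂ) =
      LSeries (fun n => ((vonMangoldt n : ℝ) : ℂ)) (1 + σ) := by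
  have h0 : ∀ n : ℕ, LSeries.term (fun n => ((vonMangoldt n : ℝ) : ℂ)) (1 + σ) n =
      ((vonMangoldt n / (n : ℝ) ^ (1 + σ) : ℝ) : ℂ) := by
    intro n
    rcases eq_or_ne n 0 with rfl | hn
    · simp
    · rw [LSeries.term_of_ne_zero hn, Complex.ofReal_div, Complex.ofReal_cpow n.cast_nonneg]
      simp
  constructor
  · have := LSeriesSummable_vonMangoldt (s := 1 + σ) (by simpa using h)
    unfold LSeriesSummable at this
    rw [funext h0] at this
    exact_mod_cast this
  · rw [LSeries, Complex.ofReal_tsum]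
    exact tsum_congr fun n => (h0 n).symm

lemma vm_real_bound : ∃ C : ℝ, ∀ σ : ℝ, 0 < σ → σ ≤ 1 →
    σ * ∑' n : ℕ, vonMangoldt n / (n : ℝ) ^ (1 + σ) ≤ C := by
  obtain ⟨C, hC⟩ := vm_bound 0
  refine ⟨|C| + 1, fun σ h0 h1 => ?_⟩
  have := hC σ h0 h1
  simp only [Complex.ofReal_zero, zero_mul, add_zero, Complex.norm_real] at this
  rw [← (vm_real σ h0).2, Complex.norm_real, Real.norm_of_nonneg h0.le] at this
  have h2 := (le_abs_self _).trans this
  calc _ ≤ σ * (C + 1 / σ) := by gcongr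
    _ = σ * C + 1 := by field_simp
    _ ≤ _ := by nlinarith [le_abs_self C, abs_nonneg C]

lemma w_abscissa : LSeries.abscissaOfAbsConv (fun n => (w n : ℂ)) ≤ 1 := by
  refine LSeries.abscissaOfAbsConv_le_of_le_const ⟨1, fun n _ => ?_⟩
  rw [Complex.norm_real, Real.norm_of_nonneg (w_nonneg n)]
  exact w_le_one n

lemma w_bound (t : ℝ) (ht : t ≠ 0) : ∃ C : ℝ, ∀ σ : ℝ, 0 < σ → σ ≤ 1 →
    ‖LSeries (fun n => (w n : ℂ)) (1 + σ + t * Complex.I)‖ ≤ C := by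
  obtain ⟨C, hC⟩ := vm_bound t
  set F : ℝ → ℂ := fun σ => LSeries (fun n => (w n : ℂ)) (1 + σ + t * Complex.I) with hF
  have hlog : LSeries.logMul (fun n => (w n : ℂ)) = fun n => ((vonMangoldt n : ℝ) : ℂ) := by
    ext n
    rw [LSeries.logMul, ← w_mul_log]
    push_cast
    ring
  have hd : ∀ σ ∈ Set.Ioc (0:ℝ) 1, HasDerivWithinAt F
      (-LSeries (fun n => ((vonMangoldt n : ℝ) : ℂ)) (1 + σ + t * Complex.I)) (Set.Ioc 0 1) σ := by
    intro σ hσ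
    have h1 : HasDerivAt (LSeries (fun n => (w n : ℂ)))
      (-LSeries (fun n => ((vonMangoldt n : ℝ) : ℂ)) (1 + σ + t * Complex.I)) (1 + σ + t * Complex.I) := by
      rw [← hlog]
      apply LSeries_hasDerivAt
      refine w_abscissa.trans_lt ?_
      have := hσ.1
      have h2 : (1:ℝ) < (1 + σ + t * Complex.I : ℂ).re := by simpa using this
      exact_mod_cast h2
    have h2 : HasDerivAt (fun σ : ℝ => (1 + σ + t * Complex.I : ℂ)) 1 σ := by
      have := (Complex.ofRealCLM.hasDerivAt (x := σ))
      simpa using (this.const_add (1:ℂ)).add_const (t * Complex.I : ℂ)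
    have h3 := HasDerivAt.comp σ h1 h2
    rw [mul_one] at h3
    exact h3.hasDerivWithinAt
  have hb : ∀ σ ∈ Set.Ioc (0:ℝ) 1,
      ‖-LSeries (fun n => ((vonMangoldt n : ℝ) : ℂ)) (1 + σ + t * Complex.I)‖ ≤ C + 1 / |t| := by
    intro σ hσ
    rw [norm_neg]
    refine (hC σ hσ.1 hσ.2).trans ?_
    have : |t| ≤ ‖(σ + t * Complex.I : ℂ)‖ := by
      simpa using Complex.abs_im_le_norm (σ + t * Complex.I : ℂ)
    have := abs_pos.2 ht
    gcongr
  refine ⟨‖F 1‖ + (C + 1 / |t|), fun σ h0 h1 => ?_⟩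
  have h2 := Convex.norm_image_sub_le_of_norm_hasDerivWithin_le hd hb (convex_Ioc 0 1)
    (x := 1) (y := σ) (by simp) ⟨h0, h1⟩
  have h3 : ‖σ - 1‖ ≤ 1 := by rw [Real.norm_eq_abs, abs_le]; constructor <;> linarith
  have h4 : 0 ≤ C + 1 / |t| := (norm_nonneg _).trans (hb 1 (by simp))
  have h5 := norm_le_norm_add_norm_sub' (F σ) (F 1)
  change ‖F σ‖ ≤ _
  nlinarith

lemma w_partial (t : ℝ) (ht : t ≠ 0) : ∃ C : ℝ, ∀ N : ℕ, 3 ≤ N →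
    ‖∑ n ∈ Finset.range (N + 1), LSeries.term (fun n => (w n : ℂ)) (1 + t * Complex.I) n‖ ≤ C := by
  obtain ⟨C, hC⟩ := w_bound t ht
  obtain ⟨D, hD⟩ := vm_real_bound
  refine ⟨C + 3 * D, fun N hN => ?_⟩
  have hN0 : (0:ℝ) < N := by positivity
  have hl : 1 ≤ Real.log N := by
    rw [Real.le_log_iff_exp_le hN0]
    have : (3:ℝ) ≤ N := by exact_mod_cast hN
    linarith [Real.exp_one_lt_d9]
  set σ := 1 / Real.log N with hσ
  have h0 : 0 < σ := by positivity
  have h1 : σ ≤ 1 := by rw [hσ, div_le_one (by positivity)]; exact hl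
  set s : ℂ := 1 + σ + t * Complex.I with hs
  set a : ℕ → ℂ := fun n => if n ∈ Finset.range (N + 1) then
    LSeries.term (fun n => (w n : ℂ)) (1 + t * Complex.I) n else 0 with ha
  have hsum : ∑ n ∈ Finset.range (N + 1), LSeries.term (fun n => (w n : ℂ)) (1 + t * Complex.I) n
      = ∑' n, a n := by
    rw [tsum_eq_sum (s := Finset.range (N + 1))]
    · exact Finset.sum_congr rfl fun n hn => by simp only [ha, if_pos hn]
    · intro n hn; simp only [ha, if_neg hn]
  have hasum : Summable a := summable_of_ne_finset_zero (s := Finset.range (N + 1))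
    fun n hn => by simp only [ha, if_neg hn]
  have hbsum : Summable (LSeries.term (fun n => (w n : ℂ)) s) := by
    apply LSeriesSummable_of_abscissaOfAbsConv_lt_re
    refine w_abscissa.trans_lt ?_
    have h2 : (1:ℝ) < s.re := by simpa [hs] using h0
    exact_mod_cast h2
  have hterm : ∀ n, ‖a n - LSeries.term (fun n => (w n : ℂ)) s n‖ ≤
      3 * σ * (vonMangoldt n / (n : ℝ) ^ (1 + σ)) := by
    intro n
    rcases eq_or_ne n 0 with rfl | hn
    · simp [ha]
    have hn0 : (0:ℝ) < n := by positivity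
    have hnl : 0 ≤ Real.log n := Real.log_natCast_nonneg n
    have hpow : (n:ℝ) ^ (1 + σ) = n * (n:ℝ) ^ σ := by rw [Real.rpow_add hn0, Real.rpow_one]
    have hps : (0:ℝ) < (n:ℝ) ^ σ := by positivity
    by_cases hnN : n ∈ Finset.range (N + 1)
    · simp only [ha, if_pos hnN]
      rw [LSeries.term_of_ne_zero hn, LSeries.term_of_ne_zero hn]
      have hnC : (n:ℂ) ≠ 0 := by exact_mod_cast hn
      have e1 : (w n : ℂ) / (n:ℂ) ^ (1 + t * Complex.I) - (w n : ℂ) / (n:ℂ) ^ s =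
          ((w n * (1 - ((n:ℝ) ^ σ)⁻¹) : ℝ) : ℂ) / (n:ℂ) ^ (1 + t * Complex.I) := by
        have : s = (1 + t * Complex.I) + σ := by rw [hs]; ring
        rw [this, Complex.cpow_add (1 + t * Complex.I) (σ : ℂ) hnC]
        push_cast
        rw [Complex.ofReal_cpow hn0.le]
        have h1 : (n:ℂ) ^ (1 + t * Complex.I) ≠ 0 := by simp [Complex.cpow_eq_zero_iff, hnC]
        have h2 : (n:ℂ) ^ (σ:ℂ) ≠ 0 := by simp [Complex.cpow_eq_zero_iff, hnC]
        push_cast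
        generalize (n:ℂ) ^ (1 + t * Complex.I) = A at *
        generalize (n:ℂ) ^ (σ:ℂ) = B at *
        field_simp
      rw [e1, norm_div, Complex.norm_natCast_cpow_of_pos (Nat.pos_of_ne_zero hn), Complex.norm_real]
      simp only [Complex.add_re, Complex.one_re, Complex.mul_re, Complex.ofReal_re, Complex.I_re,
        mul_zero, Complex.ofReal_im, Complex.I_im, mul_one, sub_zero, add_zero, Real.rpow_one]
      have e2 : (n:ℝ) ^ σ = Real.exp (σ * Real.log n) := by
        rw [Real.rpow_def_of_pos hn0, mul_comm]
      have e3 : ((n:ℝ) ^ σ)⁻¹ = Real.exp (-(σ * Real.log n)) := by rw [e2, Real.exp_neg]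
      have e4 : 1 - ((n:ℝ) ^ σ)⁻¹ ≤ σ * Real.log n := by
        rw [e3]; linarith [Real.add_one_le_exp (-(σ * Real.log n))]
      have e5 : 0 ≤ 1 - ((n:ℝ) ^ σ)⁻¹ := by
        rw [e3, sub_nonneg, Real.exp_le_one_iff]
        have : 0 ≤ σ * Real.log n := by positivity
        linarith
      have e6 : (n:ℝ) ^ σ ≤ 3 := by
        rw [e2]
        have : σ * Real.log n ≤ 1 := by
          rw [hσ, div_mul_eq_mul_div, one_mul, div_le_one (by positivity)]
          apply Real.log_le_log hn0
          have : n ≤ N := by simp at hnN; omega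
          exact_mod_cast this
        exact (Real.exp_le_exp.2 this).trans (by linarith [Real.exp_one_lt_d9])
      rw [Real.norm_of_nonneg (mul_nonneg (w_nonneg n) e5), hpow]
      have e7 : w n * (1 - ((n:ℝ) ^ σ)⁻¹) ≤ σ * vonMangoldt n := by
        rw [← w_mul_log]
        nlinarith [mul_le_mul_of_nonneg_left e4 (w_nonneg n)]
      have e8 : 0 ≤ vonMangoldt n := vonMangoldt_nonneg
      rw [div_le_iff₀ hn0]
      refine e7.trans ?_
      have : 3 * σ * (vonMangoldt n / (n * (n:ℝ) ^ σ)) * n = σ * vonMangoldt n * (3 / (n:ℝ)^σ) := by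
        field_simp
      rw [this]
      have e9 : 1 ≤ 3 / (n:ℝ)^σ := by rwa [le_div_iff₀ hps, one_mul]
      have : 0 ≤ σ * vonMangoldt n := by positivity
      nlinarith
    · simp only [ha, if_neg hnN, zero_sub, norm_neg]
      rw [LSeries.norm_term_eq, if_neg hn, Complex.norm_real, Real.norm_of_nonneg (w_nonneg n)]
      have : s.re = 1 + σ := by simp [hs]
      rw [this, ← mul_div_assoc]
      apply div_le_div_of_nonneg_right _ (by positivity)
      have e1 : 1 ≤ σ * Real.log n := by
        rw [hσ, div_mul_eq_mul_div, one_mul, le_div_iff₀ (by positivity), one_mul]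
        apply Real.log_le_log hN0
        have : N ≤ n := by simp at hnN; omega
        exact_mod_cast this
      rw [← w_mul_log]
      nlinarith [mul_le_mul_of_nonneg_left e1 (w_nonneg n), w_nonneg n]
  have hV := (vm_real σ h0).1.mul_left (3 * σ)
  have hdiff : ‖∑' n, a n - LSeries (fun n => (w n : ℂ)) s‖ ≤ 3 * D := by
    rw [LSeries, ← hasum.tsum_sub hbsum]
    refine (tsum_of_norm_bounded hV.hasSum hterm).trans ?_
    rw [tsum_mul_left]
    have := hD σ h0 h1
    linarith
  have h2 := norm_le_norm_add_norm_sub' (∑' n, a n) (LSeries (fun n => (w n : ℂ)) s)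
  rw [hsum]
  have := hC σ h0 h1
  linarith

lemma prime_partial (t : ℝ) (ht : t ≠ 0) : ∃ C : ℝ, ∀ N : ℕ, 3 ≤ N →
    ‖∑ n ∈ (Finset.range (N + 1)).filter Nat.Prime, 1 / (n : ℂ) ^ (1 + t * Complex.I)‖ ≤ C := by
  obtain ⟨C, hC⟩ := w_partial t ht
  have hS := summable_residueClass_non_primes_div (a := (1 : ZMod 1))
  have h4 : residueClass (1 : ZMod 1) = fun n => vonMangoldt n := by
    ext n
    have : (n : ZMod 1) = 1 := Subsingleton.elim _ _
    simp [residueClass, this]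
  rw [h4] at hS
  set g : ℕ → ℝ := fun n => (if n.Prime then 0 else vonMangoldt n) / n with hg
  have hg0 : ∀ n, 0 ≤ g n := fun n => by
    have : 0 ≤ vonMangoldt n := vonMangoldt_nonneg
    simp only [hg]; positivity
  refine ⟨C + (∑' n, g n) * (1 / Real.log 2), fun N hN => ?_⟩
  have hl2 : 0 < Real.log 2 := Real.log_pos (by norm_num)
  have hdiff : ‖∑ n ∈ (Finset.range (N + 1)).filter Nat.Prime, 1 / (n : ℂ) ^ (1 + t * Complex.I) -
      ∑ n ∈ Finset.range (N + 1), LSeries.term (fun n => (w n : ℂ)) (1 + t * Complex.I) n‖ ≤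
      (∑' n, g n) * (1 / Real.log 2) := by
    rw [Finset.sum_filter, ← Finset.sum_sub_distrib]
    refine (norm_sum_le _ _).trans ?_
    refine le_trans ?_ (mul_le_mul_of_nonneg_right (hS.sum_le_tsum (Finset.range (N + 1)) fun n _ => hg0 n)
      (by positivity))
    rw [Finset.sum_mul]
    refine Finset.sum_le_sum fun n _ => ?_
    split_ifs with hp
    · have hlp : Real.log n ≠ 0 := (Real.log_pos (by exact_mod_cast hp.one_lt)).ne'
      rw [LSeries.term_of_ne_zero hp.ne_zero, w, vonMangoldt_apply_prime hp, div_self hlp]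
      have := hg0 n
      simp
      positivity
    · rw [zero_sub, norm_neg, LSeries.norm_term_eq]
      split_ifs with hn
      · have := hg0 n
        positivity
      simp only [Complex.norm_real, Real.norm_of_nonneg (w_nonneg n)]
      simp only [Complex.add_re, Complex.one_re, Complex.mul_re, Complex.ofReal_re, Complex.I_re,
        mul_zero, Complex.ofReal_im, Complex.I_im, mul_one, sub_zero, add_zero, Real.rpow_one]
      rw [div_mul_eq_mul_div]
      apply div_le_div_of_nonneg_right _ (by positivity)
      rcases eq_or_ne n 1 with rfl | hn1
      · simp [w]
      have : Real.log 2 ≤ Real.log n := by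
        apply Real.log_le_log (by norm_num)
        have : 2 ≤ n := by omega
        exact_mod_cast this
      have e : 0 ≤ vonMangoldt n := vonMangoldt_nonneg
      rw [w, div_eq_mul_one_div, if_neg hp]
      gcongr
  have h2 := norm_le_norm_add_norm_sub' (∑ n ∈ (Finset.range (N + 1)).filter Nat.Prime, 1 / (n : ℂ) ^ (1 + t * Complex.I))
    (∑ n ∈ Finset.range (N + 1), LSeries.term (fun n => (w n : ℂ)) (1 + t * Complex.I) n)
  have := hC N hN
  linarith

end WB
namespace WB
open MeasureTheory AddCircle Topology

/-- primes up to `N` -/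
def Pr (N : ℕ) : Finset ℕ := (Finset.range (N + 1)).filter Nat.Prime

/-- sum of reciprocals of the primes up to `N` -/
noncomputable def S (N : ℕ) : ℝ := ∑ p ∈ Pr N, 1 / (p : ℝ)

lemma S_tendsto : Tendsto S atTop atTop := by
  have h := (not_summable_iff_tendsto_nat_atTop_of_nonneg (fun n => ?_)).1
    not_summable_one_div_on_primes
  · have h2 := h.comp (tendsto_add_atTop_nat 1)
    refine h2.congr fun N => ?_
    simp only [S, Pr, Function.comp, Finset.sum_filter, Set.indicator, Set.mem_ofPred_eq]
  · exact Set.indicator_nonneg (fun _ _ => by positivity) n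

lemma S_pos (N : ℕ) : 0 < S (N + 2) := by
  refine Finset.sum_pos (fun p hp => ?_) ⟨2, ?_⟩
  · have : p.Prime := (Finset.mem_filter.1 hp).2
    have := this.pos
    positivity
  · simp [Pr, Nat.prime_two]

/-- position of `n` on the circle -/
noncomputable def pos (n : ℕ) : AddCircle (1 : ℝ) := ((Real.logb 10 n : ℝ) : AddCircle (1 : ℝ))

lemma fourier_pos (k : ℤ) (n : ℕ) (hn : n ≠ 0) : fourier k (pos n) / (n : ℂ) =
    1 / (n : ℂ) ^ (1 + ((-(2 * π * k / Real.log 10) : ℝ) : ℂ) * Complex.I) := by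
  have hnC : (n : ℂ) ≠ 0 := by exact_mod_cast hn
  rw [pos, fourier_coe_apply, Complex.cpow_add _ _ hnC, Complex.cpow_one, one_div, mul_inv, mul_comm,
    div_eq_mul_inv, mul_comm, ← Complex.cpow_neg, Complex.cpow_def_of_ne_zero hnC,
    ← Complex.natCast_log, Real.logb]
  congr 2
  push_cast
  ring

/-- weighted counting measure -/
noncomputable def mu (N : ℕ) : Measure (AddCircle (1 : ℝ)) :=
  ∑ p ∈ Pr (N + 2), ENNReal.ofReal (1 / (p : ℝ) / S (N + 2)) • Measure.dirac (pos p)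

lemma mu_apply (N : ℕ) {E : Set (AddCircle (1 : ℝ))} (hE : MeasurableSet E) :
    mu N E = ENNReal.ofReal (∑ p ∈ Pr (N + 2), E.indicator (fun _ => 1 / (p : ℝ) / S (N + 2)) (pos p)) := by
  have := (S_pos N).le
  rw [mu, Measure.finsetSum_apply, ENNReal.ofReal_sum_of_nonneg]
  · refine Finset.sum_congr rfl fun p _ => ?_
    rw [Measure.smul_apply, Measure.dirac_apply' _ hE]
    by_cases h : pos p ∈ E <;> simp [h]
  · intro p _
    exact Set.indicator_nonneg (fun _ _ => by positivity) _

instance mu_prob (N : ℕ) : IsProbabilityMeasure (mu N) := by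
  constructor
  rw [mu_apply N MeasurableSet.univ]
  simp only [Set.indicator_univ]
  rw [← Finset.sum_div]
  change ENNReal.ofReal (S (N + 2) / S (N + 2)) = 1
  rw [div_self (S_pos N).ne', ENNReal.ofReal_one]

lemma mu_integral (N : ℕ) (f : C(AddCircle (1 : ℝ), ℂ)) :
    ∫ u, f u ∂(mu N) = (∑ p ∈ Pr (N + 2), f (pos p) / (p : ℂ)) / (S (N + 2) : ℂ) := by
  have := (S_pos N).le
  rw [mu, integral_finsetSum_measure, Finset.sum_div]
  · refine Finset.sum_congr rfl fun p _ => ?_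
    rw [integral_smul_measure, integral_dirac, ENNReal.toReal_ofReal (by positivity),
      Complex.real_smul]
    push_cast
    ring
  · intro p _
    refine Integrable.smul_measure ?_ ENNReal.ofReal_ne_top
    exact integrable_dirac (by simp)

lemma haar_fourier (k : ℤ) (hk : k ≠ 0) :
    ∫ u, fourier k u ∂(haarAddCircle : Measure (AddCircle (1 : ℝ))) = 0 := by
  have h := congrFun (fourierCoeff_fourier (T := 1) k) 0
  rw [Pi.single_eq_of_ne hk.symm] at h
  simpa [fourierCoeff] using h

lemma tendsto_fourier (k : ℤ) : Tendsto (fun N => ∫ u, fourier k u ∂(mu N)) atTop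
    (𝓝 (∫ u, fourier k u ∂(haarAddCircle : Measure (AddCircle (1 : ℝ))))) := by
  rcases eq_or_ne k 0 with rfl | hk
  · simp
  rw [haar_fourier k hk]
  have hl : Real.log 10 ≠ 0 := (Real.log_pos (by norm_num)).ne'
  obtain ⟨C, hC⟩ := prime_partial (-(2 * π * k / Real.log 10)) (by
    have : (k : ℝ) ≠ 0 := by exact_mod_cast hk
    have := Real.pi_ne_zero
    exact neg_ne_zero.2 (div_ne_zero (by positivity) hl))
  have hS : Tendsto (fun N => C / S (N + 2)) atTop (𝓝 0) :=
    (S_tendsto.comp (tendsto_add_atTop_nat 2)).const_div_atTop C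
  refine squeeze_zero_norm' ?_ hS
  filter_upwards [eventually_ge_atTop 1] with N hN
  rw [mu_integral, norm_div, Complex.norm_real, Real.norm_of_nonneg (S_pos N).le]
  refine div_le_div_of_nonneg_right ?_ (S_pos N).le
  have := hC (N + 2) (by omega)
  refine le_trans (le_of_eq ?_) this
  congr 1
  refine Finset.sum_congr rfl fun p hp => ?_
  exact fourier_pos k p (Finset.mem_filter.1 hp).2.ne_zero

lemma tendsto_cont (f : C(AddCircle (1 : ℝ), ℂ)) : Tendsto (fun N => ∫ u, f u ∂(mu N)) atTop
    (𝓝 (∫ u, f u ∂(haarAddCircle : Measure (AddCircle (1 : ℝ))))) := by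
  have hInt : ∀ (g : C(AddCircle (1 : ℝ), ℂ)) (m : Measure (AddCircle (1 : ℝ))) [IsProbabilityMeasure m],
      Integrable g m := by
    intro g m _
    exact (BoundedContinuousFunction.mkOfCompact g).integrable m
  have hspan : ∀ g ∈ Submodule.span ℂ (Set.range (fourier (T := (1:ℝ)))),
      Tendsto (fun N => ∫ u, g u ∂(mu N)) atTop
        (𝓝 (∫ u, g u ∂(haarAddCircle : Measure (AddCircle (1 : ℝ))))) := by
    intro g hg
    induction hg using Submodule.span_induction with
    | mem x h => obtain ⟨k, rfl⟩ := h; exact tendsto_fourier k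
    | zero => simp
    | add x y _ _ hx hy =>
      simp only [ContinuousMap.add_apply]
      rw [integral_add (hInt x _) (hInt y _)]
      refine (hx.add hy).congr fun N => ?_
      rw [integral_add (hInt x _) (hInt y _)]
    | smul c x _ hx =>
      simp only [ContinuousMap.smul_apply, integral_smul]
      exact hx.const_smul c
  have hdist : ∀ (g : C(AddCircle (1 : ℝ), ℂ)) (m : Measure (AddCircle (1 : ℝ))) [IsProbabilityMeasure m],
      dist (∫ u, f u ∂m) (∫ u, g u ∂m) ≤ dist f g := by
    intro g m _
    rw [dist_eq_norm, ← integral_sub (hInt f m) (hInt g m)]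
    have := norm_integral_le_of_norm_le_const (μ := m) (f := fun u => f u - g u) (C := dist f g)
      (Eventually.of_forall fun u => by
        rw [← dist_eq_norm]; exact ContinuousMap.dist_apply_le_dist u)
    simpa using this
  rw [Metric.tendsto_atTop]
  intro ε hε
  have hf : f ∈ closure (Submodule.span ℂ (Set.range (fourier (T := (1:ℝ)))) : Set C(AddCircle (1 : ℝ), ℂ)) := by
    rw [← Submodule.topologicalClosure_coe, span_fourier_closure_eq_top]; trivial
  obtain ⟨g, hg, hfg⟩ := Metric.mem_closure_iff.1 hf (ε / 3) (by positivity)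
  obtain ⟨N₀, h₀⟩ := Metric.tendsto_atTop.1 (hspan g hg) (ε / 3) (by positivity)
  refine ⟨N₀, fun N hN => ?_⟩
  have h1 := hdist g (mu N)
  have h2 := hdist g (haarAddCircle : Measure (AddCircle (1 : ℝ)))
  have h3 := h₀ N hN
  have h4 := dist_triangle4_right (∫ u, f u ∂(mu N)) (∫ u, f u ∂(haarAddCircle : Measure (AddCircle (1 : ℝ))))
    (∫ u, g u ∂(mu N)) (∫ u, g u ∂(haarAddCircle : Measure (AddCircle (1 : ℝ))))
  linarith

lemma tendsto_pm : Tendsto (β := ProbabilityMeasure (AddCircle (1 : ℝ))) (fun N => ⟨mu N, mu_prob N⟩) atTop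
    (𝓝 ⟨haarAddCircle, inferInstance⟩) := by
  refine (ProbabilityMeasure.tendsto_iff_forall_integral_rclike_tendsto ℂ).2 ?_
  intro f
  exact tendsto_cont f.toContinuousMap

lemma haar_eq : (haarAddCircle : Measure (AddCircle (1 : ℝ))) = volume := by
  rw [volume_eq_smul_haarAddCircle]; simp

lemma vol_singleton (u : AddCircle (1 : ℝ)) : (volume : Measure (AddCircle (1 : ℝ))) {u} = 0 := by
  rw [AddCircle.add_projection_respects_measure 1 0 (measurableSet_singleton u)]
  apply Set.Subsingleton.measure_zero
  intro x hx y hy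
  have h1 : (x : AddCircle (1:ℝ)) = u := hx.1
  have h2 : (y : AddCircle (1:ℝ)) = u := hy.1
  exact (AddCircle.coe_eq_coe_iff_of_mem_Ioc hx.2 hy.2).1 (h1.trans h2.symm)

/-- the half open arc -/
def arc (a b : ℝ) : Set (AddCircle (1 : ℝ)) := (fun x : ℝ => (x : AddCircle (1 : ℝ))) '' Set.Ico a b

lemma arc_frontier (a b : ℝ) :
    frontier (arc a b) ⊆ {(a : AddCircle (1 : ℝ)), (b : AddCircle (1 : ℝ))} := by
  have hcont : Continuous (fun x : ℝ => (x : AddCircle (1 : ℝ))) := AddCircle.continuous_mk' 1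
  have h1 : closure (arc a b) ⊆ (fun x : ℝ => (x : AddCircle (1 : ℝ))) '' Set.Icc a b :=
    closure_minimal (Set.image_mono Set.Ico_subset_Icc_self)
      (isCompact_Icc.image hcont).isClosed
  have h2 : (fun x : ℝ => (x : AddCircle (1 : ℝ))) '' Set.Ioo a b ⊆ interior (arc a b) :=
    interior_maximal (Set.image_mono Set.Ioo_subset_Ico_self)
      (QuotientAddGroup.isOpenMap_coe _ isOpen_Ioo)
  rintro u ⟨hu1, hu2⟩
  obtain ⟨x, hx, rfl⟩ := h1 hu1
  have hx2 : x ∉ Set.Ioo a b := fun h => hu2 (h2 ⟨x, h, rfl⟩)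
  have : x = a ∨ x = b := by
    by_contra! h
    exact hx2 ⟨lt_of_le_of_ne hx.1 h.1.symm, lt_of_le_of_ne hx.2 h.2⟩
  rcases this with rfl | rfl <;> simp

lemma arc_meas (a b : ℝ) : MeasurableSet (arc a b) := by
  by_cases hab : a < b
  · have : arc a b = {(a : AddCircle (1:ℝ))} ∪ (fun x : ℝ => (x : AddCircle (1 : ℝ))) '' Set.Ioo a b := by
      rw [arc, ← Set.Ioo_insert_left hab, Set.image_insert_eq]; rfl
    rw [this]
    exact (measurableSet_singleton _).union
      (QuotientAddGroup.isOpenMap_coe _ isOpen_Ioo).measurableSet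
  · simp [arc, Set.Ico_eq_empty hab]

lemma arc_vol (a b : ℝ) (ha : 0 ≤ a) (hab : a ≤ b) (hb : b ≤ 1) :
    (volume : Measure (AddCircle (1 : ℝ))) (arc a b) = ENNReal.ofReal (b - a) := by
  have h := AddCircle.add_projection_respects_measure 1 0 (arc_meas a b)
  rw [h]
  apply le_antisymm
  · calc _ ≤ volume (Set.Icc a b ∪ {1}) := by
          refine measure_mono ?_
          rintro y ⟨⟨x, hx, hxy⟩, hy⟩
          rcases eq_or_ne y 1 with rfl | hy1
          · right; rfl
          left
          have hx' : x ∈ Set.Ico (0:ℝ) (0 + 1) := ⟨by linarith [hx.1], by linarith [hx.2]⟩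
          have hy' : y ∈ Set.Ico (0:ℝ) (0 + 1) :=
            ⟨hy.1.le, lt_of_le_of_ne hy.2 (by simpa using hy1)⟩
          have : x = y := (AddCircle.coe_eq_coe_iff_of_mem_Ico hx' hy').1 hxy
          rw [← this]
          exact ⟨hx.1, hx.2.le⟩
      _ ≤ volume (Set.Icc a b) + volume {(1:ℝ)} := measure_union_le _ _
      _ = _ := by simp
  · rw [← Real.volume_Ioo]
    refine measure_mono ?_
    intro y hy
    exact ⟨⟨y, ⟨hy.1.le, hy.2⟩, rfl⟩, by linarith [hy.1], by linarith [hy.2]⟩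

lemma tendsto_arc (a b : ℝ) (ha : 0 ≤ a) (hab : a ≤ b) (hb : b ≤ 1) :
    Tendsto (fun N => (∑ p ∈ Pr (N + 2), (arc a b).indicator (fun _ => 1 / (p : ℝ) / S (N + 2)) (pos p)))
      atTop (𝓝 (b - a)) := by
  have h := ProbabilityMeasure.tendsto_measure_of_null_frontier_of_tendsto' tendsto_pm
    (E := arc a b) (by
      change haarAddCircle _ = 0
      rw [haar_eq]
      refine measure_mono_null (arc_frontier a b) ?_
      rw [Set.insert_eq]
      exact measure_union_null (vol_singleton _) (vol_singleton _))
  change Tendsto (fun N => mu N (arc a b)) atTop (𝓝 (haarAddCircle (arc a b))) at h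
  rw [haar_eq, arc_vol a b ha hab hb] at h
  have h2 := (ENNReal.tendsto_toReal ENNReal.ofReal_ne_top).comp h
  rw [ENNReal.toReal_ofReal (by linarith)] at h2
  refine h2.congr fun N => ?_
  have := (S_pos N).le
  rw [Function.comp, mu_apply N (arc_meas a b), ENNReal.toReal_ofReal]
  exact Finset.sum_nonneg fun p _ => Set.indicator_nonneg (fun _ _ => by positivity) _

lemma digit_iff (d : ℕ) (hd₁ : 1 ≤ d) (hd₉ : d ≤ 9) (n : ℕ) (hn : n ≠ 0) :
    pos n ∈ arc (Real.logb 10 d) (Real.logb 10 (d + 1)) ↔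
      ∃ t : ℕ, d * 10 ^ t ≤ n ∧ n < (d + 1) * 10 ^ t := by
  have hn0 : (0:ℝ) < n := by positivity
  have hd0 : (0:ℝ) < d := by positivity
  have hkey : ∀ (c : ℕ), 0 < c → ∀ t : ℕ, Real.logb 10 (c * 10 ^ t : ℕ) = Real.logb 10 c + t := by
    intro c hc t
    push_cast
    rw [Real.logb_mul (by positivity) (by positivity), Real.logb_pow, Real.logb_self_eq_one (by norm_num)]
    simp
  have hle : ∀ x y : ℕ, 0 < x → 0 < y → (x ≤ y ↔ Real.logb 10 x ≤ Real.logb 10 y) := by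
    intro x y hx hy
    rw [Real.logb_le_logb (by norm_num) (by positivity) (by positivity)]
    exact Nat.cast_le.symm
  have hd10 : Real.logb 10 (d + 1) ≤ 1 := by
    rw [Real.logb_le_iff_le_rpow (by norm_num) (by positivity), Real.rpow_one]
    have : d + 1 ≤ 10 := by omega
    exact_mod_cast this
  constructor
  · rintro ⟨x, hx, hxn⟩
    rw [pos] at hxn
    obtain ⟨m, hm⟩ := (AddCircle.coe_eq_zero_iff 1 (x := Real.logb 10 n - x)).1 (by
      rw [AddCircle.coe_sub]; exact sub_eq_zero.2 hxn.symm)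
    have hm' : Real.logb 10 n = x + m := by simp at hm; linarith
    have hn1 : 0 ≤ Real.logb 10 n := Real.logb_nonneg (by norm_num) (by
      have : 1 ≤ n := by omega
      exact_mod_cast this)
    have hm0 : 0 ≤ m := by
      have : (-1 : ℝ) < m := by linarith [hx.2]
      have : -1 < m := by exact_mod_cast this
      omega
    obtain ⟨t, rfl⟩ := Int.eq_ofNat_of_zero_le hm0
    refine ⟨t, ?_, ?_⟩
    · rw [hle _ _ (by positivity) (by omega), hkey d (by omega), hm']
      have := hx.1
      push_cast
      linarith
    · rw [← not_le, hle _ _ (by positivity) (Nat.pos_of_ne_zero hn), hkey (d + 1) (by omega), hm']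
      have := hx.2
      push_cast
      linarith
  · rintro ⟨t, h1, h2⟩
    rw [hle _ _ (by positivity) (Nat.pos_of_ne_zero hn), hkey d (by omega)] at h1
    rw [← not_le, hle _ _ (by positivity) (Nat.pos_of_ne_zero hn), hkey (d + 1) (by omega)] at h2
    push_cast at h2
    refine ⟨Real.logb 10 n - t, ⟨by linarith, by linarith⟩, ?_⟩
    simp only [pos]
    rw [AddCircle.coe_sub, sub_eq_self, AddCircle.coe_eq_zero_iff]
    exact ⟨t, by simp⟩

lemma tsum_sub (F : Finset ℕ) (R : ℕ → Prop) (h : ∀ p, p ∈ F ↔ R p) (f : ℕ → ℝ) :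
    ∑' p : {p : ℕ // R p}, f p.1 = ∑ p ∈ F, f p := by
  obtain rfl : (fun p => p ∈ F) = R := funext fun p => propext (h p)
  exact Finset.tsum_subtype F f

lemma mem_Pr_floor (x : ℝ) (hx : 0 ≤ x) (p : ℕ) : p ∈ Pr ⌊x⌋₊ ↔ p.Prime ∧ (p : ℝ) ≤ x := by
  rw [Pr, Finset.mem_filter, Finset.mem_range, Nat.lt_succ_iff, Nat.le_floor_iff hx, and_comm]

end WB

/-- Whitney's theorem: the primes satisfy Benford's law logarithmically; the
logarithmic density of primes with leading base-10 digit `d` is `log₁₀(1 + 1/d)`. -/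
theorem whitney_benford_primes (d : ℕ) (hd₁ : 1 ≤ d) (hd₉ : d ≤ 9) :
    Tendsto (fun x : ℝ =>
        (∑' p : {p : ℕ // p.Prime ∧ (∃ t : ℕ, d * 10 ^ t ≤ p ∧ p < (d + 1) * 10 ^ t) ∧
            (p : ℝ) ≤ x}, (1 : ℝ) / (p.1 : ℝ)) /
        (∑' p : {p : ℕ // p.Prime ∧ (p : ℝ) ≤ x}, (1 : ℝ) / (p.1 : ℝ)))
      atTop (nhds (Real.logb 10 (1 + 1 / (d : ℝ)))) := by
  classical
  have hd0 : (0:ℝ) < d := by positivity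
  have hlog : Real.logb 10 (1 + 1 / (d : ℝ)) = Real.logb 10 (d + 1) - Real.logb 10 d := by
    rw [← Real.logb_div (by positivity) (by positivity)]
    congr 1
    field_simp
  have h := WB.tendsto_arc (Real.logb 10 d) (Real.logb 10 (d + 1))
    (Real.logb_nonneg (by norm_num) (by exact_mod_cast hd₁))
    (Real.logb_le_logb_of_le (by norm_num) hd0 (by linarith)) (by
      rw [Real.logb_le_iff_le_rpow (by norm_num) (by positivity), Real.rpow_one]
      have : d + 1 ≤ 10 := by omega
      exact_mod_cast this)
  rw [← hlog] at h
  have h2 : Tendsto (fun N => (∑ p ∈ WB.Pr N, if ∃ t : ℕ, d * 10 ^ t ≤ p ∧ p < (d + 1) * 10 ^ t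
      then 1 / (p : ℝ) else 0) / WB.S N) atTop (nhds (Real.logb 10 (1 + 1 / (d : ℝ)))) := by
    rw [← tendsto_add_atTop_iff_nat 2]
    refine h.congr fun N => ?_
    rw [Finset.sum_div]
    refine Finset.sum_congr rfl fun p hp => ?_
    have := WB.digit_iff d hd₁ hd₉ p (Finset.mem_filter.1 hp).2.ne_zero
    by_cases hq : ∃ t : ℕ, d * 10 ^ t ≤ p ∧ p < (d + 1) * 10 ^ t
    · rw [if_pos hq, Set.indicator_of_mem (this.2 hq)]
    · rw [if_neg hq, Set.indicator_of_notMem (fun h => hq (this.1 h)), zero_div]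
  refine (h2.comp tendsto_nat_floor_atTop).congr' ?_
  filter_upwards [eventually_ge_atTop 0] with x hx
  rw [Function.comp, ← Finset.sum_filter]
  congr 1
  · refine (WB.tsum_sub _ _ (fun p => ?_) (fun p => 1 / (p : ℝ))).symm
    rw [Finset.mem_filter, WB.mem_Pr_floor x hx]
    tauto
  · exact (WB.tsum_sub _ _ (fun p => WB.mem_Pr_floor x hx p) (fun p => 1 / (p : ℝ))).symm
end

section
/- Let p_m denote the m-th prime (so p_1 = 2, p_2 = 3, …). Let r be an integer and t ≥ 1 an integer, let b ≥ 2 be an integer, and let S be a positive integer with b^{m−1} ≤ S < b^m for some m ≥ 1. Let A be the set of primes p_j with j ≡ r (mod t) whose base-b expansion begins with the string S. Then lim_{x→∞} (1/log log x) · ∑_{p ∈ A, p ≤ x} 1/p = (1/t) · log_b(1 + 1/S). -/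
open Filter Real

open Topology

/-- log of zeta via the Euler product -/
noncomputable def hz (s : ℂ) : ℂ := ∑' p : Nat.Primes, -Complex.log (1 - (p.1 : ℂ) ^ (-s))

lemma norm_pcpow (p : Nat.Primes) (s : ℂ) : ‖(p.1 : ℂ) ^ (-s)‖ = (p.1 : ℝ) ^ (-s.re) := by
  rw [Complex.norm_natCast_cpow_of_pos p.2.pos]; simp

lemma pcpow_half (p : Nat.Primes) (s : ℂ) (hs : 1 < s.re) : ‖(p.1 : ℂ) ^ (-s)‖ ≤ 1 / 2 := by
  rw [norm_pcpow]
  have h2 : (2 : ℝ) ≤ p.1 := by exact_mod_cast p.2.two_le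
  calc (p.1 : ℝ) ^ (-s.re) ≤ (p.1 : ℝ) ^ (-1 : ℝ) :=
        Real.rpow_le_rpow_of_exponent_le (by linarith) (by linarith)
    _ = (p.1 : ℝ)⁻¹ := Real.rpow_neg_one _
    _ ≤ 1 / 2 := by rw [one_div]; exact inv_anti₀ (by norm_num) h2

lemma hz_differentiableAt (s : ℂ) (hs : 1 < s.re) : DifferentiableAt ℂ hz s := by
  obtain ⟨a, ha1, ha2⟩ := exists_between hs
  have hopen : IsOpen {w : ℂ | a < w.re} := isOpen_lt continuous_const Complex.continuous_re
  have hd : DifferentiableOn ℂ hz {w : ℂ | a < w.re} := by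
    unfold hz
    refine Complex.differentiableOn_tsum_of_summable_norm
      (u := fun p : Nat.Primes => 3 / 2 * (p.1 : ℝ) ^ (-a)) ?_ ?_ hopen ?_
    · exact (Nat.Primes.summable_rpow.2 (by linarith)).mul_left _
    · intro p w hw
      apply DifferentiableAt.differentiableWithinAt
      have hw' : 1 < w.re := lt_trans ha1 hw
      have hp0 : (p.1 : ℂ) ≠ 0 := by exact_mod_cast p.2.ne_zero
      have h1 : DifferentiableAt ℂ (fun w : ℂ => 1 - (p.1 : ℂ) ^ (-w)) w := by
        apply DifferentiableAt.const_sub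
        exact (differentiableAt_id.neg).const_cpow (Or.inl hp0)
      refine (h1.clog ?_).neg
      left
      have h3 := pcpow_half p w hw'
      have h4 := Complex.re_le_norm ((p.1 : ℂ) ^ (-w))
      simp only [Complex.sub_re, Complex.one_re]
      linarith
    · intro p w hw
      have hw' : 1 < w.re := lt_trans ha1 hw
      rw [norm_neg, sub_eq_add_neg]
      refine (Complex.norm_log_one_add_half_le_self (by rw [norm_neg]; exact pcpow_half p w hw')).trans ?_
      rw [norm_neg, norm_pcpow]
      have h2 : (1 : ℝ) ≤ p.1 := by exact_mod_cast p.2.one_le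
      have h3 : a ≤ w.re := le_of_lt hw
      gcongr
  exact hd.differentiableAt (hopen.mem_nhds ha2)

lemma hz_exp (s : ℂ) (hs : 1 < s.re) : Complex.exp (hz s) = riemannZeta s :=
  riemannZeta_eulerProduct_exp_log hs

lemma summable_pcpow (s : ℂ) (hs : 1 < s.re) : Summable (fun p : Nat.Primes => (p.1 : ℂ) ^ (-s)) := by
  apply Summable.of_norm
  simp_rw [norm_pcpow]
  exact Nat.Primes.summable_rpow.2 (by linarith)

lemma hz_close : ∃ C : ℝ, ∀ s : ℂ, 1 < s.re →
    ‖(∑' p : Nat.Primes, (p.1 : ℂ) ^ (-s)) - hz s‖ ≤ C := by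
  have hsum : Summable (fun p : Nat.Primes => (p.1 : ℝ) ^ (-2 : ℝ)) :=
    Nat.Primes.summable_rpow.2 (by norm_num)
  refine ⟨∑' p : Nat.Primes, (p.1 : ℝ) ^ (-2 : ℝ), fun s hs => ?_⟩
  have hs1 := summable_pcpow s hs
  have hs2 : Summable (fun p : Nat.Primes => -Complex.log (1 - (p.1 : ℂ) ^ (-s))) :=
    hs1.clog_one_sub.neg
  unfold hz
  rw [← hs1.tsum_sub hs2]
  refine tsum_of_norm_bounded hsum.hasSum fun p => ?_
  have hh := pcpow_half p s hs
  have h := Complex.norm_log_one_add_sub_self_le (z := -(p.1 : ℂ) ^ (-s)) (by rw [norm_neg]; linarith)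
  rw [norm_neg] at h
  have e : (p.1 : ℂ) ^ (-s) - -Complex.log (1 - (p.1 : ℂ) ^ (-s)) =
    Complex.log (1 + -(p.1 : ℂ) ^ (-s)) - -(p.1 : ℂ) ^ (-s) := by rw [← sub_eq_add_neg]; ring
  rw [e]
  refine h.trans ?_
  have h5 : (1 - ‖(p.1 : ℂ) ^ (-s)‖)⁻¹ ≤ 2 := by
    rw [inv_le_comm₀ (by linarith) (by norm_num)]; linarith
  have h6 : ‖(p.1 : ℂ) ^ (-s)‖ ≤ (p.1 : ℝ) ^ (-1 : ℝ) := by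
    rw [norm_pcpow]
    have h2 : (1 : ℝ) ≤ p.1 := by exact_mod_cast p.2.one_le
    exact Real.rpow_le_rpow_of_exponent_le h2 (by linarith)
  have h7 : (p.1 : ℝ) ^ (-2 : ℝ) = ((p.1 : ℝ) ^ (-1 : ℝ)) ^ 2 := by
    rw [← Real.rpow_natCast, ← Real.rpow_mul (by positivity)]; norm_num
  rw [h7]
  calc ‖(p.1 : ℂ) ^ (-s)‖ ^ 2 * (1 - ‖(p.1 : ℂ) ^ (-s)‖)⁻¹ / 2
      ≤ ‖(p.1 : ℂ) ^ (-s)‖ ^ 2 * 2 / 2 := by gcongr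
    _ = ‖(p.1 : ℂ) ^ (-s)‖ ^ 2 := by ring
    _ ≤ _ := by gcongr

lemma bounded_twist (τ : ℝ) (hτ : τ ≠ 0) : ∃ C : ℝ, ∀ᶠ δ : ℝ in 𝓝[>] 0,
    ‖∑' p : Nat.Primes, (p.1 : ℂ) ^ (-(1 + δ + τ * Complex.I))‖ ≤ C := by
  obtain ⟨C0, hC0⟩ := hz_close
  set s0 : ℂ := 1 + τ * Complex.I with hs0
  have hs01 : s0 ≠ 1 := by
    intro h
    have := congrArg Complex.im h
    simp [hs0] at this
    exact hτ this
  have hre : s0.re = 1 := by simp [hs0]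
  have hne : riemannZeta s0 ≠ 0 := riemannZeta_ne_zero_of_one_le_re hre.ge
  have hanal : AnalyticAt ℂ riemannZeta s0 := by
    have : DifferentiableOn ℂ riemannZeta {1}ᶜ := fun w hw =>
      (differentiableAt_riemannZeta hw).differentiableWithinAt
    exact this.analyticAt (isOpen_compl_singleton.mem_nhds hs01)
  have hcont : ContinuousAt (fun s => deriv riemannZeta s / riemannZeta s) s0 :=
    hanal.deriv.continuousAt.div hanal.continuousAt hne
  have hev : ∀ᶠ s in 𝓝 s0, ‖deriv riemannZeta s / riemannZeta s‖ <
      ‖deriv riemannZeta s0 / riemannZeta s0‖ + 1 :=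
    hcont.norm.eventually_lt continuousAt_const (by simp)
  obtain ⟨ε, hε, hball⟩ := Metric.eventually_nhds_iff_ball.1 hev
  set D := ‖deriv riemannZeta s0 / riemannZeta s0‖ + 1
  set V : Set ℂ := Metric.ball s0 ε ∩ {w : ℂ | 1 < w.re} with hV
  have hVopen : IsOpen V := Metric.isOpen_ball.inter (isOpen_lt continuous_const Complex.continuous_re)
  have hVconv : Convex ℝ V := (convex_ball _ _).inter (convex_halfSpace_re_gt 1)
  have hmem : ∀ δ : ℝ, 0 < δ → δ < ε → (1 + δ + τ * Complex.I : ℂ) ∈ V := by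
    intro δ h1 h2
    constructor
    · rw [Metric.mem_ball, dist_eq_norm]
      have : (1 + δ + τ * Complex.I : ℂ) - s0 = δ := by rw [hs0]; ring
      rw [this, Complex.norm_real, Real.norm_of_nonneg h1.le]; exact h2
    · simp [h1]
  have hderiv : ∀ w ∈ V, ‖deriv hz w‖ ≤ D := by
    intro w hw
    have h1 : 1 < w.re := hw.2
    have hd := (hz_differentiableAt w h1).hasDerivAt
    have h2 := hd.cexp
    have h3 : deriv riemannZeta w = Complex.exp (hz w) * deriv hz w := by
      rw [← h2.deriv]
      apply Filter.EventuallyEq.deriv_eq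
      filter_upwards [hVopen.mem_nhds hw] with v hv
      exact (hz_exp v hv.2).symm
    have h4 : deriv hz w = deriv riemannZeta w / riemannZeta w := by
      rw [h3, hz_exp w h1]
      rw [mul_div_cancel_left₀]
      rw [← hz_exp w h1]; exact Complex.exp_ne_zero _
    rw [h4]
    exact (hball w hw.1).le
  set v0 : ℂ := 1 + (ε / 2 : ℝ) + τ * Complex.I with hv0
  have hv0m : v0 ∈ V := hmem (ε / 2) (by linarith) (by linarith)
  refine ⟨C0 + (‖hz v0‖ + D * (ε + ε)), ?_⟩
  filter_upwards [Ioo_mem_nhdsGT hε] with δ hδ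
  have hm := hmem δ hδ.1 hδ.2
  have h1 := hVconv.norm_image_sub_le_of_norm_deriv_le
    (fun x hx => hz_differentiableAt x hx.2) hderiv hv0m hm
  have h2 := hC0 _ hm.2
  have h3 : ‖(1 + δ + τ * Complex.I : ℂ) - v0‖ ≤ ε + ε := by
    rw [← dist_eq_norm]
    have a := hm.1; have b := hv0m.1
    rw [Metric.mem_ball] at a b
    exact (dist_triangle_right _ _ s0).trans (by linarith)
  have hD : 0 ≤ D := by positivity
  have h4 : D * ‖(1 + δ + τ * Complex.I : ℂ) - v0‖ ≤ D * (ε + ε) := by gcongr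
  have h5 := norm_le_norm_add_norm_sub (hz v0) (hz (1 + δ + τ * Complex.I))
  have h6 := norm_le_norm_add_norm_sub (hz (1 + δ + τ * Complex.I)) (∑' p : Nat.Primes, (p.1 : ℂ) ^ (-(1 + δ + τ * Complex.I)))
  rw [norm_sub_rev] at h5 h6
  rw [norm_sub_rev] at h1
  rw [norm_sub_rev] at h5; linarith

/-- total mass -/
noncomputable def Zp (δ : ℝ) : ℝ := ∑' p : Nat.Primes, (p.1 : ℝ) ^ (-(1 + δ))

lemma Zp_bound : ∃ C : ℝ, ∀ᶠ δ : ℝ in 𝓝[>] 0, |Zp δ - Real.log (1 / δ)| ≤ C := by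
  obtain ⟨C0, hC0⟩ := hz_close
  refine ⟨C0 + 1, ?_⟩
  have hres : Tendsto (fun δ : ℝ => ((1 + δ : ℂ) - 1) * riemannZeta (1 + δ)) (𝓝[>] 0) (𝓝 1) := by
    refine riemannZeta_residue_one.comp ?_
    rw [tendsto_nhdsWithin_iff]
    constructor
    · have : Tendsto (fun δ : ℝ => (1 + δ : ℂ)) (𝓝 0) (𝓝 (1 + (0 : ℝ))) := by
        apply Continuous.tendsto; fun_prop
      simp only [Complex.ofReal_zero, add_zero] at this
      exact this.mono_left nhdsWithin_le_nhds
    · filter_upwards [self_mem_nhdsWithin] with δ hδ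
      simp only [Set.mem_compl_iff, Set.mem_singleton_iff]
      intro h
      have : (δ : ℂ) = 0 := by linear_combination h
      exact (ne_of_gt hδ) (by exact_mod_cast this)
  have hlog : Tendsto (fun δ : ℝ => Real.log ‖((1 + δ : ℂ) - 1) * riemannZeta (1 + δ)‖) (𝓝[>] 0) (𝓝 0) := by
    have := (Real.continuousAt_log (x := ‖(1 : ℂ)‖) (by simp)).tendsto.comp hres.norm
    simpa [Function.comp_def] using this
  have h1 : ∀ᶠ δ : ℝ in 𝓝[>] 0, |Real.log ‖((1 + δ : ℂ) - 1) * riemannZeta (1 + δ)‖| < 1 := by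
    have := hlog.abs
    rw [abs_zero] at this
    exact this.eventually_lt_const (by norm_num)
  filter_upwards [h1, self_mem_nhdsWithin] with δ h hδ
  have hδ0 : 0 < δ := hδ
  have hre : 1 < (1 + δ : ℂ).re := by simp [hδ0]
  have hne : riemannZeta (1 + δ) ≠ 0 := riemannZeta_ne_zero_of_one_le_re hre.le
  have h2 : Real.log ‖((1 + δ : ℂ) - 1) * riemannZeta (1 + δ)‖ = Real.log δ + (hz (1 + δ)).re := by
    rw [← hz_exp _ hre, norm_mul, Complex.norm_exp, add_sub_cancel_left, Complex.norm_real,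
      Real.norm_of_nonneg hδ0.le, Real.log_mul hδ0.ne' (Real.exp_pos _).ne', Real.log_exp]
  rw [h2] at h
  have h3 := hC0 _ hre
  have h4 : (∑' p : Nat.Primes, (p.1 : ℂ) ^ (-(1 + δ : ℂ))) = (Zp δ : ℂ) := by
    unfold Zp
    push_cast
    refine tsum_congr fun p => ?_
    rw [Complex.ofReal_cpow (by positivity)]
    push_cast; rfl
  rw [h4] at h3
  have h5 := (Complex.abs_re_le_norm _).trans h3
  simp only [Complex.sub_re, Complex.ofReal_re] at h5
  rw [one_div, Real.log_inv]
  rw [abs_le] at *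
  rw [abs_lt] at h
  constructor <;> linarith [h.1, h.2, h5.1, h5.2]

lemma log_one_div_tendsto : Tendsto (fun δ : ℝ => Real.log (1 / δ)) (𝓝[>] 0) atTop := by
  simp_rw [one_div]
  exact Real.tendsto_log_atTop.comp tendsto_inv_nhdsGT_zero

lemma bdd_div_tendsto {l : Filter ℝ} {f g : ℝ → ℝ} {C : ℝ} (hf : ∀ᶠ x in l, |f x| ≤ C)
    (hg : Tendsto g l atTop) : Tendsto (fun x => f x / g x) l (𝓝 0) := by
  have h := hg.const_div_atTop C
  refine squeeze_zero_norm' ?_ h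
  filter_upwards [hf, hg.eventually_gt_atTop 0] with x hx hgx
  rw [norm_div, Real.norm_eq_abs, Real.norm_of_nonneg hgx.le]
  gcongr

lemma Zp_tendsto : Tendsto (fun δ : ℝ => Zp δ / Real.log (1 / δ)) (𝓝[>] 0) (𝓝 1) := by
  obtain ⟨C, hC⟩ := Zp_bound
  have h := (bdd_div_tendsto hC log_one_div_tendsto).add_const 1
  rw [zero_add] at h
  refine h.congr' ?_
  filter_upwards [log_one_div_tendsto.eventually_gt_atTop 0] with δ hδ
  field_simp
  ring

section circle
set_option linter.unusedSectionVars false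
open MeasureTheory

variable {T : ℝ} [hT : Fact (0 < T)]

/-- normalized weights -/
noncomputable def wp (δ : ℝ) (p : Nat.Primes) : ℝ := (p.1 : ℝ) ^ (-(1 + δ)) / Zp δ

lemma summable_prpow {δ : ℝ} (hδ : 0 < δ) : Summable (fun p : Nat.Primes => (p.1 : ℝ) ^ (-(1 + δ))) :=
  Nat.Primes.summable_rpow.2 (by linarith)

lemma Zp_pos {δ : ℝ} (hδ : 0 < δ) : 0 < Zp δ := by
  unfold Zp
  refine (summable_prpow hδ).tsum_pos (fun p => by positivity) ⟨2, Nat.prime_two⟩ ?_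
  positivity

lemma wp_nonneg {δ : ℝ} (hδ : 0 < δ) (p : Nat.Primes) : 0 ≤ wp δ p :=
  div_nonneg (by positivity) (Zp_pos hδ).le

lemma wp_hasSum {δ : ℝ} (hδ : 0 < δ) : HasSum (wp δ) 1 := by
  have := (summable_prpow hδ).hasSum.div_const (Zp δ)
  rwa [show (∑' p : Nat.Primes, (p.1 : ℝ) ^ (-(1 + δ))) = Zp δ from rfl, div_self (Zp_pos hδ).ne'] at this

variable (T) in
noncomputable def muC (δ : ℝ) : Measure (AddCircle T) :=
  Measure.sum fun p : Nat.Primes => ENNReal.ofReal (wp δ p) • Measure.dirac ((Real.log p.1 : ℝ) : AddCircle T)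

lemma muC_prob {δ : ℝ} (hδ : 0 < δ) : IsProbabilityMeasure (muC T δ) := by
  constructor
  unfold muC
  rw [Measure.sum_apply _ MeasurableSet.univ]
  simp only [Measure.smul_apply, measure_univ, smul_eq_mul, mul_one]
  rw [← ENNReal.ofReal_tsum_of_nonneg (wp_nonneg hδ) (wp_hasSum hδ).summable, (wp_hasSum hδ).tsum_eq]
  simp

lemma muC_integral {E : Type*} [NormedAddCommGroup E] [NormedSpace ℝ E] [CompleteSpace E]
    {δ : ℝ} (hδ : 0 < δ) (f : AddCircle T → E)
    (hf : Integrable f (muC T δ)) :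
    ∫ x, f x ∂(muC T δ) = ∑' p : Nat.Primes, wp δ p • f ((Real.log p.1 : ℝ) : AddCircle T) := by
  unfold muC at *
  rw [integral_sum_measure hf]
  refine tsum_congr fun p => ?_
  rw [integral_smul_measure, integral_dirac, ENNReal.toReal_ofReal (wp_nonneg hδ p)]

open Classical in
variable (T) in
noncomputable def PC (δ : ℝ) : ProbabilityMeasure (AddCircle T) :=
  if h : 0 < δ then ⟨muC T δ, muC_prob h⟩ else ⟨Measure.dirac 0, inferInstance⟩

lemma PC_coe {δ : ℝ} (hδ : 0 < δ) : (PC T δ : Measure (AddCircle T)) = muC T δ := by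
  simp [PC, hδ]

variable (T) in
noncomputable def haarP : ProbabilityMeasure (AddCircle T) := ⟨AddCircle.haarAddCircle, inferInstance⟩

lemma cont_int (P : ProbabilityMeasure (AddCircle T)) (f : C(AddCircle T, ℂ)) :
    Integrable (fun x => f x) (P : Measure (AddCircle T)) :=
  (BoundedContinuousFunction.mkOfCompact f).integrable _

lemma fourier_case (n : ℤ) :
    Tendsto (fun δ => ∫ x, fourier n x ∂(PC T δ : Measure (AddCircle T))) (𝓝[>] 0)
      (𝓝 (∫ x, fourier n x ∂(haarP T : Measure (AddCircle T)))) := by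
  have hT0 : 0 < T := hT.out
  by_cases hn : n = 0
  · subst hn
    simp
  have h0 : ∫ x, fourier n x ∂(haarP T : Measure (AddCircle T)) = 0 :=
    integral_eq_zero_of_add_right_eq_neg (μ := AddCircle.haarAddCircle)
      (fourier_add_half_inv_index hn hT.elim)
  rw [h0]
  set τ : ℝ := -(2 * π * n / T) with hτ
  have hτ0 : τ ≠ 0 := by
    rw [hτ, neg_ne_zero]
    have : (n : ℝ) ≠ 0 := by exact_mod_cast hn
    have := Real.pi_pos
    positivity
  obtain ⟨C, hC⟩ := bounded_twist τ hτ0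
  have hZ : Tendsto Zp (𝓝[>] 0) atTop := by
    have h := (Zp_tendsto.pos_mul_atTop one_pos log_one_div_tendsto)
    refine h.congr' ?_
    filter_upwards [log_one_div_tendsto.eventually_gt_atTop 0] with δ hδ
    field_simp
  refine squeeze_zero_norm' ?_ (hZ.const_div_atTop C)
  filter_upwards [hC, self_mem_nhdsWithin] with δ h hδ
  have hδ0 : 0 < δ := hδ
  have hi := cont_int (PC T δ) (fourier n)
  rw [PC_coe hδ0] at hi ⊢
  rw [muC_integral hδ0 _ hi]
  have e : ∀ p : Nat.Primes, wp δ p • fourier n ((Real.log p.1 : ℝ) : AddCircle T) =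
      (p.1 : ℂ) ^ (-(1 + δ + τ * Complex.I)) / (Zp δ : ℂ) := by
    intro p
    rw [fourier_coe_apply, wp]
    have hp : (0 : ℝ) < p.1 := by exact_mod_cast p.2.pos
    have hp0 : (p.1 : ℂ) ≠ 0 := by exact_mod_cast p.2.ne_zero
    rw [Complex.real_smul, Complex.ofReal_div, Complex.ofReal_cpow hp.le, div_mul_eq_mul_div]
    congr 1
    rw [Complex.ofReal_natCast, neg_add (1 + (δ : ℂ)), Complex.cpow_add _ _ hp0]
    have h1 : Complex.exp (2 * π * Complex.I * n * (Real.log p.1 : ℝ) / T) = (p.1 : ℂ) ^ (-(τ * Complex.I)) := by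
      rw [Complex.cpow_def_of_ne_zero hp0]
      congr 1
      rw [hτ, ← Complex.natCast_log]
      push_cast
      ring
    rw [h1]
    push_cast
    rfl
  simp_rw [e]
  rw [tsum_div_const, norm_div, Complex.norm_real, Real.norm_of_nonneg (Zp_pos hδ0).le]
  have := Zp_pos hδ0
  gcongr

lemma cont_case (f : C(AddCircle T, ℂ)) :
    Tendsto (fun δ => ∫ x, f x ∂(PC T δ : Measure (AddCircle T))) (𝓝[>] 0)
      (𝓝 (∫ x, f x ∂(haarP T : Measure (AddCircle T)))) := by
  have hspan : ∀ g ∈ Submodule.span ℂ (Set.range (fourier (T := T))),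
      Tendsto (fun δ => ∫ x, g x ∂(PC T δ : Measure (AddCircle T))) (𝓝[>] 0)
      (𝓝 (∫ x, g x ∂(haarP T : Measure (AddCircle T)))) := by
    intro g hg
    induction hg using Submodule.span_induction with
    | mem g hg => obtain ⟨n, rfl⟩ := hg; exact fourier_case n
    | zero => simp
    | add g1 g2 _ _ h1 h2 =>
      simp only [ContinuousMap.add_apply]
      rw [integral_add (cont_int _ g1) (cont_int _ g2)]
      refine (h1.add h2).congr fun δ => ?_
      rw [integral_add (cont_int _ g1) (cont_int _ g2)]
    | smul c g _ h =>
      simp only [ContinuousMap.smul_apply, integral_smul]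
      exact h.const_smul c
  have hf : f ∈ (Submodule.span ℂ (Set.range (fourier (T := T)))).topologicalClosure := by
    rw [span_fourier_closure_eq_top]; trivial
  have hf' : f ∈ closure (Submodule.span ℂ (Set.range (fourier (T := T))) : Set C(AddCircle T, ℂ)) := hf
  rw [Metric.tendsto_nhds]
  intro ε hε
  obtain ⟨g, hg, hfg⟩ := Metric.mem_closure_iff.1 hf' (ε / 3) (by linarith)
  have hd : ∀ P : ProbabilityMeasure (AddCircle T),
      dist (∫ x, f x ∂(P : Measure (AddCircle T))) (∫ x, g x ∂(P : Measure (AddCircle T))) ≤ ε / 3 := by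
    intro P
    rw [dist_eq_norm, ← integral_sub (cont_int P f) (cont_int P g)]
    have := norm_integral_le_of_norm_le_const (μ := (P : Measure (AddCircle T)))
      (f := fun x => f x - g x) (C := ε / 3) (Eventually.of_forall fun x => by
        rw [← dist_eq_norm]; exact (ContinuousMap.dist_apply_le_dist x).trans hfg.le)
    simpa using this
  filter_upwards [Metric.tendsto_nhds.1 (hspan g hg) (ε / 3) (by linarith)] with δ hδ
  have h1 := hd (PC T δ)
  have h2 := hd (haarP T)
  rw [dist_comm] at h2
  have h3 := dist_triangle4 (∫ x, f x ∂(PC T δ : Measure (AddCircle T))) (∫ x, g x ∂(PC T δ : Measure (AddCircle T)))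
    (∫ x, g x ∂(haarP T : Measure (AddCircle T))) (∫ x, f x ∂(haarP T : Measure (AddCircle T)))
  linarith

lemma PC_tendsto : Tendsto (PC T) (𝓝[>] 0) (𝓝 (haarP T)) := by
  rw [ProbabilityMeasure.tendsto_iff_forall_integral_rclike_tendsto ℂ]
  intro f
  exact cont_case f.toContinuousMap

lemma vol_singleton (a : ℝ) : volume ({(a : AddCircle T)} : Set (AddCircle T)) = 0 := by
  rw [AddCircle.add_projection_respects_measure T (a - T) (measurableSet_singleton _)]
  have hT0 : 0 < T := hT.out
  refine measure_mono_null (t := {a}) ?_ (by simp)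
  rintro x ⟨hx1, hx2⟩
  have hx3 : (x : AddCircle T) = (a : AddCircle T) := hx1
  exact (AddCircle.coe_eq_coe_iff_of_mem_Ioc hx2 ⟨by linarith, by linarith⟩).1 hx3

variable (T) in
/-- arc -/
def arc (α β : ℝ) : Set (AddCircle T) := (fun x : ℝ => (x : AddCircle T)) '' Set.Ico α β

lemma arc_frontier (α β : ℝ) :
    frontier (arc T α β) ⊆ {(α : AddCircle T), (β : AddCircle T)} := by
  have hcl : closure (arc T α β) ⊆ (fun x : ℝ => (x : AddCircle T)) '' Set.Icc α β := by
    refine closure_minimal (Set.image_mono Set.Ico_subset_Icc_self) ?_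
    exact (isCompact_Icc.image (AddCircle.continuous_mk' T)).isClosed
  have hin : (fun x : ℝ => (x : AddCircle T)) '' Set.Ioo α β ⊆ interior (arc T α β) := by
    refine interior_maximal (Set.image_mono Set.Ioo_subset_Ico_self) ?_
    exact QuotientAddGroup.isOpenMap_coe _ isOpen_Ioo
  rintro x ⟨hx1, hx2⟩
  obtain ⟨y, hy, rfl⟩ := hcl hx1
  rcases eq_or_lt_of_le hy.1 with h1 | h1
  · left; simp [h1]
  rcases eq_or_lt_of_le hy.2 with h2 | h2
  · right; simp [h2]
  exact absurd (hin ⟨y, ⟨h1, h2⟩, rfl⟩) hx2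

lemma arc_meas (α β : ℝ) (h : α < β) : MeasurableSet (arc T α β) := by
  have : arc T α β = (fun x : ℝ => (x : AddCircle T)) '' Set.Ioo α β ∪ {(α : AddCircle T)} := by
    rw [arc, ← Set.Ioo_union_left h, Set.image_union, Set.image_singleton]
  rw [this]
  exact (QuotientAddGroup.isOpenMap_coe _ isOpen_Ioo).measurableSet.union (measurableSet_singleton _)

lemma arc_vol (α β : ℝ) (h : α < β) (h2 : β ≤ α + T) :
    volume (arc T α β) = ENNReal.ofReal (β - α) := by
  have hT0 : 0 < T := hT.out
  rw [AddCircle.add_projection_respects_measure T α (arc_meas α β h)]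
  apply le_antisymm
  · calc _ ≤ volume (Set.Icc α β ∪ {α + T}) := by
          apply measure_mono
          rintro x ⟨hx1, hx2⟩
          obtain ⟨y, hy, hxy⟩ := hx1
          have hxy' : (y : AddCircle T) = (x : AddCircle T) := hxy
          rcases eq_or_lt_of_le hy.1 with h1 | h1
          · right
            have h3 : ((α + T : ℝ) : AddCircle T) = (x : AddCircle T) := by
              rw [← hxy', ← h1]; simp
            exact ((AddCircle.coe_eq_coe_iff_of_mem_Ioc ⟨by linarith, by linarith⟩ hx2).1 h3).symm
          · left
            have := (AddCircle.coe_eq_coe_iff_of_mem_Ioc ⟨h1, by linarith [hy.2]⟩ hx2).1 hxy'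
            rw [← this]; exact ⟨h1.le, hy.2.le⟩
      _ ≤ volume (Set.Icc α β) + volume {α + T} := measure_union_le _ _
      _ = _ := by simp
  · calc _ = volume (Set.Ioo α β) := by simp
      _ ≤ _ := by
        apply measure_mono
        intro x hx
        exact ⟨⟨x, ⟨hx.1.le, hx.2⟩, rfl⟩, hx.1, by linarith [hx.2]⟩

open Classical in
lemma arc_tendsto (α β : ℝ) (h : α < β) (h2 : β ≤ α + T) :
    Tendsto (fun δ => (∑' p : Nat.Primes, if ((Real.log p.1 : ℝ) : AddCircle T) ∈ arc T α β
      then (p.1 : ℝ) ^ (-(1 + δ)) else 0) / Zp δ) (𝓝[>] 0) (𝓝 ((β - α) / T)) := by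
  have hT0 : 0 < T := hT.out
  have hvol : ∀ A : Set (AddCircle T), volume A = ENNReal.ofReal T * AddCircle.haarAddCircle A := by
    intro A
    rw [AddCircle.volume_eq_smul_haarAddCircle]; rfl
  have hfr : (haarP T : Measure (AddCircle T)) (frontier (arc T α β)) = 0 := by
    have h3 : volume (frontier (arc T α β)) = 0 := by
      refine measure_mono_null (arc_frontier α β) ?_
      rw [Set.insert_eq]
      exact measure_union_null (vol_singleton α) (vol_singleton β)
    rw [hvol] at h3
    rcases mul_eq_zero.1 h3 with h4 | h4
    · simp at h4; linarith
    · exact h4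
  have key := ProbabilityMeasure.tendsto_measure_of_null_frontier_of_tendsto' (PC_tendsto (T := T)) hfr
  have key2 := (ENNReal.tendsto_toReal (measure_ne_top _ _)).comp key
  have hlim : ((haarP T : Measure (AddCircle T)) (arc T α β)).toReal = (β - α) / T := by
    have h5 := arc_vol α β h h2
    rw [hvol] at h5
    have h6 := congrArg ENNReal.toReal h5
    rw [ENNReal.toReal_mul, ENNReal.toReal_ofReal hT0.le, ENNReal.toReal_ofReal (by linarith)] at h6
    rw [eq_div_iff hT0.ne', mul_comm]; exact h6
  rw [hlim] at key2
  refine key2.congr' ?_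
  filter_upwards [self_mem_nhdsWithin] with δ hδ
  have hδ0 : 0 < δ := hδ
  simp only [Function.comp]
  rw [PC_coe hδ0]
  have := muC_prob (T := T) hδ0
  have h7 : (muC T δ).real (arc T α β) = ∫ x, (arc T α β).indicator 1 x ∂(muC T δ) :=
    (integral_indicator_one (arc_meas α β h)).symm
  rw [← measureReal_def, h7, muC_integral hδ0, ← tsum_div_const]
  · refine tsum_congr fun p => ?_
    rw [Set.indicator_apply, wp]
    split_ifs <;> simp
  · exact (integrable_const (1 : ℝ)).indicator (arc_meas α β h)

end circle

lemma tauber (g : ℕ → ℝ) (hg : ∀ n, 0 ≤ g n) (hg0 : g 0 = 0)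
    (hs : ∀ δ : ℝ, 0 < δ → Summable fun n : ℕ => g n * (n : ℝ) ^ (-δ)) (c : ℝ)
    (hF : Tendsto (fun δ : ℝ => (∑' n : ℕ, g n * (n : ℝ) ^ (-δ)) / Real.log (1 / δ)) (𝓝[>] 0) (𝓝 c)) :
    Tendsto (fun x : ℝ => (∑ n ∈ Finset.range (⌊x⌋₊ + 1), g n) / Real.log (Real.log x)) atTop (𝓝 c) := by
  set F : ℝ → ℝ := fun δ => ∑' n : ℕ, g n * (n : ℝ) ^ (-δ) with hFdef
  set U : ℝ → ℝ := fun x => ∑ n ∈ Finset.range (⌊x⌋₊ + 1), g n with hU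
  have hll : Tendsto (fun x : ℝ => Real.log (Real.log x)) atTop atTop :=
    Real.tendsto_log_atTop.comp Real.tendsto_log_atTop
  have hΦ : ∀ K : ℝ, 0 < K → Tendsto (fun x : ℝ => F (K / Real.log x) / Real.log (Real.log x)) atTop (𝓝 c) := by
    intro K hK
    have h1 : Tendsto (fun x : ℝ => K / Real.log x) atTop (𝓝[>] 0) := by
      rw [tendsto_nhdsWithin_iff]
      refine ⟨Real.tendsto_log_atTop.const_div_atTop K, ?_⟩
      filter_upwards [Real.tendsto_log_atTop.eventually_gt_atTop 0] with x hx
      exact div_pos hK hx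
    have h2 := hF.comp h1
    have h3 : Tendsto (fun x : ℝ => 1 - Real.log K / Real.log (Real.log x)) atTop (𝓝 1) := by
      simpa using (hll.const_div_atTop (Real.log K)).const_sub 1
    have h4 := h2.mul h3
    rw [mul_one] at h4
    refine h4.congr' ?_
    filter_upwards [hll.eventually_gt_atTop 0, hll.eventually_gt_atTop (Real.log K),
      Real.tendsto_log_atTop.eventually_gt_atTop 0] with x hx1 hx2 hx3
    simp only [Function.comp]
    have h5 : Real.log (1 / (K / Real.log x)) = Real.log (Real.log x) - Real.log K := by
      rw [one_div_div, Real.log_div hx3.ne' hK.ne']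
    rw [h5]
    have h6 : Real.log (Real.log x) - Real.log K ≠ 0 := by linarith
    change F (K / Real.log x) / _ * _ = _
    field_simp
  have hup : ∀ ε : ℝ, 0 < ε → ∀ᶠ x in atTop, U x ≤ Real.exp ε * F (ε / Real.log x) := by
    intro ε hε
    filter_upwards [Real.tendsto_log_atTop.eventually_gt_atTop 0, eventually_gt_atTop 1] with x hx hx1
    have hδ : 0 < ε / Real.log x := div_pos hε hx
    have h1 : ∑ n ∈ Finset.range (⌊x⌋₊ + 1), Real.exp ε * (g n * (n : ℝ) ^ (-(ε / Real.log x))) ≤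
        Real.exp ε * F (ε / Real.log x) := by
      rw [← Finset.mul_sum]
      gcongr
      exact (hs _ hδ).sum_le_tsum _ (fun n _ => mul_nonneg (hg n) (by positivity))
    refine le_trans (Finset.sum_le_sum fun n hn => ?_) h1
    rcases Nat.eq_zero_or_pos n with h0 | h0
    · subst h0; simp [hg0]
    have hn' : (n : ℝ) ≤ x := by
      rw [Finset.mem_range, Nat.lt_succ_iff] at hn
      exact (Nat.cast_le.2 hn).trans (Nat.floor_le (by linarith))
    have hn0 : (0 : ℝ) < n := by exact_mod_cast h0
    have h2 : 1 ≤ Real.exp ε * (n : ℝ) ^ (-(ε / Real.log x)) := by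
      rw [Real.rpow_def_of_pos hn0, ← Real.exp_add]
      apply Real.one_le_exp
      have : Real.log n ≤ Real.log x := Real.log_le_log hn0 hn'
      have h3 : Real.log n * (ε / Real.log x) ≤ Real.log x * (ε / Real.log x) := by gcongr
      rw [mul_div_cancel₀ _ hx.ne'] at h3
      linarith
    have := mul_le_mul_of_nonneg_left h2 (hg n)
    linarith
  have hlo : ∀ K : ℝ, 1 < K → ∀ᶠ x in atTop,
      F (K / Real.log x) - Real.exp (1 - K) * F (1 / Real.log x) ≤ U x := by
    intro K hK
    filter_upwards [Real.tendsto_log_atTop.eventually_gt_atTop 0, eventually_gt_atTop 1] with x hx hx1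
    have hδ : 0 < K / Real.log x := div_pos (by linarith) hx
    have hδ1 : 0 < 1 / Real.log x := div_pos (by linarith) hx
    have hsum := (hs _ hδ).sub ((hs _ hδ1).mul_left (Real.exp (1 - K)))
    have h1 : F (K / Real.log x) - Real.exp (1 - K) * F (1 / Real.log x) =
        ∑' n : ℕ, (g n * (n : ℝ) ^ (-(K / Real.log x)) - Real.exp (1 - K) * (g n * (n : ℝ) ^ (-(1 / Real.log x)))) := by
      rw [(hs _ hδ).tsum_sub ((hs _ hδ1).mul_left _), tsum_mul_left]
    rw [h1]
    have hUt : U x = ∑' n : ℕ, if n ∈ Finset.range (⌊x⌋₊ + 1) then g n else 0 := by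
      rw [tsum_eq_sum (s := Finset.range (⌊x⌋₊ + 1))]
      · exact Finset.sum_congr rfl fun n hn => by rw [if_pos hn]
      · intro n hn; rw [if_neg hn]
    rw [hUt]
    refine hsum.tsum_le_tsum ?_ (summable_of_ne_finset_zero (s := Finset.range (⌊x⌋₊ + 1)) fun n hn => if_neg hn)
    intro n
    rcases Nat.eq_zero_or_pos n with h0 | h0
    · subst h0; simp [hg0]
    have hn0 : (0 : ℝ) < n := by exact_mod_cast h0
    have hn1 : (1 : ℝ) ≤ n := by exact_mod_cast h0
    split_ifs with hn
    · have h2 : (n : ℝ) ^ (-(K / Real.log x)) ≤ 1 :=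
        Real.rpow_le_one_of_one_le_of_nonpos hn1 (by linarith)
      have h3 := mul_le_mul_of_nonneg_left h2 (hg n)
      have h4 : 0 ≤ Real.exp (1 - K) * (g n * (n : ℝ) ^ (-(1 / Real.log x))) :=
        mul_nonneg (Real.exp_pos _).le (mul_nonneg (hg n) (by positivity))
      linarith
    · have hxn : x ≤ n := by
        rw [Finset.mem_range, not_lt] at hn
        exact ((Nat.lt_floor_add_one x).trans_le (by exact_mod_cast hn)).le
      have h2 : (n : ℝ) ^ (-(K / Real.log x)) ≤ Real.exp (1 - K) * (n : ℝ) ^ (-(1 / Real.log x)) := by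
        rw [Real.rpow_def_of_pos hn0, Real.rpow_def_of_pos hn0, ← Real.exp_add]
        apply Real.exp_le_exp.2
        have h3 : Real.log x ≤ Real.log n := Real.log_le_log (by linarith) hxn
        have h4 : 1 ≤ Real.log n / Real.log x := by rw [le_div_iff₀ hx]; linarith
        have e1 : Real.log n * -(K / Real.log x) = -(K * (Real.log n / Real.log x)) := by ring
        have e2 : Real.log n * -(1 / Real.log x) = -(Real.log n / Real.log x) := by ring
        rw [e1, e2]
        nlinarith
      have h3 := mul_le_mul_of_nonneg_left h2 (hg n)
      linarith
  rw [tendsto_order]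
  constructor
  · intro a ha
    -- choose K
    have hK : Tendsto (fun K : ℝ => c - Real.exp (1 - K) * c) atTop (𝓝 (c - 0 * c)) := by
      refine tendsto_const_nhds.sub (Tendsto.mul_const c ?_)
      exact Real.tendsto_exp_atBot.comp (tendsto_atBot_add_const_left _ 1 tendsto_neg_atTop_atBot)
    rw [zero_mul, sub_zero] at hK
    obtain ⟨K, hK1, hK2⟩ := ((hK.eventually_const_lt ha).and (eventually_gt_atTop 1)).exists
    have h1 := (hΦ K (by linarith)).sub ((hΦ 1 one_pos).const_mul (Real.exp (1 - K)))
    filter_upwards [h1.eventually_const_lt hK1, hlo K hK2, hll.eventually_gt_atTop 0] with x hx1 hx2 hx3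
    refine hx1.trans_le ?_
    have : F (K / Real.log x) / Real.log (Real.log x) - Real.exp (1 - K) * (F (1 / Real.log x) / Real.log (Real.log x))
      = (F (K / Real.log x) - Real.exp (1 - K) * F (1 / Real.log x)) / Real.log (Real.log x) := by ring
    rw [this]
    gcongr
  · intro a ha
    have hε : Tendsto (fun ε : ℝ => Real.exp ε * c) (𝓝[>] 0) (𝓝 (Real.exp 0 * c)) := by
      refine Tendsto.mono_left ?_ nhdsWithin_le_nhds
      apply Continuous.tendsto; fun_prop
    rw [Real.exp_zero, one_mul] at hε
    obtain ⟨ε, hε1, hε2⟩ := ((hε.eventually_lt_const ha).and self_mem_nhdsWithin).exists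
    have hε0 : 0 < ε := hε2
    have h1 := (hΦ ε hε0).const_mul (Real.exp ε)
    filter_upwards [h1.eventually_lt_const hε1, hup ε hε0, hll.eventually_gt_atTop 0] with x hx1 hx2 hx3
    refine lt_of_le_of_lt ?_ hx1
    rw [← mul_div_assoc]
    gcongr

/-- abel summation bound -/
lemma abel_bound (c w : ℕ → ℝ) (M : ℝ) (hc : ∀ k, |∑ i ∈ Finset.range k, c i| ≤ M)
    (hw : ∀ i, w (i + 1) ≤ w i) (hw0 : ∀ i, 0 ≤ w i) (n : ℕ) :
    |∑ i ∈ Finset.range n, c i * w i| ≤ M * w 0 := by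
  have hid : ∀ n, ∑ i ∈ Finset.range n, c i * w i = (∑ i ∈ Finset.range n, c i) * w n +
      ∑ i ∈ Finset.range n, (∑ j ∈ Finset.range (i + 1), c j) * (w i - w (i + 1)) := by
    intro n
    induction n with
    | zero => simp
    | succ n ih =>
      rw [Finset.sum_range_succ, ih, Finset.sum_range_succ (fun i => (∑ j ∈ Finset.range (i + 1), c j) * (w i - w (i + 1))),
        Finset.sum_range_succ c]
      ring
  rw [hid]
  refine (abs_add_le _ _).trans ?_
  have h1 : |(∑ i ∈ Finset.range n, c i) * w n| ≤ M * w n := by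
    rw [abs_mul, abs_of_nonneg (hw0 n)]
    exact mul_le_mul_of_nonneg_right (hc n) (hw0 n)
  have h2 : |∑ i ∈ Finset.range n, (∑ j ∈ Finset.range (i + 1), c j) * (w i - w (i + 1))| ≤
      ∑ i ∈ Finset.range n, M * (w i - w (i + 1)) := by
    refine (Finset.abs_sum_le_sum_abs _ _).trans (Finset.sum_le_sum fun i _ => ?_)
    rw [abs_mul, abs_of_nonneg (sub_nonneg.2 (hw i))]
    exact mul_le_mul_of_nonneg_right (hc _) (sub_nonneg.2 (hw i))
  rw [← Finset.mul_sum, Finset.sum_range_sub'] at h2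
  linarith

/-- index condition -/
def idx (r : ℤ) (t n : ℕ) : Prop :=
  ∃ j : ℕ, 1 ≤ j ∧ n = Nat.nth Nat.Prime (j - 1) ∧ (j : ℤ) ≡ r [ZMOD (t : ℤ)]

open Classical in
noncomputable def ee (r : ℤ) (t n : ℕ) : ℝ :=
  (if idx r t n then 1 else 0) - (1 / (t : ℝ)) * (if n.Prime then 1 else 0)

lemma idx_prime {r : ℤ} {t n : ℕ} (h : idx r t n) : n.Prime := by
  obtain ⟨j, _, rfl, _⟩ := h
  exact Nat.prime_nth_prime _

lemma idx_iff {r : ℤ} {t n : ℕ} (hn : n.Prime) :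
    idx r t n ↔ ((Nat.count Nat.Prime n : ℕ) + 1 : ℤ) ≡ r [ZMOD (t : ℤ)] := by
  constructor
  · rintro ⟨j, hj, rfl, h⟩
    rw [Nat.count_nth_of_infinite Nat.infinite_setOfPred_prime]
    have : ((j - 1 : ℕ) + 1 : ℤ) = j := by omega
    rw [this]; exact h
  · intro h
    refine ⟨Nat.count Nat.Prime n + 1, by omega, ?_, by push_cast; exact h⟩
    rw [Nat.add_sub_cancel, Nat.nth_count hn]

lemma ee_sum (r : ℤ) (t : ℕ) (ht : 1 ≤ t) (N : ℕ) : |∑ n ∈ Finset.range N, ee r t n| ≤ 1 := by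
  have ht0 : (0 : ℤ) < t := by exact_mod_cast ht
  set v : ℕ := ((r - 1) % t).toNat with hv
  have hvr : (v : ℤ) = (r - 1) % t := Int.toNat_of_nonneg (Int.emod_nonneg _ ht0.ne')
  have hiff : ∀ j : ℕ, (j + 1 : ℤ) ≡ r [ZMOD (t : ℤ)] ↔ j ≡ v [MOD t] := by
    intro j
    rw [← Int.natCast_modEq_iff, hvr]
    have h1 : (r - 1) % t ≡ r - 1 [ZMOD t] := Int.mod_modEq _ _
    constructor
    · intro h
      have h2 := h.sub_right 1
      rw [add_sub_cancel_right] at h2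
      exact h2.trans h1.symm
    · intro h
      have h2 := (h.trans h1).add_right 1
      rwa [sub_add_cancel] at h2
  have hH : ∀ N, ∑ n ∈ Finset.range N, ee r t n =
      (Nat.count (· ≡ v [MOD t]) (Nat.count Nat.Prime N) : ℝ) - (Nat.count Nat.Prime N : ℝ) / t := by
    intro N
    induction N with
    | zero => simp
    | succ N ih =>
      rw [Finset.sum_range_succ, ih, Nat.count_succ]
      by_cases hN : N.Prime
      · rw [if_pos hN, Nat.count_succ]
        unfold ee
        rw [if_pos hN]
        have := (idx_iff (r := r) (t := t) hN).trans (hiff _)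
        by_cases h : idx r t N
        · rw [if_pos h, if_pos (this.1 h)]; push_cast; ring
        · rw [if_neg h, if_neg (fun h' => h (this.2 h'))]; push_cast; ring
      · have h : ¬ idx r t N := fun h => hN (idx_prime h)
        simp [ee, hN, h]
  rw [hH]
  set k := Nat.count Nat.Prime N
  rw [Nat.count_modEq_card k (by omega)]
  have hdm := Nat.div_add_mod k t
  have hlt := Nat.mod_lt k (show t > 0 by omega)
  have hT : (0 : ℝ) < t := by exact_mod_cast ht
  have hk : (k : ℝ) / t = (k / t : ℕ) + ((k % t : ℕ) : ℝ) / t := by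
    field_simp
    exact_mod_cast hdm.symm
  have h1 : 0 ≤ ((k % t : ℕ) : ℝ) / t := by positivity
  have h2 : ((k % t : ℕ) : ℝ) / t ≤ 1 := by
    rw [div_le_one hT]; exact_mod_cast hlt.le
  rw [hk, abs_le]
  push_cast
  split_ifs <;> constructor <;> linarith

lemma ee_block (r : ℤ) (t : ℕ) (ht : 1 ≤ t) (a c : ℕ) (ha : 1 ≤ a) :
    |∑ n ∈ Finset.Ico a c, ee r t n * (1 / (n : ℝ))| ≤ 2 * (1 / (a : ℝ)) := by
  rw [Finset.sum_Ico_eq_sum_range]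
  have ha0 : (0 : ℝ) < a := by exact_mod_cast ha
  have h := abel_bound (fun i => ee r t (a + i)) (fun i => 1 / ((a + i : ℕ) : ℝ)) 2 ?_ ?_ ?_ (c - a)
  · simpa using h
  · intro k
    have h1 : ∑ i ∈ Finset.range k, ee r t (a + i) =
        ∑ n ∈ Finset.range (a + k), ee r t n - ∑ n ∈ Finset.range a, ee r t n := by
      rw [Finset.sum_range_add]; ring
    rw [h1]
    have h2 := ee_sum r t ht (a + k)
    have h3 := ee_sum r t ht a
    refine (abs_sub _ _).trans (by linarith)
  · intro i
    push_cast
    gcongr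
    linarith
  · intro i; positivity

/-- block condition -/
def inB (b S n : ℕ) : Prop := ∃ u : ℕ, S * b ^ u ≤ n ∧ n < (S + 1) * b ^ u

open Classical in
lemma ee_total (r : ℤ) (t : ℕ) (ht : 1 ≤ t) (b S : ℕ) (hb : 2 ≤ b) (hS : 1 ≤ S) (N : ℕ) :
    |∑ n ∈ Finset.range N, (if inB b S n then ee r t n * (1 / (n : ℝ)) else 0)| ≤ 4 := by
  have h1 : ∀ n ∈ Finset.range N, (if inB b S n then ee r t n * (1 / (n : ℝ)) else 0) =
      ∑ u ∈ Finset.range N, if S * b ^ u ≤ n ∧ n < (S + 1) * b ^ u then ee r t n * (1 / (n : ℝ)) else 0 := by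
    intro n hn
    rw [Finset.mem_range] at hn
    split_ifs with h
    · obtain ⟨u, hu1, hu2⟩ := h
      have huN : u < N := by
        have h3 : u < b ^ u := Nat.lt_pow_self (by omega)
        have h4 : 1 * b ^ u ≤ S * b ^ u := Nat.mul_le_mul_right _ hS
        omega
      rw [Finset.sum_eq_single u, if_pos ⟨hu1, hu2⟩]
      · intro v _ hvu
        rw [if_neg]
        have key : ∀ u v : ℕ, u < v → (S + 1) * b ^ u ≤ S * b ^ v := by
          intro u v huv
          calc (S + 1) * b ^ u ≤ (S * b) * b ^ u := by
                apply Nat.mul_le_mul_right; nlinarith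
            _ = S * b ^ (u + 1) := by rw [pow_succ]; ring
            _ ≤ S * b ^ v := by
                apply Nat.mul_le_mul_left
                exact Nat.pow_le_pow_right (by omega) huv
        rintro ⟨hv1, hv2⟩
        rcases lt_or_gt_of_ne hvu with h | h
        · have := key v u h; omega
        · have := key u v h; omega
      · intro h; exact absurd (Finset.mem_range.2 huN) h
    · symm
      apply Finset.sum_eq_zero
      intro u _
      rw [if_neg]
      exact fun h' => h ⟨u, h'⟩
  rw [Finset.sum_congr rfl h1, Finset.sum_comm]
  have h2 : ∀ u ∈ Finset.range N, |∑ n ∈ Finset.range N, if S * b ^ u ≤ n ∧ n < (S + 1) * b ^ u then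
      ee r t n * (1 / (n : ℝ)) else 0| ≤ 2 * (1 / 2 : ℝ) ^ u := by
    intro u _
    rw [← Finset.sum_filter]
    have h3 : (Finset.range N).filter (fun n => S * b ^ u ≤ n ∧ n < (S + 1) * b ^ u) =
        Finset.Ico (S * b ^ u) (min ((S + 1) * b ^ u) N) := by
      ext n; simp only [Finset.mem_filter, Finset.mem_range, Finset.mem_Ico, lt_min_iff]; tauto
    rw [h3]
    have hpos : 1 ≤ S * b ^ u := Nat.mul_pos hS (Nat.pow_pos (by omega))
    refine (ee_block r t ht _ _ hpos).trans ?_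
    rw [one_div_pow]
    have : (2 : ℝ) ^ u ≤ (S * b ^ u : ℕ) := by
      have h4 : 2 ^ u ≤ S * b ^ u := by
        calc 2 ^ u ≤ b ^ u := Nat.pow_le_pow_left hb u
          _ ≤ S * b ^ u := Nat.le_mul_of_pos_left _ hS
      exact_mod_cast h4
    gcongr
  refine (Finset.abs_sum_le_sum_abs _ _).trans ((Finset.sum_le_sum h2).trans ?_)
  rw [← Finset.mul_sum]
  have h5 : ∑ u ∈ Finset.range N, (1 / 2 : ℝ) ^ u ≤ 2 := by
    refine le_trans ?_ tsum_geometric_two.le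
    exact summable_geometric_two.sum_le_tsum _ (fun _ _ => by positivity)
  linarith

open Classical in
noncomputable def gA (b S n : ℕ) : ℝ :=
  if n.Prime ∧ ((Real.log n : ℝ) : AddCircle (Real.log b)) ∈ arc (Real.log b) (Real.log S) (Real.log ((S : ℝ) + 1))
    then 1 / (n : ℝ) else 0

lemma gA_nonneg (b S n : ℕ) : 0 ≤ gA b S n := by
  unfold gA; split_ifs <;> positivity

lemma gA_tendsto (b S : ℕ) (hb : 2 ≤ b) (hS : 1 ≤ S) :
    Tendsto (fun x : ℝ => (∑ n ∈ Finset.range (⌊x⌋₊ + 1), gA b S n) / Real.log (Real.log x)) atTop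
      (𝓝 (Real.logb b (1 + 1 / (S : ℝ)))) := by
  classical
  have hb1 : (2 : ℝ) ≤ b := by exact_mod_cast hb
  have hS1 : (1 : ℝ) ≤ S := by exact_mod_cast hS
  have hT0 : 0 < Real.log b := Real.log_pos (by linarith)
  haveI : Fact (0 < Real.log b) := ⟨hT0⟩
  refine tauber _ (gA_nonneg b S) (by simp [gA]) ?_ _ ?_
  · intro δ hδ
    refine Summable.of_nonneg_of_le (fun n => mul_nonneg (gA_nonneg b S n) (by positivity)) ?_
      (Real.summable_nat_rpow.2 (show -(1 + δ) < -1 by linarith))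
    intro n
    unfold gA
    split_ifs with h
    · have hn : (0 : ℝ) < n := by exact_mod_cast h.1.pos
      rw [neg_add, Real.rpow_add hn, Real.rpow_neg_one, one_div]
    · rw [zero_mul]; positivity
  · have h1 : Real.log S < Real.log ((S : ℝ) + 1) := Real.log_lt_log (by linarith) (by linarith)
    have h2 : Real.log ((S : ℝ) + 1) ≤ Real.log S + Real.log b := by
      rw [← Real.log_mul (by linarith) (by linarith)]
      apply Real.log_le_log (by linarith)
      nlinarith
    have h3 := (arc_tendsto (T := Real.log b) _ _ h1 h2).mul Zp_tendsto
    have h4 : (Real.log ((S : ℝ) + 1) - Real.log S) / Real.log b * 1 = Real.logb b (1 + 1 / (S : ℝ)) := by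
      rw [mul_one, ← Real.log_div (by linarith) (by linarith), Real.logb]
      congr 2
      field_simp
    rw [h4] at h3
    refine h3.congr' ?_
    filter_upwards [self_mem_nhdsWithin, log_one_div_tendsto.eventually_gt_atTop 0] with δ hδ hl
    have hδ0 : 0 < δ := hδ
    have hZ := Zp_pos hδ0
    have h5 : (∑' p : Nat.Primes, if ((Real.log p.1 : ℝ) : AddCircle (Real.log b)) ∈ arc (Real.log b) (Real.log S) (Real.log ((S : ℝ) + 1))
      then (p.1 : ℝ) ^ (-(1 + δ)) else 0) = ∑' n : ℕ, gA b S n * (n : ℝ) ^ (-δ) := by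
      have h6 := tsum_subtype {p : ℕ | p.Prime} (fun n : ℕ => gA b S n * (n : ℝ) ^ (-δ))
      have h7 : ∀ n, Set.indicator {p : ℕ | p.Prime} (fun n : ℕ => gA b S n * (n : ℝ) ^ (-δ)) n = gA b S n * (n : ℝ) ^ (-δ) := by
        intro n
        rw [Set.indicator_apply]
        split_ifs with h
        · rfl
        · have h' : ¬ n.Prime := h
          simp [gA, h']
      rw [← tsum_congr h7, ← h6]
      refine tsum_congr (β := Nat.Primes) fun p => ?_
      have hp := p.2
      have hn : (0 : ℝ) < p.1 := by exact_mod_cast hp.pos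
      unfold gA
      by_cases h : ((Real.log p.1 : ℝ) : AddCircle (Real.log b)) ∈ arc (Real.log b) (Real.log S) (Real.log ((S : ℝ) + 1))
      · rw [if_pos h, if_pos ⟨hp, h⟩, neg_add, Real.rpow_add hn, Real.rpow_neg_one, one_div]
      · rw [if_neg h, if_neg (fun h' => h h'.2), zero_mul]
    rw [h5]
    field_simp

lemma arc_iff (b S p : ℕ) (hb : 2 ≤ b) (hS : 1 ≤ S) (hp : S ≤ p) :
    ((Real.log p : ℝ) : AddCircle (Real.log b)) ∈ arc (Real.log b) (Real.log S) (Real.log ((S : ℝ) + 1)) ↔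
      inB b S p := by
  have hb1 : (2 : ℝ) ≤ b := by exact_mod_cast hb
  have hS1 : (1 : ℝ) ≤ S := by exact_mod_cast hS
  have hp1 : (S : ℝ) ≤ p := by exact_mod_cast hp
  have hT0 : 0 < Real.log b := Real.log_pos (by linarith)
  have hpw : ∀ u : ℕ, (0 : ℝ) < (b : ℝ) ^ u := fun u => by positivity
  have e1 : ∀ u : ℕ, Real.log S ≤ Real.log p - u * Real.log b ↔ S * b ^ u ≤ p := by
    intro u
    rw [le_sub_iff_add_le, ← Real.log_pow, ← Real.log_mul (by linarith) (hpw u).ne',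
      Real.log_le_log_iff (mul_pos (by linarith) (hpw u)) (by linarith)]
    exact_mod_cast Iff.rfl
  have e2 : ∀ u : ℕ, Real.log p - u * Real.log b < Real.log ((S : ℝ) + 1) ↔ p < (S + 1) * b ^ u := by
    intro u
    rw [sub_lt_iff_lt_add, ← Real.log_pow, ← Real.log_mul (by linarith) (hpw u).ne',
      Real.log_lt_log_iff (by linarith) (mul_pos (by linarith) (hpw u))]
    exact_mod_cast Iff.rfl
  constructor
  · rintro ⟨y, hy, hyp⟩
    have h1 : ((Real.log p - y : ℝ) : AddCircle (Real.log b)) = 0 := by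
      rw [AddCircle.coe_sub, sub_eq_zero]; exact hyp.symm
    obtain ⟨n, hn⟩ := (AddCircle.coe_eq_zero_iff _).1 h1
    rw [zsmul_eq_mul] at hn
    have hn0 : 0 ≤ n := by
      by_contra hneg
      have h2 : (n : ℝ) ≤ -1 := by
        have : n ≤ -1 := by omega
        exact_mod_cast this
      have h3 : (n : ℝ) * Real.log b ≤ -1 * Real.log b := by gcongr
      have h4 : Real.log ((S : ℝ) + 1) ≤ Real.log S + Real.log b := by
        rw [← Real.log_mul (by linarith) (by linarith)]
        apply Real.log_le_log (by linarith)
        nlinarith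
      have h5 : Real.log S ≤ Real.log p := Real.log_le_log (by linarith) hp1
      linarith [hy.2]
    obtain ⟨u, rfl⟩ := Int.eq_ofNat_of_zero_le hn0
    push_cast at hn
    have hy' : y = Real.log p - u * Real.log b := by linarith
    rw [hy'] at hy
    exact ⟨u, (e1 u).1 hy.1, (e2 u).1 hy.2⟩
  · rintro ⟨u, hu1, hu2⟩
    refine ⟨Real.log p - u * Real.log b, ⟨(e1 u).2 hu1, (e2 u).2 hu2⟩, ?_⟩
    have h1 : ((Real.log p - u * Real.log b - Real.log p : ℝ) : AddCircle (Real.log b)) = 0 := by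
      rw [AddCircle.coe_eq_zero_iff]
      refine ⟨-u, ?_⟩
      rw [zsmul_eq_mul]; push_cast; ring
    rw [AddCircle.coe_sub, sub_eq_zero] at h1
    exact h1

open Classical in
lemma UQ_bound (r : ℤ) (t : ℕ) (ht : 1 ≤ t) (b S : ℕ) (hb : 2 ≤ b) (hS : 1 ≤ S) (N : ℕ) :
    |(∑ n ∈ Finset.range N, if idx r t n ∧ inB b S n then 1 / (n : ℝ) else 0) -
      (1 / (t : ℝ)) * ∑ n ∈ Finset.range N, gA b S n| ≤ 4 + S := by
  have h1 := ee_total r t ht b S hb hS N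
  have htt : (1 : ℝ) ≤ t := by exact_mod_cast ht
  have h2 : |∑ n ∈ Finset.range N, (1 / (t : ℝ)) *
      ((if n.Prime ∧ inB b S n then 1 / (n : ℝ) else 0) - gA b S n)| ≤ S := by
    refine (Finset.abs_sum_le_sum_abs _ _).trans ?_
    calc _ ≤ ∑ n ∈ Finset.range N, (if n < S then (1 : ℝ) else 0) := by
          refine Finset.sum_le_sum fun n _ => ?_
          have ht1 : |1 / (t : ℝ)| ≤ 1 := by
            rw [abs_of_nonneg (by positivity), div_le_one (by linarith)]; exact htt
          rw [abs_mul]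
          by_cases hn : n < S
          · rw [if_pos hn]
            have hle : (1 : ℝ) / n ≤ 1 := by
              rcases Nat.eq_zero_or_pos n with h | h
              · simp [h]
              · rw [div_le_one (by exact_mod_cast h)]; exact_mod_cast h
            have hnn : (0 : ℝ) ≤ 1 / n := by positivity
            have h3 : |(if n.Prime ∧ inB b S n then 1 / (n : ℝ) else 0) - gA b S n| ≤ 1 := by
              unfold gA
              rw [abs_le]
              split_ifs <;> constructor <;> linarith
            calc _ ≤ (1 : ℝ) * 1 := by gcongr
              _ = 1 := by ring
          · rw [if_neg hn]
            have h3 : (if n.Prime ∧ inB b S n then 1 / (n : ℝ) else 0) = gA b S n := by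
              unfold gA
              simp only [arc_iff b S n hb hS (by omega)]
            rw [h3]; simp
      _ = (((Finset.range N).filter (fun n => n < S)).card : ℝ) := by
          rw [← Finset.sum_filter]; simp
      _ ≤ S := by
          have : ((Finset.range N).filter (fun n => n < S)).card ≤ (Finset.range S).card := by
            apply Finset.card_le_card
            intro n hn
            exact Finset.mem_range.2 (Finset.mem_filter.1 hn).2
          rw [Finset.card_range] at this
          exact_mod_cast this
  have h3 : (∑ n ∈ Finset.range N, if idx r t n ∧ inB b S n then 1 / (n : ℝ) else 0) -
      (1 / (t : ℝ)) * ∑ n ∈ Finset.range N, gA b S n =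
      (∑ n ∈ Finset.range N, (if inB b S n then ee r t n * (1 / (n : ℝ)) else 0)) +
      ∑ n ∈ Finset.range N, (1 / (t : ℝ)) *
      ((if n.Prime ∧ inB b S n then 1 / (n : ℝ) else 0) - gA b S n) := by
    rw [Finset.mul_sum, ← Finset.sum_sub_distrib, ← Finset.sum_add_distrib]
    refine Finset.sum_congr rfl fun n _ => ?_
    unfold ee
    by_cases h : inB b S n <;> by_cases h' : n.Prime <;> by_cases h'' : idx r t n <;> simp [h, h', h''] <;> ring
  rw [h3]
  exact (abs_add_le _ _).trans (add_le_add h1 h2)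




/-- Example 1.6 of the paper: with `p_j` the `j`-th prime (`p_1 = 2`), the set of
primes `p_j` with `j ≡ r (mod t)` whose base-`b` expansion begins with the string `S`
has logarithmic density `(1/t) · log_b(1 + 1/S)`. -/
theorem benford_primes_in_index_AP
    (r : ℤ) (t : ℕ) (ht : 1 ≤ t)
    (b S m : ℕ) (hb : 2 ≤ b) (hm : 1 ≤ m)
    (hS₁ : b ^ (m - 1) ≤ S) (hS₂ : S < b ^ m) :
    Tendsto (fun x : ℝ =>
        (∑' p : {p : ℕ //
            (∃ j : ℕ, 1 ≤ j ∧ p = Nat.nth Nat.Prime (j - 1) ∧ (j : ℤ) ≡ r [ZMOD (t : ℤ)]) ∧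
            (∃ u : ℕ, S * b ^ u ≤ p ∧ p < (S + 1) * b ^ u) ∧ (p : ℝ) ≤ x},
          (1 : ℝ) / (p.1 : ℝ)) / Real.log (Real.log x))
      atTop (nhds ((1 / (t : ℝ)) * Real.logb b (1 + 1 / (S : ℝ)))) := by
  classical
  have hS : 1 ≤ S := le_trans (Nat.one_le_pow _ _ (by omega)) hS₁
  have hll : Tendsto (fun x : ℝ => Real.log (Real.log x)) atTop atTop :=
    Real.tendsto_log_atTop.comp Real.tendsto_log_atTop
  have h1 := (gA_tendsto b S hb hS).const_mul (1 / (t : ℝ))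
  have h2 := bdd_div_tendsto (l := atTop) (C := 4 + S)
    (f := fun x : ℝ => (∑ n ∈ Finset.range (⌊x⌋₊ + 1), if idx r t n ∧ inB b S n then 1 / (n : ℝ) else 0) -
      (1 / (t : ℝ)) * ∑ n ∈ Finset.range (⌊x⌋₊ + 1), gA b S n)
    (Eventually.of_forall fun x => UQ_bound r t ht b S hb hS (⌊x⌋₊ + 1)) hll
  have h3 := h2.add h1
  rw [zero_add] at h3
  refine h3.congr' ?_
  filter_upwards [eventually_ge_atTop 0] with x hx
  have h4 : (∑' p : {p : ℕ //
            (∃ j : ℕ, 1 ≤ j ∧ p = Nat.nth Nat.Prime (j - 1) ∧ (j : ℤ) ≡ r [ZMOD (t : ℤ)]) ∧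
            (∃ u : ℕ, S * b ^ u ≤ p ∧ p < (S + 1) * b ^ u) ∧ (p : ℝ) ≤ x},
          (1 : ℝ) / (p.1 : ℝ)) =
      ∑ n ∈ Finset.range (⌊x⌋₊ + 1), if idx r t n ∧ inB b S n then 1 / (n : ℝ) else 0 := by
    have h5 := tsum_subtype {p : ℕ | idx r t p ∧ inB b S p ∧ (p : ℝ) ≤ x} (fun n : ℕ => (1 : ℝ) / (n : ℝ))
    refine h5.trans ?_
    rw [tsum_eq_sum (s := Finset.range (⌊x⌋₊ + 1))]
    · refine Finset.sum_congr rfl fun n hn => ?_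
      have hn' : (n : ℝ) ≤ x := by
        rw [Finset.mem_range, Nat.lt_succ_iff] at hn
        exact (Nat.cast_le.2 hn).trans (Nat.floor_le hx)
      rw [Set.indicator_apply]
      simp only [Set.mem_setOf_eq, hn', and_true]
    · intro n hn
      rw [Set.indicator_of_notMem]
      rintro ⟨_, _, h⟩
      apply hn
      rw [Finset.mem_range, Nat.lt_succ_iff]
      exact Nat.le_floor h
  rw [h4]
  ring
end
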